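/- arXiv:1905.03317 — 3 statements merged into one kernel-verified Lean document; each statement's English description precedes it below -/
import Mathlib

section
/- Let ε>0. There is a constant C>0 such that for all N large enough and all s with N^{−1/3+ε} ≤ s ≤ 1, the two largest eigenvalues λ₁≥λ₂ of an N×N GOE matrix H (and likewise of the zero-diagonal matrix M) satisfy P( N^{2/3}(λ₁−λ₂) < s ) ≤ C·s·N^{ε}. -/
open MeasureTheory Complex ProbabilityTheory
open scoped RealInnerProductSpace BigOperators

noncomputable section

abbrev ESp (N : ℕ) := EuclideanSpace ℝ (Fin N)

/-- Surface (uniform, up to normalization) measure on the unit sphere of `ℝ^N`. -/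
def sphereMeas (N : ℕ) : Measure (Metric.sphere (0 : ESp N) 1) :=
  (volume : Measure (ESp N)).toSphere

/-- Gibbs weight `exp((β/2)⟨σ, Mσ⟩)` where `σ = √N · x` and `x` is on the unit sphere. -/
def gibbsWeight (N : ℕ) (β : ℝ) (M : Matrix (Fin N) (Fin N) ℝ)
    (x : Metric.sphere (0 : ESp N) 1) : ℝ :=
  Real.exp ((β * N / 2) * ⟪(x : ESp N), Matrix.toEuclideanLin M (x : ESp N)⟫)

/-- Gibbs expectation of a two-replica observable `φ` (in unit-sphere coordinates). -/
def gibbsExpect (N : ℕ) (β : ℝ) (M : Matrix (Fin N) (Fin N) ℝ)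
    (φ : ESp N → ESp N → ℝ) : ℝ :=
  (∫ x, ∫ y, gibbsWeight N β M x * gibbsWeight N β M y * φ (x : ESp N) (y : ESp N)
      ∂(sphereMeas N) ∂(sphereMeas N))
   / (∫ x, gibbsWeight N β M x ∂(sphereMeas N)) ^ 2

/-- Overlap `R₁₂ = σ⁽¹⁾·σ⁽²⁾/N` in unit-sphere coordinates. -/
def overlapFn (N : ℕ) (x y : ESp N) : ℝ := ⟪x, y⟫

/-- The function `G(z) = βz - N⁻¹ ∑ log(z - λᵢ)` (principal branch). -/
def Gfn (N : ℕ) (β : ℝ) (lam : Fin N → ℝ) (z : ℂ) : ℂ :=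
  β * z - (1 / (N : ℂ)) * ∑ i, Complex.log (z - lam i)

/-- `∫_{γ-i∞}^{γ+i∞} f(z) dz` parametrized as `i ∫_ℝ f(γ+it) dt`. -/
def lineInt (γ : ℝ) (f : ℂ → ℂ) : ℂ := Complex.I * ∫ t : ℝ, f (γ + t * Complex.I)

def lineInt2 (γ : ℝ) (F : ℂ → ℂ → ℂ) : ℂ :=
  Complex.I * Complex.I * ∫ t : ℝ, ∫ s : ℝ, F (γ + t * Complex.I) (γ + s * Complex.I)

/-- Semicircle density. -/
def rhoSC (x : ℝ) : ℝ := Real.sqrt (max (4 - x ^ 2) 0) / (2 * Real.pi)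

/-- iid standard Gaussian coefficients `g_{ij}`. -/
def gMeasure (N : ℕ) : Measure (Fin N → Fin N → ℝ) :=
  Measure.pi fun _ => Measure.pi fun _ => gaussianReal 0 1

/-- GOE matrix built from iid standard Gaussians. -/
def Hmat (N : ℕ) (g : Fin N → Fin N → ℝ) : Matrix (Fin N) (Fin N) ℝ :=
  fun i j => if i = j then Real.sqrt (2 / N) * g i i else (g i j + g j i) / Real.sqrt (2 * N)

/-- GOE matrix with zero diagonal. -/
def Mmat (N : ℕ) (g : Fin N → Fin N → ℝ) : Matrix (Fin N) (Fin N) ℝ :=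
  fun i j => if i = j then 0 else (g i j + g j i) / Real.sqrt (2 * N)

lemma Hmat_isHermitian (N : ℕ) (g : Fin N → Fin N → ℝ) : (Hmat N g).IsHermitian := by
  unfold Matrix.IsHermitian
  ext i j
  simp only [Matrix.conjTranspose_apply, star_trivial, Hmat]
  by_cases h : i = j
  · subst h; rfl
  · rw [if_neg fun hh => h hh.symm, if_neg h]; ring

lemma Mmat_isHermitian (N : ℕ) (g : Fin N → Fin N → ℝ) : (Mmat N g).IsHermitian := by
  unfold Matrix.IsHermitian
  ext i j
  simp only [Matrix.conjTranspose_apply, star_trivial, Mmat]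
  by_cases h : i = j
  · subst h; rfl
  · rw [if_neg fun hh => h hh.symm, if_neg h]; ring

/-- Eigenvalues of a real symmetric matrix, in decreasing order. -/
def evalsDesc {N : ℕ} {A : Matrix (Fin N) (Fin N) ℝ} (hA : A.IsHermitian) : Fin N → ℝ :=
  fun i => - (fun j => - hA.eigenvalues j) ((Tuple.sort fun j => - hA.eigenvalues j) i)

/-- Decreasing eigenvalues of the GOE matrix. -/
def evalsH (N : ℕ) (g : Fin N → Fin N → ℝ) : Fin N → ℝ := evalsDesc (Hmat_isHermitian N g)

/-- Decreasing eigenvalues of the zero-diagonal GOE matrix. -/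
def evalsM (N : ℕ) (g : Fin N → Fin N → ℝ) : Fin N → ℝ := evalsDesc (Mmat_isHermitian N g)

/-- `m̃_N(w) = N⁻¹ ∑_{j≥2} (λ_j - w)⁻¹`. -/
def mtil (N : ℕ) (lam : Fin N → ℝ) (w : ℝ) : ℝ :=
  (1 / (N:ℝ)) * ∑ j ∈ Finset.univ.filter (fun j : Fin N => (j : ℕ) ≠ 0), 1 / (lam j - w)

/-- `m̃_N'(w) = N⁻¹ ∑_{j≥2} (λ_j - w)⁻²`. -/
def mtil' (N : ℕ) (lam : Fin N → ℝ) (w : ℝ) : ℝ :=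
  (1 / (N:ℝ)) * ∑ j ∈ Finset.univ.filter (fun j : Fin N => (j : ℕ) ≠ 0), 1 / (lam j - w) ^ 2

/-- Rigidity: `|λ_i - γ_i| ≤ N^{ε₁/10} min(i, N+1-i)^{-1/3} N^{-2/3}` (1-based `i`). -/
def rigidityCond (N : ℕ) (ε₁ : ℝ) (lam γcl : Fin N → ℝ) : Prop :=
  ∀ i : Fin N, |lam i - γcl i| ≤
    (N:ℝ) ^ (ε₁ / 10) * ((min ((i:ℕ)+1) (N - (i:ℕ)) : ℕ) : ℝ) ^ (-(1:ℝ)/3) * (N:ℝ) ^ (-(2:ℝ)/3)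

/-- Classical locations: `∫_{-2}^{γ_i} ρ_sc = i/N` (1-based `i`). -/
def classicalLoc (N : ℕ) (γcl : Fin N → ℝ) : Prop :=
  ∀ i : Fin N, ∫ x in (-2:ℝ)..(γcl i), rhoSC x = (((i:ℕ) + 1 : ℕ) : ℝ) / N

/-- Keyhole contour integral around `-b`: rays below/above `(-∞, -b-r)` plus the
counterclockwise circle of radius `r`, for an integrand `f(z)·(z+b)^s`
(principal branch, boundary values on the rays). -/
def keyholeInt (b r : ℝ) (s : ℂ) (f : ℂ → ℂ) : ℂ :=
  (∫ x in Set.Iio (-b - r),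
      f x * Complex.exp (s * Real.log (-(x + b))) * Complex.exp (-(Real.pi:ℂ) * s * Complex.I))
  + (∫ θ in (-Real.pi)..Real.pi,
      f (-b + r * Complex.exp (θ * Complex.I)) *
        Complex.exp (s * ((Real.log r : ℂ) + θ * Complex.I)) *
        (Complex.I * r * Complex.exp (θ * Complex.I)))
  - (∫ x in Set.Iio (-b - r),
      f x * Complex.exp (s * Real.log (-(x + b))) * Complex.exp ((Real.pi:ℂ) * s * Complex.I))

/-- Integral over the contour `Γ̂ = Γ₁ ∪ Γ₃` (counterclockwise around the branch cut). -/
def hatInt (X η₀ : ℝ) (ηf ηf' : ℝ → ℝ) (F : ℂ → ℂ) : ℂ :=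
  (-Complex.I) * (∫ t in (0:ℝ)..η₀, F (-X - t * Complex.I))
  + (∫ E in (-X)..(0:ℝ), F (E - ηf E * Complex.I) * (1 - ηf' E * Complex.I))
  - (∫ E in (-X)..(0:ℝ), F (E + ηf E * Complex.I) * (1 + ηf' E * Complex.I))
  - Complex.I * (∫ t in (0:ℝ)..η₀, F (-X + t * Complex.I))

def hatInt2 (X η₀ : ℝ) (ηf ηf' : ℝ → ℝ) (F : ℂ → ℂ → ℂ) : ℂ :=
  hatInt X η₀ ηf ηf' fun z => hatInt X η₀ ηf ηf' fun w => F z w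

/-- Resolvent of a real matrix at complex spectral parameter. -/
def resolventM (N : ℕ) (A : Matrix (Fin N) (Fin N) ℝ) (z : ℂ) : Matrix (Fin N) (Fin N) ℂ :=
  (A.map (fun x => (x : ℂ)) - z • (1 : Matrix (Fin N) (Fin N) ℂ))⁻¹

/-- Empirical Stieltjes transform `N⁻¹ tr (A - z)⁻¹`. -/
def stTrans (N : ℕ) (A : Matrix (Fin N) (Fin N) ℝ) (z : ℂ) : ℂ :=
  (1 / (N:ℂ)) * Matrix.trace (resolventM N A z)

/-- Stieltjes transform of the semicircle law. -/
def mSC (z : ℂ) : ℂ := ∫ x in (-2:ℝ)..2, (rhoSC x : ℂ) / ((x:ℂ) - z)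


set_option linter.unusedSectionVars false

/-- A Gaussian measure all of whose linear functionals have mean zero. -/
structure CenteredGaussian {E : Type*} [NormedAddCommGroup E] [NormedSpace ℝ E]
    [MeasurableSpace E] [BorelSpace E] (μ : Measure E) : Prop where
  gauss : IsGaussian μ
  mean : ∀ L : StrongDual ℝ E, ∫ x, L x ∂μ = 0

namespace CenteredGaussian

variable {E F : Type*} [NormedAddCommGroup E] [NormedSpace ℝ E] [MeasurableSpace E] [BorelSpace E]
  [CompleteSpace E] [SecondCountableTopology E]
  [NormedAddCommGroup F] [NormedSpace ℝ F] [MeasurableSpace F] [BorelSpace F]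
  [CompleteSpace F] [SecondCountableTopology F]
  {μ : Measure E} {ν : Measure F}

lemma integrable_dual (h : CenteredGaussian μ) (L : StrongDual ℝ E) :
    Integrable (fun x => L x) μ :=
  have := h.gauss
  IsGaussian.integrable_dual μ L

lemma memLp_dual (h : CenteredGaussian μ) (L : StrongDual ℝ E) {p : ENNReal} (hp : p ≠ ⊤) :
    MemLp (fun x => L x) p μ :=
  have := h.gauss
  IsGaussian.memLp_dual μ L p hp

lemma integrable_dual_mul (h : CenteredGaussian μ) (L L' : StrongDual ℝ E) :
    Integrable (fun x => L x * L' x) μ :=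
  (h.memLp_dual L (p := 2) (by simp)).integrable_mul (h.memLp_dual L' (p := 2) (by simp))

lemma ext {ν : Measure E} (h : CenteredGaussian μ) (h' : CenteredGaussian ν)
    (hv : ∀ L : StrongDual ℝ E, ∫ x, L x ^ 2 ∂μ = ∫ x, L x ^ 2 ∂ν) : μ = ν := by
  have := h.gauss
  have := h'.gauss
  refine Measure.ext_of_charFunDual ?_
  ext L
  have hL : AEMeasurable (fun x => L x) μ := (by fun_prop : Measurable fun x => L x).aemeasurable
  have hL' : AEMeasurable (fun x => L x) ν := (by fun_prop : Measurable fun x => L x).aemeasurable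
  rw [IsGaussian.charFunDual_eq, IsGaussian.charFunDual_eq,
    variance_of_integral_eq_zero hL (h.mean L), variance_of_integral_eq_zero hL' (h'.mean L)]
  have e1 := h.mean L
  have e2 := h'.mean L
  simp only [integral_complex_ofReal, hv L]
  rw [e1, e2]

lemma map (h : CenteredGaussian μ) (T : E →L[ℝ] F) : CenteredGaussian (μ.map T) := by
  have := h.gauss
  refine ⟨inferInstance, fun L => ?_⟩
  rw [integral_map (by fun_prop) (by fun_prop)]
  exact h.mean (L.comp T)

lemma prod (h : CenteredGaussian μ) (h' : CenteredGaussian ν) :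
    CenteredGaussian (μ.prod ν) := by
  have := h.gauss
  have := h'.gauss
  refine ⟨inferInstance, fun L => ?_⟩
  have hL : ∀ x : E × F, L x = L.comp (.inl ℝ E F) x.1 + L.comp (.inr ℝ E F) x.2 := by
    intro x
    simp [← map_add]
  simp_rw [hL]
  rw [integral_add ((h.integrable_dual _).comp_fst ν) ((h'.integrable_dual _).comp_snd μ),
    integral_fun_fst (fun x => L.comp (.inl ℝ E F) x),
    integral_fun_snd (fun x => L.comp (.inr ℝ E F) x), h.mean, h'.mean]
  simp

lemma integral_sq_prod (h : CenteredGaussian μ) (h' : CenteredGaussian ν)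
    (L : StrongDual ℝ E) (L' : StrongDual ℝ F) :
    ∫ x, (L x.1 + L' x.2) ^ 2 ∂(μ.prod ν) = ∫ x, L x ^ 2 ∂μ + ∫ x, L' x ^ 2 ∂ν := by
  have := h.gauss
  have := h'.gauss
  have e : ∀ x : E × F, (L x.1 + L' x.2) ^ 2 = L x.1 ^ 2 + 2 * (L x.1 * L' x.2) + L' x.2 ^ 2 :=
    fun x => by ring
  have i1 : Integrable (fun x => L x ^ 2) μ := (h.memLp_dual L (by simp)).integrable_sq
  have i2 : Integrable (fun x => L' x ^ 2) ν := (h'.memLp_dual L' (by simp)).integrable_sq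
  have i3 : Integrable (fun x : E × F => 2 * (L x.1 * L' x.2)) (μ.prod ν) :=
    ((h.integrable_dual L).mul_prod (h'.integrable_dual L')).const_mul 2
  simp_rw [e]
  have i4 : Integrable (fun x : E × F => L x.1 ^ 2 + 2 * (L x.1 * L' x.2)) (μ.prod ν) :=
    (i1.comp_fst ν).add i3
  rw [integral_add i4 (i2.comp_snd μ), integral_add (i1.comp_fst ν) i3,
    integral_const_mul, integral_prod_mul (fun x => L x) (fun x => L' x), h.mean,
    integral_fun_fst (fun x => L x ^ 2), integral_fun_snd (fun x => L' x ^ 2)]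
  simp

lemma real : CenteredGaussian (gaussianReal 0 1) := by
  refine ⟨inferInstance, fun L => ?_⟩
  have : ∀ x : ℝ, L x = x * L 1 := fun x => by
    rw [← smul_eq_mul, ← map_smul, smul_eq_mul, mul_one]
  rw [integral_congr_ae (ae_of_all _ this), integral_mul_const, integral_id_gaussianReal]
  simp

section pi
variable {ι : Type*} [Fintype ι] [DecidableEq ι] {P : ι → Measure E}

lemma pi (h : ∀ i, CenteredGaussian (P i)) : CenteredGaussian (Measure.pi P) := by
  have := fun i => (h i).gauss
  have hg : IsGaussian (Measure.pi P) := by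
    have hi : iIndepFun (fun i (ω : ι → E) => ω i) (Measure.pi P) :=
      iIndepFun_pi (X := fun _ x => x) (fun i => by fun_prop)
    have := iIndepFun.hasGaussianLaw (X := fun i (ω : ι → E) => ω i) (fun i => ⟨by
      rw [show (fun ω : ι → E => ω i) = Function.eval i from rfl,
        (measurePreserving_eval P i).map_eq]
      infer_instance⟩) hi
    have h2 := this.isGaussian_map
    rwa [show (fun ω : ι → E => fun i => ω i) = id from rfl, Measure.map_id] at h2
  refine ⟨hg, fun L => ?_⟩
  have hL : ∀ x : ι → E, L x = ∑ i, L.comp (.single ℝ (fun _ => E) i) (x i) := by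
    intro x
    simp [← map_sum, Finset.univ_sum_single]
  simp_rw [hL]
  have hint : ∀ i, Integrable (fun x : ι → E => L.comp (.single ℝ (fun _ => E) i) (x i))
      (Measure.pi P) := fun i =>
    (measurePreserving_eval P i).integrable_comp_of_integrable ((h i).integrable_dual _)
  rw [integral_finsetSum _ fun i _ => hint i]
  refine Finset.sum_eq_zero fun i _ => ?_
  rw [integral_comp_eval (X := fun _ => E) (μ := P) (i := i)
    (f := fun y => L.comp (.single ℝ (fun _ => E) i) y)
    (by fun_prop), (h i).mean]

lemma integral_sq_pi (h : ∀ i, CenteredGaussian (P i)) (L : ι → StrongDual ℝ E) :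
    ∫ x, (∑ i, L i (x i)) ^ 2 ∂(Measure.pi P) = ∑ i, ∫ x, L i x ^ 2 ∂(P i) := by
  have := fun i => (h i).gauss
  have hpi := pi h
  let M : ι → StrongDual ℝ (ι → E) := fun i => (L i).comp (.proj i)
  have hM : ∀ i x, L i (x i) = M i x := fun i x => rfl
  have hi : iIndepFun (fun i (ω : ι → E) => L i (ω i)) (Measure.pi P) :=
    iIndepFun_pi (X := fun i x => L i x) (fun i => by fun_prop)
  have e : ∀ x : ι → E, (∑ i, L i (x i)) ^ 2 = ∑ i, ∑ j, M i x * M j x := fun x => by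
    rw [sq, Finset.sum_mul_sum]; rfl
  simp_rw [e]
  rw [integral_finsetSum _ fun i _ => integrable_finsetSum _ fun j _ =>
    hpi.integrable_dual_mul _ _]
  refine Finset.sum_congr rfl fun i _ => ?_
  rw [integral_finsetSum _ fun j _ => hpi.integrable_dual_mul _ _, Finset.sum_eq_single i]
  · rw [← integral_comp_eval (μ := P) (i := i) (f := fun y => L i y ^ 2) (by fun_prop)]
    refine integral_congr_ae (ae_of_all _ fun x => ?_)
    simp only [sq, hM]
  · intro j _ hj
    have := (hi.indepFun hj.symm).integral_mul_eq_mul_integral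
      (hpi.integrable_dual (M i)).aestronglyMeasurable
      (hpi.integrable_dual (M j)).aestronglyMeasurable
    have e2 : ∫ x, M i x * M j x ∂(Measure.pi P) =
      (∫ x, M i x ∂(Measure.pi P)) * ∫ x, M j x ∂(Measure.pi P) := this
    rw [e2, hpi.mean, zero_mul]
  · simp

end pi

end CenteredGaussian

section LogSumExp

variable {ι : Type*} [Fintype ι]

lemma abs_log_sum_mul_exp_sub_le (p w : ι → ℝ) (hp : ∀ i, 0 ≤ p i) (hp1 : ∑ i, p i = 1) {M : ℝ}
    (hw : ∀ i, |w i| ≤ M) :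
    |Real.log (∑ i, p i * Real.exp (w i)) - ∑ i, p i * w i
      - (∑ i, p i * w i ^ 2 - (∑ i, p i * w i) ^ 2) / 2| ≤ 40 * M ^ 3 := by
  have hne : Nonempty ι := by
    by_contra h
    rw [not_nonempty_iff] at h
    simp at hp1
  have hM : 0 ≤ M := (abs_nonneg _).trans (hw hne.some)
  set m := ∑ i, p i * w i with hm
  set q := ∑ i, p i * w i ^ 2 with hq
  have avg : ∀ (f : ι → ℝ) (c : ℝ), (∀ i, |f i| ≤ c) → |∑ i, p i * f i| ≤ c := by
    intro f c hf
    calc |∑ i, p i * f i| ≤ ∑ i, |p i * f i| := Finset.abs_sum_le_sum_abs _ _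
      _ ≤ ∑ i, p i * c := Finset.sum_le_sum fun i _ => by
          rw [abs_mul, abs_of_nonneg (hp i)]
          exact mul_le_mul_of_nonneg_left (hf i) (hp i)
      _ = c := by rw [← Finset.sum_mul, hp1, one_mul]
  have m_le : |m| ≤ M := avg w M hw
  have q_le : |q| ≤ M ^ 2 := avg (fun i => w i ^ 2) _ fun i => by
    rw [abs_pow]
    exact pow_le_pow_left₀ (abs_nonneg _) (hw i) 2
  have q0 : 0 ≤ q := Finset.sum_nonneg fun i _ => mul_nonneg (hp i) (sq_nonneg _)
  rw [abs_of_nonneg q0] at q_le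
  have m2 : m ^ 2 ≤ M ^ 2 := sq_le_sq' (by linarith [(abs_le.1 m_le).1]) (abs_le.1 m_le).2
  rcases le_or_gt M (1 / 4) with hs | hs
  · set r := ∑ i, p i * (Real.exp (w i) - (1 + w i + w i ^ 2 / 2)) with hr
    have r_le : |r| ≤ M ^ 3 / 4 := avg _ _ fun i => by
      have := Real.exp_bound (x := w i) ((hw i).trans (by linarith)) (n := 3) (by norm_num)
      norm_num [Finset.sum_range_succ, Nat.factorial] at this
      refine this.trans ?_
      have := pow_le_pow_left₀ (abs_nonneg _) (hw i) 3
      have h0 := pow_nonneg hM 3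
      linarith
    set u := m + q / 2 + r with hu
    have hsum : ∑ i, p i * Real.exp (w i) = 1 + u := by
      have : ∀ i, p i * Real.exp (w i) = p i + p i * w i + p i * w i ^ 2 / 2
        + p i * (Real.exp (w i) - (1 + w i + w i ^ 2 / 2)) := fun i => by ring
      rw [Finset.sum_congr rfl fun i _ => this i, Finset.sum_add_distrib, Finset.sum_add_distrib,
        Finset.sum_add_distrib, hp1, ← Finset.sum_div]
      ring
    rw [hsum]
    have hM2 : M ^ 2 ≤ M / 4 := by nlinarith
    have hM3 : M ^ 3 ≤ M / 16 := by nlinarith [mul_nonneg hM (sq_nonneg M)]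
    have hM30 : 0 ≤ M ^ 3 := pow_nonneg hM 3
    have u_le : |u| ≤ 1.15 * M := by
      rw [abs_le] at *
      constructor <;> linarith
    have hlog := Real.abs_log_sub_add_sum_range_le (x := -u) (by rw [abs_neg]; linarith) 2
    norm_num [Finset.sum_range_succ] at hlog
    have hu3 : |u| ^ 3 / (1 - |u|) ≤ 2.3 * M ^ 3 := by
      rw [div_le_iff₀ (by linarith)]
      have h1 : |u| ^ 3 ≤ (1.15 * M) ^ 3 := pow_le_pow_left₀ (abs_nonneg _) u_le 3
      have h2 : 0.7 ≤ 1 - |u| := by linarith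
      have h3 : 2.3 * M ^ 3 * 0.7 ≤ 2.3 * M ^ 3 * (1 - |u|) :=
        mul_le_mul_of_nonneg_left h2 (by positivity)
      have h4 : (1.15 * M) ^ 3 = 1.520875 * M ^ 3 := by ring
      linarith
    have hdiff : |(u - m) * (u + m)| ≤ 1.3 * M ^ 3 := by
      rw [abs_mul]
      have h1 : |u - m| ≤ 0.57 * M ^ 2 := by
        have : u - m = q / 2 + r := by rw [hu]; ring
        rw [this]
        have h3 : M ^ 3 ≤ M ^ 2 / 4 := by nlinarith [sq_nonneg M]
        have h4 := sq_nonneg M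
        rw [abs_le] at *
        constructor <;> linarith
      have h2 : |u + m| ≤ 2.15 * M := by
        refine (abs_add_le _ _).trans ?_
        linarith
      calc |u - m| * |u + m| ≤ (0.57 * M ^ 2) * (2.15 * M) :=
            mul_le_mul h1 h2 (abs_nonneg _) (by positivity)
        _ ≤ 1.3 * M ^ 3 := by nlinarith
    have key : Real.log (1 + u) - m - (q - m ^ 2) / 2
        = (-u + u ^ 2 / 2 + Real.log (1 + u)) + r - (u - m) * (u + m) / 2 := by
      rw [hu]; ring
    rw [key]
    have h5 := hlog.trans hu3
    rw [abs_le] at *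
    constructor <;> linarith
  · have hlog : |Real.log (∑ i, p i * Real.exp (w i))| ≤ M := by
      have hlo : Real.exp (-M) ≤ ∑ i, p i * Real.exp (w i) := by
        calc Real.exp (-M) = ∑ i, p i * Real.exp (-M) := by rw [← Finset.sum_mul, hp1, one_mul]
          _ ≤ _ := Finset.sum_le_sum fun i _ => mul_le_mul_of_nonneg_left
            (Real.exp_le_exp.2 (by linarith [(abs_le.1 (hw i)).1])) (hp i)
      have hhi : ∑ i, p i * Real.exp (w i) ≤ Real.exp M := by
        calc _ ≤ ∑ i, p i * Real.exp M := Finset.sum_le_sum fun i _ => mul_le_mul_of_nonneg_left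
              (Real.exp_le_exp.2 (by linarith [(abs_le.1 (hw i)).2])) (hp i)
          _ = Real.exp M := by rw [← Finset.sum_mul, hp1, one_mul]
      have hpos : 0 < ∑ i, p i * Real.exp (w i) := (Real.exp_pos _).trans_le hlo
      rw [abs_le]
      exact ⟨(Real.le_log_iff_exp_le hpos).2 hlo, (Real.log_le_iff_le_exp hpos).2 hhi⟩
    have h2 : M ≤ 16 * M ^ 3 := by nlinarith [mul_nonneg hM (sq_nonneg M)]
    have h3 : M ^ 2 ≤ 4 * M ^ 3 := by nlinarith [sq_nonneg M]
    have h4 := sq_nonneg m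
    rw [abs_le] at *
    constructor <;> linarith

/-- The log-sum-exp function. -/
def logSumExp (v : ι → ℝ) : ℝ := Real.log (∑ i, Real.exp (v i))

/-- The softmax weights. -/
def softmax (v : ι → ℝ) (i : ι) : ℝ := Real.exp (v i) / ∑ j, Real.exp (v j)

variable [Nonempty ι]

lemma sum_exp_pos (v : ι → ℝ) : 0 < ∑ i, Real.exp (v i) :=
  Finset.sum_pos (fun _ _ => Real.exp_pos _) Finset.univ_nonempty

lemma softmax_nonneg (v : ι → ℝ) (i : ι) : 0 ≤ softmax v i :=
  div_nonneg (Real.exp_pos _).le (sum_exp_pos v).le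

lemma sum_softmax (v : ι → ℝ) : ∑ i, softmax v i = 1 := by
  simp only [softmax]
  rw [← Finset.sum_div, div_self (sum_exp_pos v).ne']

lemma abs_logSumExp_taylor (v w : ι → ℝ) :
    |logSumExp (v + w) - logSumExp v - ∑ i, softmax v i * w i
      - (∑ i, softmax v i * w i ^ 2 - (∑ i, softmax v i * w i) ^ 2) / 2| ≤ 40 * ‖w‖ ^ 3 := by
  have h := abs_log_sum_mul_exp_sub_le (softmax v) w (softmax_nonneg v) (sum_softmax v)
    (M := ‖w‖) (fun i => norm_le_pi_norm w i)
  have e : logSumExp (v + w) - logSumExp v = Real.log (∑ i, softmax v i * Real.exp (w i)) := by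
    rw [logSumExp, logSumExp, ← Real.log_div (sum_exp_pos _).ne' (sum_exp_pos _).ne',
      Finset.sum_div]
    congr 1
    refine Finset.sum_congr rfl fun i _ => ?_
    rw [softmax, Pi.add_apply, Real.exp_add]
    ring
  rwa [e]

lemma le_logSumExp (v : ι → ℝ) (i : ι) : v i ≤ logSumExp v := by
  rw [logSumExp, Real.le_log_iff_exp_le (sum_exp_pos v)]
  exact Finset.single_le_sum (f := fun i => Real.exp (v i)) (fun i _ => (Real.exp_pos _).le)
    (Finset.mem_univ i)

lemma logSumExp_le (v : ι → ℝ) {c : ℝ} (hc : ∀ i, v i ≤ c) :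
    logSumExp v ≤ c + Real.log (Fintype.card ι) := by
  rw [logSumExp, Real.log_le_iff_le_exp (sum_exp_pos v), Real.exp_add,
    Real.exp_log (by exact_mod_cast Fintype.card_pos)]
  calc _ ≤ ∑ _i : ι, Real.exp c := Finset.sum_le_sum fun i _ => Real.exp_le_exp.2 (hc i)
    _ = _ := by simp [mul_comm]

lemma abs_logSumExp_le (v : ι → ℝ) : |logSumExp v| ≤ Real.log (Fintype.card ι) + ‖v‖ := by
  have h0 : 0 ≤ Real.log (Fintype.card ι) :=
    Real.log_nonneg (by exact_mod_cast Fintype.card_pos)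
  have h := logSumExp_le v (c := ‖v‖) fun i => (le_abs_self _).trans (norm_le_pi_norm v i)
  have h1 := le_logSumExp v (Classical.arbitrary ι)
  have h2 := (abs_le.1 (norm_le_pi_norm v (Classical.arbitrary ι))).1
  rw [abs_le]
  constructor <;> linarith

lemma continuous_logSumExp : Continuous (logSumExp : (ι → ℝ) → ℝ) := by
  unfold logSumExp
  exact Continuous.log (by fun_prop) fun v => (sum_exp_pos v).ne'

end LogSumExp

lemma CenteredGaussian.integrable_of_le {E : Type*} [NormedAddCommGroup E] [NormedSpace ℝ E]
    [MeasurableSpace E] [BorelSpace E] [CompleteSpace E] [SecondCountableTopology E]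
    {μ : Measure E} (h : CenteredGaussian μ) {f : E → ℝ} (hf : Continuous f) {a b : ℝ}
    (hab : ∀ x, |f x| ≤ a + b * ‖x‖) : Integrable f μ := by
  have := h.gauss
  have hn : Integrable (fun x : E => a + b * ‖x‖) μ :=
    (integrable_const a).add ((IsGaussian.integrable_id (μ := μ)).norm.const_mul b)
  exact hn.mono' hf.aestronglyMeasurable (ae_of_all _ hab)

section Slepian

variable {ι : Type*} [Fintype ι] [Nonempty ι] {P Q : Measure (ι → ℝ)}

lemma CenteredGaussian.integral_logSumExp_taylor (hP : CenteredGaussian P) (v : ι → ℝ) {r : ℝ}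
    (hr : 0 ≤ r) :
    |∫ x, logSumExp (v + r • x) ∂P - logSumExp v
      - r ^ 2 / 2 * (∑ i, softmax v i * ∫ x, x i ^ 2 ∂P
        - ∑ i, ∑ j, softmax v i * softmax v j * ∫ x, x i * x j ∂P)|
      ≤ 40 * (∫ x, ‖x‖ ^ 3 ∂P) * r ^ 3 := by
  have := hP.gauss
  set p := softmax v
  have ii : ∀ i j, Integrable (fun x : ι → ℝ => x i * x j) P := fun i j =>
    hP.integrable_dual_mul (.proj i) (.proj j)
  have i2 : ∀ i, Integrable (fun x : ι → ℝ => x i ^ 2) P := fun i => by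
    simpa only [sq] using ii i i
  have i1 : ∀ i, Integrable (fun x : ι → ℝ => x i) P := fun i =>
    hP.integrable_dual (.proj i)
  have m1 : ∀ i, ∫ x : ι → ℝ, x i ∂P = 0 := fun i => hP.mean (.proj i)
  let T : (ι → ℝ) → ℝ := fun x => logSumExp v + r * ∑ i, p i * x i
    + r ^ 2 / 2 * (∑ i, p i * x i ^ 2 - ∑ i, ∑ j, p i * p j * (x i * x j))
  have hTx : ∀ x, |logSumExp (v + r • x) - T x| ≤ 40 * r ^ 3 * ‖x‖ ^ 3 := by
    intro x
    have h := abs_logSumExp_taylor v (r • x)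
    rw [norm_smul, Real.norm_of_nonneg hr, mul_pow, ← mul_assoc] at h
    convert h using 2
    simp only [T, Pi.smul_apply, smul_eq_mul]
    have e1 : ∑ i, p i * (r * x i) = r * ∑ i, p i * x i := by
      rw [Finset.mul_sum]
      exact Finset.sum_congr rfl fun i _ => by ring
    have e2 : ∑ i, p i * (r * x i) ^ 2 = r ^ 2 * ∑ i, p i * x i ^ 2 := by
      rw [Finset.mul_sum]
      exact Finset.sum_congr rfl fun i _ => by ring
    have e3 : ∑ i, ∑ j, p i * p j * (x i * x j) = (∑ i, p i * x i) ^ 2 := by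
      rw [sq, Finset.sum_mul_sum]
      exact Finset.sum_congr rfl fun i _ => Finset.sum_congr rfl fun j _ => by ring
    rw [e3]
    rw [show softmax v = p from rfl, e1, e2]
    ring
  have j1 : Integrable (fun x : ι → ℝ => ∑ i, p i * x i) P :=
    integrable_finsetSum _ fun i _ => (i1 i).const_mul _
  have j2 : Integrable (fun x : ι → ℝ => ∑ i, p i * x i ^ 2) P :=
    integrable_finsetSum _ fun i _ => (i2 i).const_mul _
  have j3 : Integrable (fun x : ι → ℝ => ∑ i, ∑ j, p i * p j * (x i * x j)) P :=
    integrable_finsetSum _ fun i _ => integrable_finsetSum _ fun j _ => (ii i j).const_mul _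
  have j12 : Integrable (fun x : ι → ℝ => logSumExp v + r * ∑ i, p i * x i) P :=
    (integrable_const _).add (j1.const_mul r)
  have j23 : Integrable (fun x : ι → ℝ => r ^ 2 / 2 *
      (∑ i, p i * x i ^ 2 - ∑ i, ∑ j, p i * p j * (x i * x j))) P := (j2.sub j3).const_mul _
  have jT : Integrable T P := j12.add j23
  have hT : ∫ x, T x ∂P = logSumExp v + r ^ 2 / 2 * (∑ i, p i * ∫ x, x i ^ 2 ∂P
        - ∑ i, ∑ j, p i * p j * ∫ x, x i * x j ∂P) := by
    simp only [T]
    rw [integral_add j12 j23, integral_add (integrable_const _)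
      (j1.const_mul r), integral_const_mul, integral_const_mul, integral_sub j2 j3,
      integral_finsetSum _ fun i _ => (i1 i).const_mul _,
      integral_finsetSum _ fun i _ => (i2 i).const_mul _,
      integral_finsetSum _ fun i _ => integrable_finsetSum _ fun j _ => (ii i j).const_mul _]
    simp only [integral_const_mul, m1, mul_zero, Finset.sum_const_zero, add_zero, integral_const,
      probReal_univ, one_smul]
    congr 3
    refine Finset.sum_congr rfl fun i _ => ?_
    rw [integral_finsetSum _ fun j _ => (ii i j).const_mul _]
    simp only [integral_const_mul]
  have jF : Integrable (fun x => logSumExp (v + r • x)) P :=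
    hP.integrable_of_le (continuous_logSumExp.comp (by fun_prop))
      (a := Real.log (Fintype.card ι) + ‖v‖) (b := r) fun x => by
        refine (abs_logSumExp_le _).trans ?_
        have := norm_add_le v (r • x)
        rw [norm_smul, Real.norm_of_nonneg hr] at this
        linarith
  have j4 : Integrable (fun x : ι → ℝ => ‖x‖ ^ 3) P := by
    have := (IsGaussian.memLp_id P 3 (by simp)).integrable_norm_pow (by norm_num)
    simpa using this
  have e : ∫ x, logSumExp (v + r • x) ∂P - logSumExp v
      - r ^ 2 / 2 * (∑ i, p i * ∫ x, x i ^ 2 ∂P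
        - ∑ i, ∑ j, p i * p j * ∫ x, x i * x j ∂P)
      = ∫ x, (logSumExp (v + r • x) - T x) ∂P := by
    rw [integral_sub jF jT, hT]
    ring
  rw [e]
  refine abs_integral_le_integral_abs.trans ?_
  refine (integral_mono (jF.sub jT).abs (j4.const_mul (40 * r ^ 3)) hTx).trans ?_
  rw [integral_const_mul]
  apply le_of_eq
  ring

lemma integrable_logSumExp_smul (hP : CenteredGaussian P) (v : ι → ℝ) (r : ℝ) :
    Integrable (fun x => logSumExp (v + r • x)) P :=
  hP.integrable_of_le (continuous_logSumExp.comp (by fun_prop))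
    (a := Real.log (Fintype.card ι) + ‖v‖) (b := |r|) fun x => by
      refine (abs_logSumExp_le _).trans ?_
      have := norm_add_le v (r • x)
      rw [norm_smul, Real.norm_eq_abs] at this
      linarith

lemma integrable_logSumExp_smul_prod (hP : CenteredGaussian P) (hQ : CenteredGaussian Q)
    (v : ι → ℝ) (r s : ℝ) :
    Integrable (fun x : (ι → ℝ) × (ι → ℝ) => logSumExp (v + r • x.1 + s • x.2)) (P.prod Q) :=
  (hP.prod hQ).integrable_of_le (continuous_logSumExp.comp (by fun_prop))
    (a := Real.log (Fintype.card ι) + ‖v‖) (b := |r| + |s|) fun x => by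
      refine (abs_logSumExp_le _).trans ?_
      have h1 := norm_add_le v (r • x.1)
      have h2 := norm_add_le (v + r • x.1) (s • x.2)
      rw [norm_smul, Real.norm_eq_abs] at h1 h2
      have h3 := mul_le_mul_of_nonneg_left (norm_fst_le x) (abs_nonneg r)
      have h4 := mul_le_mul_of_nonneg_left (norm_snd_le x) (abs_nonneg s)
      linarith

lemma CenteredGaussian.map_add_smul {E : Type*} [NormedAddCommGroup E] [NormedSpace ℝ E]
    [MeasurableSpace E] [BorelSpace E] [CompleteSpace E] [SecondCountableTopology E]
    {μ : Measure E} (h : CenteredGaussian μ) {a b c : ℝ} (habc : a ^ 2 + b ^ 2 = c ^ 2) :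
    (μ.prod μ).map (fun p => a • p.1 + b • p.2) = μ.map (fun x => c • x) := by
  let T : E × E →L[ℝ] E := a • .fst ℝ E E + b • .snd ℝ E E
  let S : E →L[ℝ] E := c • .id ℝ E
  have hT : (fun p : E × E => a • p.1 + b • p.2) = T := by ext p; simp [T]
  have hS : (fun x : E => c • x) = S := by ext p; simp [S]
  rw [hT, hS]
  refine ((h.prod h).map T).ext (h.map S) fun L => ?_
  rw [integral_map (by fun_prop) (by fun_prop), integral_map (by fun_prop) (by fun_prop)]
  have := h.integral_sq_prod h (a • L) (b • L)
  simp only [smul_apply, smul_eq_mul, mul_pow, integral_const_mul] at this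
  simp only [T, S, add_apply, smul_apply, map_add,
    map_smul, smul_eq_mul, mul_pow, integral_const_mul, ContinuousLinearMap.id_apply,
    ContinuousLinearMap.coe_fst', ContinuousLinearMap.coe_snd']
  rw [this, ← add_mul, habc]

lemma integral_logSumExp_semigroup (hP : CenteredGaussian P) (v : ι → ℝ) {a b c : ℝ}
    (habc : a ^ 2 + b ^ 2 = c ^ 2) :
    ∫ x, ∫ y, logSumExp (v + a • x + b • y) ∂P ∂P = ∫ x, logSumExp (v + c • x) ∂P := by
  have := hP.gauss
  rw [← integral_prod (fun x : (ι → ℝ) × (ι → ℝ) => logSumExp (v + a • x.1 + b • x.2))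
    (integrable_logSumExp_smul_prod hP hP v a b)]
  have h := congrArg (fun μ => ∫ x, logSumExp (v + x) ∂μ) (hP.map_add_smul habc)
  have hc : Continuous fun x : ι → ℝ => logSumExp (v + x) :=
    continuous_logSumExp.comp (by fun_prop)
  rw [integral_map (by fun_prop) hc.aestronglyMeasurable,
    integral_map (by fun_prop) hc.aestronglyMeasurable] at h
  simpa only [add_assoc] using h

/-- Slepian's comparison inequality for the log-sum-exp function. -/
lemma integral_logSumExp_le (hP : CenteredGaussian P) (hQ : CenteredGaussian Q)
    (hd : ∀ i, ∫ x, x i ^ 2 ∂P = ∫ x, x i ^ 2 ∂Q)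
    (ho : ∀ i j, ∫ x, x i * x j ∂Q ≤ ∫ x, x i * x j ∂P) (v : ι → ℝ) :
    ∫ x, logSumExp (v + x) ∂P ≤ ∫ x, logSumExp (v + x) ∂Q := by
  have := hP.gauss
  have := hQ.gauss
  set K : ℝ := 40 * (∫ x, ‖x‖ ^ 3 ∂P) + 40 * (∫ x, ‖x‖ ^ 3 ∂Q) with hK
  have step : ∀ (v : ι → ℝ) (r : ℝ), 0 ≤ r → ∫ x, logSumExp (v + r • x) ∂P
      ≤ ∫ x, logSumExp (v + r • x) ∂Q + K * r ^ 3 := by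
    intro v r hr
    have h1 := (abs_le.1 (hP.integral_logSumExp_taylor v hr)).2
    have h2 := (abs_le.1 (hQ.integral_logSumExp_taylor v hr)).1
    have h3 : ∑ i, ∑ j, softmax v i * softmax v j * ∫ x, x i * x j ∂Q
        ≤ ∑ i, ∑ j, softmax v i * softmax v j * ∫ x, x i * x j ∂P :=
      Finset.sum_le_sum fun i _ => Finset.sum_le_sum fun j _ =>
        mul_le_mul_of_nonneg_left (ho i j) (mul_nonneg (softmax_nonneg v i) (softmax_nonneg v j))
    simp only [hd] at h1
    have h4 := mul_le_mul_of_nonneg_left h3 (show 0 ≤ r ^ 2 / 2 by positivity)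
    rw [hK]
    linarith
  have iter : ∀ (h : ℝ), 0 ≤ h → ∀ (n : ℕ) (v : ι → ℝ),
      ∫ x, logSumExp (v + Real.sqrt (n * h ^ 2) • x) ∂P
        ≤ ∫ x, logSumExp (v + Real.sqrt (n * h ^ 2) • x) ∂Q + n * (K * h ^ 3) := by
    intro h hh n
    induction n with
    | zero => intro v; simp
    | succ n ih =>
      intro v
      have hsq : Real.sqrt (n * h ^ 2) ^ 2 + h ^ 2 = Real.sqrt ((n + 1 : ℕ) * h ^ 2) ^ 2 := by
        rw [Real.sq_sqrt (by positivity), Real.sq_sqrt (by positivity)]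
        push_cast
        ring
      set a := Real.sqrt (n * h ^ 2)
      rw [← integral_logSumExp_semigroup hP v hsq, ← integral_logSumExp_semigroup hQ v
        (show h ^ 2 + a ^ 2 = _ by rw [add_comm]; exact hsq)]
      have iPQ := integrable_logSumExp_smul_prod hP hQ v a h
      have iPP := integrable_logSumExp_smul_prod hP hP v a h
      have iQP := integrable_logSumExp_smul_prod hQ hP v h a
      have iQQ := integrable_logSumExp_smul_prod hQ hQ v h a
      calc ∫ x, ∫ y, logSumExp (v + a • x + h • y) ∂P ∂P
          ≤ ∫ x, (∫ y, logSumExp (v + a • x + h • y) ∂Q + K * h ^ 3) ∂P :=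
            integral_mono iPP.integral_prod_left
              (iPQ.integral_prod_left.add (integrable_const _)) fun x => step _ h hh
        _ = ∫ x, ∫ y, logSumExp (v + a • x + h • y) ∂Q ∂P + K * h ^ 3 := by
            rw [integral_add iPQ.integral_prod_left (integrable_const _)]
            simp
        _ = ∫ y, ∫ x, logSumExp (v + h • y + a • x) ∂P ∂Q + K * h ^ 3 := by
            rw [integral_integral_swap iPQ]
            simp only [add_right_comm]
        _ ≤ ∫ y, (∫ x, logSumExp (v + h • y + a • x) ∂Q + n * (K * h ^ 3)) ∂Q + K * h ^ 3 := by
            gcongr ?_ + _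
            exact integral_mono iQP.integral_prod_left
              (iQQ.integral_prod_left.add (integrable_const _)) fun x => ih _
        _ = _ := by
            rw [integral_add iQQ.integral_prod_left (integrable_const _)]
            simp only [integral_const, probReal_univ, one_smul]
            push_cast
            ring
  have lim : Filter.Tendsto (fun n : ℕ => ∫ x, logSumExp (v + x) ∂Q + K * Real.sqrt (1 / n))
      Filter.atTop (nhds (∫ x, logSumExp (v + x) ∂Q + K * Real.sqrt 0)) :=
    tendsto_const_nhds.add (tendsto_const_nhds.mul
      ((Real.continuous_sqrt.tendsto 0).comp tendsto_one_div_atTop_nhds_zero_nat))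
  rw [Real.sqrt_zero, mul_zero, add_zero] at lim
  refine ge_of_tendsto lim ?_
  filter_upwards [Filter.eventually_gt_atTop 0] with n hn
  have hn' : (0 : ℝ) < n := by exact_mod_cast hn
  have h := iter (Real.sqrt (1 / n)) (Real.sqrt_nonneg _) n v
  have e : (n : ℝ) * Real.sqrt (1 / n) ^ 2 = 1 := by
    rw [Real.sq_sqrt (by positivity)]
    field_simp
  have e2 : (n : ℝ) * (K * Real.sqrt (1 / n) ^ 3) = K * Real.sqrt (1 / n) := by
    linear_combination K * Real.sqrt (1 / n) * e
  rw [e, e2] at h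
  simpa using h

lemma sup'_le_logSumExp_div {β : ℝ} (hβ : 0 < β) (v : ι → ℝ) :
    Finset.univ.sup' Finset.univ_nonempty v ≤ logSumExp (β • v) / β := by
  refine Finset.sup'_le _ _ fun i _ => ?_
  rw [le_div_iff₀ hβ, mul_comm]
  exact le_logSumExp (β • v) i

lemma logSumExp_div_le_sup' {β : ℝ} (hβ : 0 < β) (v : ι → ℝ) :
    logSumExp (β • v) / β ≤
      Finset.univ.sup' Finset.univ_nonempty v + Real.log (Fintype.card ι) / β := by
  rw [div_le_iff₀ hβ, add_mul, div_mul_cancel₀ _ hβ.ne']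
  refine logSumExp_le _ fun i => ?_
  rw [Pi.smul_apply, smul_eq_mul, mul_comm]
  exact mul_le_mul_of_nonneg_right (Finset.le_sup' v (Finset.mem_univ i)) hβ.le

lemma continuous_univ_sup' :
    Continuous fun v : ι → ℝ => Finset.univ.sup' Finset.univ_nonempty v := by
  have : (fun v : ι → ℝ => Finset.univ.sup' Finset.univ_nonempty v)
      = Finset.univ.sup' Finset.univ_nonempty (fun i (v : ι → ℝ) => v i) := by
    ext v
    rw [Finset.sup'_apply]
  rw [this]
  exact Continuous.finset_sup' _ fun i _ => continuous_apply i

lemma integrable_sup' (hP : CenteredGaussian P) (v : ι → ℝ) :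
    Integrable (fun x => Finset.univ.sup' Finset.univ_nonempty (v + x)) P := by
  refine hP.integrable_of_le (continuous_univ_sup'.comp (by fun_prop)) (a := ‖v‖) (b := 1)
    fun x => ?_
  have hb : ∀ i, |(v + x) i| ≤ ‖v‖ + 1 * ‖x‖ := fun i => by
    rw [one_mul]
    exact (norm_le_pi_norm (v + x) i).trans (norm_add_le _ _)
  rw [abs_le]
  constructor
  · exact (abs_le.1 (hb (Classical.arbitrary ι))).1.trans
      (Finset.le_sup' (v + x) (Finset.mem_univ _))
  · exact Finset.sup'_le _ _ fun i _ => (abs_le.1 (hb i)).2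

/-- Slepian's comparison inequality for the expected maximum. -/
lemma integral_sup'_le (hP : CenteredGaussian P) (hQ : CenteredGaussian Q)
    (hd : ∀ i, ∫ x, x i ^ 2 ∂P = ∫ x, x i ^ 2 ∂Q)
    (ho : ∀ i j, ∫ x, x i * x j ∂Q ≤ ∫ x, x i * x j ∂P) (v : ι → ℝ) :
    ∫ x, Finset.univ.sup' Finset.univ_nonempty (v + x) ∂P
      ≤ ∫ x, Finset.univ.sup' Finset.univ_nonempty (v + x) ∂Q := by
  have := hP.gauss
  have := hQ.gauss
  have key : ∀ β : ℝ, 0 < β → ∫ x, Finset.univ.sup' Finset.univ_nonempty (v + x) ∂P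
      ≤ ∫ x, Finset.univ.sup' Finset.univ_nonempty (v + x) ∂Q
        + Real.log (Fintype.card ι) / β := by
    intro β hβ
    let S : (ι → ℝ) →L[ℝ] (ι → ℝ) := β • .id ℝ _
    have hmap : ∀ (ρ : Measure (ι → ℝ)) (f : (ι → ℝ) → ℝ), Continuous f →
        ∫ x, f x ∂(ρ.map S) = ∫ x, f (β • x) ∂ρ := fun ρ f hf => by
      rw [integral_map (by fun_prop) hf.aestronglyMeasurable]
      rfl
    have h := integral_logSumExp_le (hP.map S) (hQ.map S)
      (fun i => by
        rw [hmap _ _ (by fun_prop), hmap _ _ (by fun_prop)]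
        simp only [Pi.smul_apply, smul_eq_mul, mul_pow, integral_const_mul, hd])
      (fun i j => by
        rw [hmap _ _ (by fun_prop), hmap _ _ (by fun_prop)]
        simp only [Pi.smul_apply, smul_eq_mul, mul_mul_mul_comm, integral_const_mul]
        exact mul_le_mul_of_nonneg_left (ho i j) (mul_self_nonneg β)) (β • v)
    have hc : Continuous fun x : ι → ℝ => logSumExp (β • v + x) :=
      continuous_logSumExp.comp (by fun_prop)
    rw [hmap _ _ hc, hmap _ _ hc] at h
    simp only [← smul_add] at h
    have iP : Integrable (fun x => logSumExp (β • (v + x)) / β) P := by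
      simpa only [smul_add] using (integrable_logSumExp_smul hP (β • v) β).div_const β
    have iQ : Integrable (fun x => logSumExp (β • (v + x)) / β) Q := by
      simpa only [smul_add] using (integrable_logSumExp_smul hQ (β • v) β).div_const β
    calc _ ≤ ∫ x, logSumExp (β • (v + x)) / β ∂P :=
          integral_mono (integrable_sup' hP v) iP fun x => sup'_le_logSumExp_div hβ _
      _ ≤ ∫ x, logSumExp (β • (v + x)) / β ∂Q := by
          rw [integral_div, integral_div]
          exact div_le_div_of_nonneg_right h hβ.le
      _ ≤ ∫ x, (Finset.univ.sup' Finset.univ_nonempty (v + x)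
            + Real.log (Fintype.card ι) / β) ∂Q :=
          integral_mono iQ ((integrable_sup' hQ v).add (integrable_const _))
            fun x => logSumExp_div_le_sup' hβ _
      _ = _ := by
          rw [integral_add (integrable_sup' hQ v) (integrable_const _)]
          simp
  have lim := (tendsto_const_nhds (x := ∫ x, Finset.univ.sup' Finset.univ_nonempty (v + x) ∂Q)
    (f := Filter.atTop)).add
    ((tendsto_const_nhds (x := Real.log (Fintype.card ι))).div_atTop (Filter.tendsto_id (α := ℝ)))
  rw [add_zero] at lim
  refine ge_of_tendsto lim ?_
  filter_upwards [Filter.eventually_gt_atTop 0] with β hβ using key β hβ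

end Slepian

section GaussianMoments

lemma integral_sq_gaussianReal : ∫ x, x ^ 2 ∂(gaussianReal 0 1) = 1 := by
  have h := variance_fun_id_gaussianReal (μ := 0) (v := 1)
  rw [variance_of_integral_eq_zero (by fun_prop) integral_id_gaussianReal] at h
  simpa using h

lemma CenteredGaussian.integral_mul_eq {E : Type*} [NormedAddCommGroup E] [NormedSpace ℝ E]
    [MeasurableSpace E] [BorelSpace E] [CompleteSpace E] [SecondCountableTopology E]
    {μ : Measure E} (h : CenteredGaussian μ) (L L' : StrongDual ℝ E) :
    ∫ x, L x * L' x ∂μ = (∫ x, (L + L') x ^ 2 ∂μ - ∫ x, L x ^ 2 ∂μ - ∫ x, L' x ^ 2 ∂μ) / 2 := by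
  have i : ∀ M : StrongDual ℝ E, Integrable (fun x => M x ^ 2) μ := fun M => by
    simpa only [sq] using h.integrable_dual_mul M M
  have i1 : Integrable (fun x => (L + L') x ^ 2 - L x ^ 2) μ := (i _).sub (i _)
  rw [← integral_sub (i _) (i _), ← integral_sub i1 (i _), ← integral_div]
  refine integral_congr_ae (ae_of_all _ fun x => ?_)
  simp only [add_apply]
  ring

variable {N : ℕ}

lemma centeredGaussian_pi (κ : Type*) [Fintype κ] :
    CenteredGaussian (Measure.pi fun _ : κ => gaussianReal 0 1) := by
  classical
  exact CenteredGaussian.pi fun _ => .real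

lemma gMeasure_centeredGaussian (N : ℕ) : CenteredGaussian (gMeasure N) :=
  CenteredGaussian.pi fun _ => centeredGaussian_pi _

instance (N : ℕ) : IsProbabilityMeasure (gMeasure N) :=
  have := (gMeasure_centeredGaussian N).gauss
  inferInstance

/-- The linear functional on vectors with coefficients `c`. -/
def vecFunctional {κ : Type*} [Fintype κ] (c : κ → ℝ) : StrongDual ℝ (κ → ℝ) :=
  ∑ j, c j • ContinuousLinearMap.proj j

lemma vecFunctional_apply {κ : Type*} [Fintype κ] (c x : κ → ℝ) :
    vecFunctional c x = ∑ j, c j * x j := by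
  simp [vecFunctional, sum_apply]

/-- The linear functional on arrays with coefficients `c`. -/
def arrFunctional (c : Fin N → Fin N → ℝ) : StrongDual ℝ (Fin N → Fin N → ℝ) :=
  ∑ i, (vecFunctional (c i)).comp (.proj i)

lemma arrFunctional_apply (c x : Fin N → Fin N → ℝ) :
    arrFunctional c x = ∑ i, ∑ j, c i j * x i j := by
  simp [arrFunctional, sum_apply, vecFunctional_apply]

lemma integral_sq_pi_gaussianReal {κ : Type*} [Fintype κ] (c : κ → ℝ) :
    ∫ x, (∑ j, c j * x j) ^ 2 ∂(Measure.pi fun _ : κ => gaussianReal 0 1) = ∑ j, c j ^ 2 := by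
  classical
  have h := CenteredGaussian.integral_sq_pi (ι := κ) (P := fun _ => gaussianReal 0 1)
    (fun _ => .real) (fun j => c j • ContinuousLinearMap.id ℝ ℝ)
  simp only [smul_apply, ContinuousLinearMap.id_apply, smul_eq_mul,
    mul_pow, integral_const_mul, integral_sq_gaussianReal, mul_one] at h
  exact h

lemma integral_sq_gMeasure (c : Fin N → Fin N → ℝ) :
    ∫ g, (∑ i, ∑ j, c i j * g i j) ^ 2 ∂(gMeasure N) = ∑ i, ∑ j, c i j ^ 2 := by
  have h := CenteredGaussian.integral_sq_pi (ι := Fin N)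
    (P := fun _ => Measure.pi fun _ : Fin N => gaussianReal 0 1)
    (fun _ => centeredGaussian_pi _) (fun i => vecFunctional (c i))
  simp only [vecFunctional_apply, integral_sq_pi_gaussianReal] at h
  exact h

lemma integral_mul_pi_gaussianReal {κ : Type*} [Fintype κ] (c c' : κ → ℝ) :
    ∫ x, (∑ j, c j * x j) * (∑ j, c' j * x j) ∂(Measure.pi fun _ : κ => gaussianReal 0 1)
      = ∑ j, c j * c' j := by
  have h := (centeredGaussian_pi κ).integral_mul_eq (vecFunctional c) (vecFunctional c')
  simp only [vecFunctional_apply, add_apply, ← Finset.sum_add_distrib,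
    ← add_mul, integral_sq_pi_gaussianReal] at h
  rw [h, ← Finset.sum_sub_distrib, ← Finset.sum_sub_distrib, Finset.sum_div]
  exact Finset.sum_congr rfl fun j _ => by ring

lemma integral_mul_gMeasure (c c' : Fin N → Fin N → ℝ) :
    ∫ g, (∑ i, ∑ j, c i j * g i j) * (∑ i, ∑ j, c' i j * g i j) ∂(gMeasure N)
      = ∑ i, ∑ j, c i j * c' i j := by
  have h := (gMeasure_centeredGaussian N).integral_mul_eq (arrFunctional c) (arrFunctional c')
  simp only [arrFunctional_apply, add_apply, ← Finset.sum_add_distrib,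
    ← add_mul, integral_sq_gMeasure] at h
  rw [h]
  simp only [← Finset.sum_sub_distrib, Finset.sum_div]
  exact Finset.sum_congr rfl fun i _ => Finset.sum_congr rfl fun j _ => by ring

lemma exists_eq_arrFunctional (L : StrongDual ℝ (Fin N → Fin N → ℝ)) :
    ∃ c, L = arrFunctional c := by
  refine ⟨fun i j => L (Pi.single i (Pi.single j 1)), ?_⟩
  ext x
  rw [arrFunctional_apply]
  have hx : x = ∑ i, ∑ j, x i j • (Pi.single i (Pi.single j (1 : ℝ)) : Fin N → Fin N → ℝ) := by
    ext a b
    simp only [Finset.sum_apply, Pi.smul_apply, smul_eq_mul]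
    rw [Finset.sum_eq_single a, Finset.sum_eq_single b]
    · simp
    · intro j _ hj
      simp [hj.symm]
    · simp
    · intro i _ hi
      simp [hi.symm]
    · simp
  conv_lhs => rw [hx]
  simp only [map_sum, map_smul, smul_eq_mul]
  exact Finset.sum_congr rfl fun i _ => Finset.sum_congr rfl fun j _ => mul_comm _ _

lemma CenteredGaussian.ext_array {μ ν : Measure (Fin N → Fin N → ℝ)} (h : CenteredGaussian μ)
    (h' : CenteredGaussian ν) (hv : ∀ c : Fin N → Fin N → ℝ,
      ∫ x, (∑ i, ∑ j, c i j * x i j) ^ 2 ∂μ = ∫ x, (∑ i, ∑ j, c i j * x i j) ^ 2 ∂ν) :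
    μ = ν := by
  refine h.ext h' fun L => ?_
  obtain ⟨c, rfl⟩ := exists_eq_arrFunctional L
  simpa only [arrFunctional_apply] using hv c

/-- Entrywise multiplication of arrays as a continuous linear map. -/
def entryMul (γ : Fin N → Fin N → ℝ) : (Fin N → Fin N → ℝ) →L[ℝ] (Fin N → Fin N → ℝ) :=
  .pi fun i => .pi fun j => γ i j • (ContinuousLinearMap.proj (R := ℝ) (φ := fun _ => ℝ) j).comp
    (.proj (φ := fun _ => Fin N → ℝ) i)

lemma entryMul_apply (γ g : Fin N → Fin N → ℝ) (i j : Fin N) :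
    entryMul γ g i j = γ i j * g i j := by
  simp [entryMul]

lemma integral_map_sq_sum {E : Type*} [NormedAddCommGroup E] [NormedSpace ℝ E]
    [MeasurableSpace E] [BorelSpace E] (μ : Measure E) (T : E →L[ℝ] (Fin N → Fin N → ℝ))
    (c : Fin N → Fin N → ℝ) :
    ∫ x, (∑ i, ∑ j, c i j * x i j) ^ 2 ∂(μ.map T)
      = ∫ x, (∑ i, ∑ j, c i j * T x i j) ^ 2 ∂μ := by
  refine integral_map (by fun_prop) (Continuous.aestronglyMeasurable ?_)
  simp only [← arrFunctional_apply]
  fun_prop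

lemma integral_sq_map_entryMul (γ c : Fin N → Fin N → ℝ) :
    ∫ g, (∑ i, ∑ j, c i j * entryMul γ g i j) ^ 2 ∂(gMeasure N)
      = ∑ i, ∑ j, c i j ^ 2 * γ i j ^ 2 := by
  simp only [entryMul_apply, ← mul_assoc, integral_sq_gMeasure, mul_pow]

lemma map_entryMul_congr {α β : Fin N → Fin N → ℝ} (h : ∀ i j, α i j ^ 2 = β i j ^ 2) :
    (gMeasure N).map (entryMul α) = (gMeasure N).map (entryMul β) := by
  refine ((gMeasure_centeredGaussian N).map _).ext_array
    ((gMeasure_centeredGaussian N).map _) fun c => ?_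
  rw [integral_map_sq_sum, integral_map_sq_sum,
    integral_sq_map_entryMul, integral_sq_map_entryMul]
  simp only [h]

lemma measurePreserving_entryMul {α : Fin N → Fin N → ℝ} (h : ∀ i j, α i j ^ 2 = 1) :
    MeasurePreserving (entryMul α) (gMeasure N) (gMeasure N) := by
  refine ⟨by fun_prop, ?_⟩
  have h1 : (entryMul fun _ _ => 1 : (Fin N → Fin N → ℝ) → _) = id := by
    ext g i j; simp [entryMul_apply]
  rw [map_entryMul_congr (β := fun _ _ => 1) fun i j => by rw [h, one_pow], h1, Measure.map_id]

lemma map_entryMul_add {α β γ : Fin N → Fin N → ℝ}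
    (h : ∀ i j, α i j ^ 2 + β i j ^ 2 = γ i j ^ 2) :
    ((gMeasure N).prod (gMeasure N)).map (fun p => entryMul α p.1 + entryMul β p.2)
      = (gMeasure N).map (entryMul γ) := by
  have hc := gMeasure_centeredGaussian N
  let T : (Fin N → Fin N → ℝ) × (Fin N → Fin N → ℝ) →L[ℝ] (Fin N → Fin N → ℝ) :=
    (entryMul α).comp (.fst ℝ _ _) + (entryMul β).comp (.snd ℝ _ _)
  have hT : (fun p : (Fin N → Fin N → ℝ) × (Fin N → Fin N → ℝ) =>
      entryMul α p.1 + entryMul β p.2) = T := by ext p; simp [T]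
  rw [hT]
  refine ((hc.prod hc).map T).ext_array (hc.map _) fun c => ?_
  rw [integral_map_sq_sum, integral_map_sq_sum,
    integral_sq_map_entryMul]
  have h2 := hc.integral_sq_prod hc ((arrFunctional c).comp (entryMul α))
    ((arrFunctional c).comp (entryMul β))
  simp only [ContinuousLinearMap.comp_apply, arrFunctional_apply, integral_sq_map_entryMul] at h2
  rw [← hT]
  simp only [Pi.add_apply, mul_add, Finset.sum_add_distrib]
  rw [h2]
  simp only [← Finset.sum_add_distrib, ← mul_add, h]

/-- Conjugation of an array by a matrix as a continuous linear map. -/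
def conjArr (Q : Matrix (Fin N) (Fin N) ℝ) :
    (Fin N → Fin N → ℝ) →L[ℝ] (Fin N → Fin N → ℝ) :=
  .pi fun i => .pi fun j => arrFunctional fun k l => Q i k * Q j l

lemma of_conjArr (Q : Matrix (Fin N) (Fin N) ℝ) (g : Fin N → Fin N → ℝ) :
    Matrix.of (conjArr Q g) = Q * Matrix.of g * Q.transpose := by
  ext i j
  simp only [conjArr, ContinuousLinearMap.coe_pi', arrFunctional_apply, Matrix.mul_apply,
    Matrix.of_apply, Matrix.transpose_apply, Finset.sum_mul]
  rw [Finset.sum_comm]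
  exact Finset.sum_congr rfl fun i _ => Finset.sum_congr rfl fun j _ => by ring

lemma sum_sum_sq_eq_trace (c : Matrix (Fin N) (Fin N) ℝ) :
    ∑ i, ∑ j, c i j ^ 2 = (c.transpose * c).trace := by
  simp only [Matrix.trace, Matrix.diag, Matrix.mul_apply, Matrix.transpose_apply, sq]
  rw [Finset.sum_comm]

lemma map_conjArr {Q : Matrix (Fin N) (Fin N) ℝ} (hQ : Q.transpose * Q = 1) :
    (gMeasure N).map (conjArr Q) = gMeasure N := by
  have hQ' : Q * Q.transpose = 1 := mul_eq_one_comm.1 hQ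
  refine ((gMeasure_centeredGaussian N).map _).ext_array (gMeasure_centeredGaussian N) fun c => ?_
  rw [integral_map_sq_sum, integral_sq_gMeasure]
  have e : ∀ g : Fin N → Fin N → ℝ, ∑ i, ∑ j, c i j * conjArr Q g i j
      = ∑ k, ∑ l, (Q.transpose * Matrix.of c * Q) k l * g k l := by
    intro g
    have e1 : ∑ i, ∑ j, c i j * conjArr Q g i j
        = ((Matrix.of c).transpose * Matrix.of (conjArr Q g)).trace := by
      simp only [Matrix.trace, Matrix.diag, Matrix.mul_apply, Matrix.transpose_apply,
        Matrix.of_apply]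
      rw [Finset.sum_comm]
    have e2 : ∑ k, ∑ l, (Q.transpose * Matrix.of c * Q) k l * g k l
        = ((Q.transpose * Matrix.of c * Q).transpose * Matrix.of g).trace := by
      simp only [Matrix.trace, Matrix.diag, Matrix.mul_apply, Matrix.transpose_apply,
        Matrix.of_apply]
      rw [Finset.sum_comm]
    rw [e1, e2, of_conjArr, Matrix.transpose_mul, Matrix.transpose_mul,
      Matrix.transpose_transpose, ← Matrix.mul_assoc, Matrix.trace_mul_comm]
    simp only [Matrix.mul_assoc]
  simp only [e]
  refine (integral_sq_gMeasure (Q.transpose * Matrix.of c * Q)).trans ?_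
  refine (sum_sum_sq_eq_trace (Q.transpose * Matrix.of c * Q)).trans ?_
  have e3 : ∑ i, ∑ j, c i j ^ 2 = ((Matrix.of c).transpose * Matrix.of c).trace :=
    sum_sum_sq_eq_trace (Matrix.of c)
  rw [e3, Matrix.transpose_mul, Matrix.transpose_mul, Matrix.transpose_transpose]
  calc _ = (Q.transpose
        * ((Matrix.of c).transpose * (Q * Q.transpose) * Matrix.of c * Q)).trace := by
        simp only [Matrix.mul_assoc]
    _ = ((Matrix.of c).transpose * Matrix.of c * (Q * Q.transpose)).trace := by
        rw [Matrix.trace_mul_comm, hQ', Matrix.mul_one, Matrix.mul_assoc, hQ']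
    _ = _ := by rw [hQ', Matrix.mul_one]

end GaussianMoments

section TopEigenvalue

open Matrix

variable {N : ℕ}

/-- The largest value of the quadratic form of `A` on the unit sphere. -/
def topEig (A : Matrix (Fin N) (Fin N) ℝ) : ℝ :=
  sSup ((fun x => x ⬝ᵥ A *ᵥ x) '' {x | x ⬝ᵥ x = 1})

/-- The entrywise `ℓ¹` norm of a matrix. -/
def absSum (A : Matrix (Fin N) (Fin N) ℝ) : ℝ := ∑ i, ∑ j, |A i j|

lemma absSum_nonneg (A : Matrix (Fin N) (Fin N) ℝ) : 0 ≤ absSum A :=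
  Finset.sum_nonneg fun _ _ => Finset.sum_nonneg fun _ _ => abs_nonneg _

lemma continuous_absSum : Continuous (absSum : Matrix (Fin N) (Fin N) ℝ → ℝ) := by
  unfold absSum
  fun_prop

lemma quadForm_eq_sum (A : Matrix (Fin N) (Fin N) ℝ) (x : Fin N → ℝ) :
    x ⬝ᵥ A *ᵥ x = ∑ i, ∑ j, A i j * (x i * x j) := by
  simp only [dotProduct, mulVec, Finset.mul_sum]
  exact Finset.sum_congr rfl fun i _ => Finset.sum_congr rfl fun j _ => by ring

lemma sq_le_dotProduct (x : Fin N → ℝ) (i : Fin N) : x i ^ 2 ≤ x ⬝ᵥ x := by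
  rw [sq]
  exact Finset.single_le_sum (f := fun i => x i * x i) (fun j _ => mul_self_nonneg (x j))
    (Finset.mem_univ i)

lemma abs_mul_le_dotProduct (x : Fin N → ℝ) (i j : Fin N) : |x i * x j| ≤ x ⬝ᵥ x := by
  have h1 := sq_le_dotProduct x i
  have h2 := sq_le_dotProduct x j
  exact abs_le.2 ⟨by nlinarith [sq_nonneg (x i + x j)], by nlinarith [sq_nonneg (x i - x j)]⟩

lemma abs_quadForm_le (A : Matrix (Fin N) (Fin N) ℝ) (x : Fin N → ℝ) :
    |x ⬝ᵥ A *ᵥ x| ≤ absSum A * (x ⬝ᵥ x) := by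
  rw [quadForm_eq_sum, absSum, Finset.sum_mul]
  refine (Finset.abs_sum_le_sum_abs _ _).trans (Finset.sum_le_sum fun i _ => ?_)
  rw [Finset.sum_mul]
  refine (Finset.abs_sum_le_sum_abs _ _).trans (Finset.sum_le_sum fun j _ => ?_)
  rw [abs_mul]
  exact mul_le_mul_of_nonneg_left (abs_mul_le_dotProduct x i j) (abs_nonneg _)

lemma bddAbove_quadForm (A : Matrix (Fin N) (Fin N) ℝ) :
    BddAbove ((fun x => x ⬝ᵥ A *ᵥ x) '' {x | x ⬝ᵥ x = 1}) := by
  refine ⟨absSum A, ?_⟩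
  rintro _ ⟨x, hx, rfl⟩
  have h := abs_quadForm_le A x
  rw [show x ⬝ᵥ x = 1 from hx, mul_one] at h
  exact (le_abs_self _).trans h

lemma quadForm_le_topEig_of_unit (A : Matrix (Fin N) (Fin N) ℝ) {x : Fin N → ℝ}
    (hx : x ⬝ᵥ x = 1) : x ⬝ᵥ A *ᵥ x ≤ topEig A :=
  le_csSup (bddAbove_quadForm A) ⟨x, hx, rfl⟩

lemma quadForm_le_topEig (A : Matrix (Fin N) (Fin N) ℝ) (x : Fin N → ℝ) :
    x ⬝ᵥ A *ᵥ x ≤ topEig A * (x ⬝ᵥ x) := by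
  by_cases hx : x = 0
  · simp [hx]
  have h0 : 0 < x ⬝ᵥ x :=
    lt_of_le_of_ne (Finset.sum_nonneg fun i _ => mul_self_nonneg _)
      fun h => hx (dotProduct_self_eq_zero.1 h.symm)
  have hs := Real.sqrt_pos.2 h0
  have hss := Real.mul_self_sqrt h0.le
  have h := quadForm_le_topEig_of_unit A (x := (√(x ⬝ᵥ x))⁻¹ • x) (by
    simp only [smul_dotProduct, dotProduct_smul, smul_eq_mul]
    rw [← mul_assoc, ← mul_inv, hss, inv_mul_cancel₀ h0.ne'])
  simp only [mulVec_smul, smul_dotProduct, dotProduct_smul, smul_eq_mul] at h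
  rwa [← mul_assoc, ← mul_inv, hss, inv_mul_le_iff₀ h0, mul_comm] at h

lemma topEig_le [NeZero N] {A : Matrix (Fin N) (Fin N) ℝ} {c : ℝ}
    (h : ∀ x : Fin N → ℝ, x ⬝ᵥ x = 1 → x ⬝ᵥ A *ᵥ x ≤ c) : topEig A ≤ c := by
  refine csSup_le ⟨_, Pi.single 0 1, by simp, rfl⟩ ?_
  rintro _ ⟨x, hx, rfl⟩
  exact h x hx

lemma topEig_add_le [NeZero N] (A B : Matrix (Fin N) (Fin N) ℝ) :
    topEig (A + B) ≤ topEig A + topEig B :=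
  topEig_le fun x hx => by
    rw [add_mulVec, dotProduct_add]
    exact add_le_add (quadForm_le_topEig_of_unit A hx) (quadForm_le_topEig_of_unit B hx)

lemma topEig_zero [NeZero N] : topEig (0 : Matrix (Fin N) (Fin N) ℝ) = 0 :=
  le_antisymm (topEig_le fun x _ => by simp) <| by
    simpa using quadForm_le_topEig_of_unit (0 : Matrix (Fin N) (Fin N) ℝ)
      (x := Pi.single 0 1) (by simp)

lemma topEig_smul [NeZero N] {c : ℝ} (hc : 0 ≤ c) (A : Matrix (Fin N) (Fin N) ℝ) :
    topEig (c • A) = c * topEig A := by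
  have key : ∀ {c : ℝ}, 0 ≤ c → ∀ A : Matrix (Fin N) (Fin N) ℝ,
      topEig (c • A) ≤ c * topEig A := fun hc A => topEig_le fun x hx => by
    rw [smul_mulVec, dotProduct_smul, smul_eq_mul]
    exact mul_le_mul_of_nonneg_left (quadForm_le_topEig_of_unit A hx) hc
  refine le_antisymm (key hc A) ?_
  rcases hc.eq_or_lt with rfl | hc'
  · simp [topEig_zero]
  have h := key (inv_nonneg.2 hc) (c • A)
  rwa [inv_smul_smul₀ hc'.ne', ← div_eq_inv_mul, le_div_iff₀' hc'] at h

lemma topEig_le_absSum [NeZero N] (A : Matrix (Fin N) (Fin N) ℝ) : topEig A ≤ absSum A :=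
  topEig_le fun x hx => by
    have h := abs_quadForm_le A x
    rw [hx, mul_one] at h
    exact (le_abs_self _).trans h

lemma absSum_neg (A : Matrix (Fin N) (Fin N) ℝ) : absSum (-A) = absSum A := by
  simp [absSum]

lemma topEig_sub_le [NeZero N] (A B : Matrix (Fin N) (Fin N) ℝ) :
    topEig A - topEig B ≤ absSum (A - B) := by
  have h := topEig_add_le (A - B) B
  rw [sub_add_cancel] at h
  linarith [topEig_le_absSum (A - B)]

lemma abs_topEig_sub_le [NeZero N] (A B : Matrix (Fin N) (Fin N) ℝ) :
    |topEig A - topEig B| ≤ absSum (A - B) :=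
  abs_le.2 ⟨by linarith [topEig_sub_le B A, absSum_neg (A - B), neg_sub A B ▸ absSum_neg (A - B)],
    topEig_sub_le A B⟩

lemma abs_topEig_le [NeZero N] (A : Matrix (Fin N) (Fin N) ℝ) : |topEig A| ≤ absSum A := by
  simpa [topEig_zero] using abs_topEig_sub_le A 0

lemma continuous_topEig [NeZero N] :
    Continuous (topEig : Matrix (Fin N) (Fin N) ℝ → ℝ) := by
  rw [continuous_iff_continuousAt]
  intro A
  refine tendsto_iff_dist_tendsto_zero.2 (squeeze_zero (fun _ => dist_nonneg)
    (fun B => (Real.dist_eq _ _).le.trans (abs_topEig_sub_le B A)) ?_)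
  have h : Continuous fun B : Matrix (Fin N) (Fin N) ℝ => absSum (B - A) :=
    continuous_absSum.comp (continuous_id.sub continuous_const)
  simpa [absSum] using h.tendsto A

lemma topEig_conj [NeZero N] {Q : Matrix (Fin N) (Fin N) ℝ} (hQ : Q.transpose * Q = 1)
    (A : Matrix (Fin N) (Fin N) ℝ) : topEig (Q * A * Q.transpose) = topEig A := by
  have key : ∀ {Q : Matrix (Fin N) (Fin N) ℝ}, Q.transpose * Q = 1 →
      ∀ A : Matrix (Fin N) (Fin N) ℝ, topEig (Q * A * Q.transpose) ≤ topEig A := by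
    intro Q hQ A
    have hQ' : Q * Q.transpose = 1 := mul_eq_one_comm.1 hQ
    refine topEig_le fun x hx => ?_
    have h := quadForm_le_topEig_of_unit A (x := Q.transpose *ᵥ x) (by
      rw [dotProduct_mulVec, vecMul_transpose, mulVec_mulVec, hQ', one_mulVec, hx])
    rwa [← mulVec_mulVec, ← mulVec_mulVec, dotProduct_mulVec, ← mulVec_transpose]
  refine le_antisymm (key hQ A) ?_
  have hQ' : Q.transpose.transpose * Q.transpose = 1 := by
    rw [transpose_transpose]; exact mul_eq_one_comm.1 hQ
  have h := key hQ' (Q * A * Q.transpose)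
  rwa [transpose_transpose, Matrix.mul_assoc, Matrix.mul_assoc, hQ, ← Matrix.mul_assoc,
    ← Matrix.mul_assoc, hQ, Matrix.one_mul, Matrix.mul_one] at h

lemma topEig_add_smul_one [NeZero N] (A : Matrix (Fin N) (Fin N) ℝ) (c : ℝ) :
    topEig (A + c • 1) = topEig A + c := by
  have key : ∀ (A : Matrix (Fin N) (Fin N) ℝ) (c : ℝ), topEig (A + c • 1) ≤ topEig A + c :=
    fun A c => topEig_le fun x hx => by
      rw [add_mulVec, dotProduct_add, smul_mulVec, one_mulVec, dotProduct_smul, hx, smul_eq_mul,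
        mul_one]
      linarith [quadForm_le_topEig_of_unit A hx]
  refine le_antisymm (key A c) ?_
  have h := key (A + c • 1) (-c)
  rw [neg_smul, add_neg_cancel_right] at h
  linarith

lemma quadForm_diagonal (f x : Fin N → ℝ) :
    x ⬝ᵥ Matrix.diagonal f *ᵥ x = ∑ i, f i * x i ^ 2 := by
  simp only [dotProduct, mulVec_diagonal]
  exact Finset.sum_congr rfl fun i _ => by ring

lemma topEig_diagonal [NeZero N] (f : Fin N → ℝ) (hf : ∀ i, f i ≤ f 0) :
    topEig (Matrix.diagonal f) = f 0 := by
  refine le_antisymm (topEig_le fun x hx => ?_) ?_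
  · rw [quadForm_diagonal, ← mul_one (f 0), ← hx, dotProduct, Finset.mul_sum]
    exact Finset.sum_le_sum fun i _ => by
      rw [← sq]; exact mul_le_mul_of_nonneg_right (hf i) (sq_nonneg _)
  · have h := quadForm_le_topEig_of_unit (Matrix.diagonal f) (x := Pi.single 0 1) (by simp)
    simpa using h

lemma Hmat_eq (g : Fin N → Fin N → ℝ) :
    Hmat N g = (√(2 * N))⁻¹ • (Matrix.of g + (Matrix.of g).transpose) := by
  ext i j
  simp only [Hmat, Matrix.smul_apply, Matrix.add_apply, of_apply, transpose_apply, smul_eq_mul]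
  split_ifs with h
  · subst h
    rw [Real.sqrt_div (by norm_num), Real.sqrt_mul (by norm_num), mul_inv, ← two_mul]
    have h2 : √2 * √2 = 2 := Real.mul_self_sqrt (by norm_num)
    have h3 : √2 ≠ 0 := by positivity
    rw [div_eq_mul_inv]
    have : √2 = (√2)⁻¹ * 2 := by rw [eq_inv_mul_iff_mul_eq₀ h3, h2]
    nth_rewrite 1 [this]
    ring
  · rw [div_eq_inv_mul]

lemma Hmat_add (g g' : Fin N → Fin N → ℝ) : Hmat N (g + g') = Hmat N g + Hmat N g' := by
  rw [Hmat_eq, Hmat_eq, Hmat_eq, ← smul_add]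
  congr 1
  ext i j
  simp only [Matrix.add_apply, of_apply, transpose_apply, Pi.add_apply]
  ring

lemma Hmat_smul (c : ℝ) (g : Fin N → Fin N → ℝ) : Hmat N (c • g) = c • Hmat N g := by
  rw [Hmat_eq, Hmat_eq, smul_comm]
  congr 1
  ext i j
  simp only [Matrix.smul_apply, Matrix.add_apply, of_apply, transpose_apply, Pi.smul_apply,
    smul_eq_mul]
  ring

lemma Hmat_conjArr (Q : Matrix (Fin N) (Fin N) ℝ) (g : Fin N → Fin N → ℝ) :
    Hmat N (conjArr Q g) = Q * Hmat N g * Q.transpose := by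
  rw [Hmat_eq, Hmat_eq, of_conjArr, Matrix.mul_smul, Matrix.smul_mul, Matrix.mul_add,
    Matrix.add_mul, transpose_mul, transpose_mul, transpose_transpose, ← Matrix.mul_assoc]

lemma continuous_Hmat : Continuous (Hmat N) := by
  have h : Continuous fun g : Fin N → Fin N → ℝ => (Matrix.of g : Matrix (Fin N) (Fin N) ℝ) :=
    continuous_id (X := Fin N → Fin N → ℝ)
  exact ((h.add h.matrix_transpose).const_smul (√(2 * (N : ℝ)))⁻¹).congr fun g => (Hmat_eq g).symm

lemma absSum_smul (c : ℝ) (A : Matrix (Fin N) (Fin N) ℝ) : absSum (c • A) = |c| * absSum A := by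
  simp [absSum, abs_mul, Finset.mul_sum]

lemma absSum_add_le (A B : Matrix (Fin N) (Fin N) ℝ) : absSum (A + B) ≤ absSum A + absSum B := by
  simp only [absSum, ← Finset.sum_add_distrib]
  exact Finset.sum_le_sum fun i _ => Finset.sum_le_sum fun j _ => abs_add_le _ _

lemma absSum_of_le (g : Fin N → Fin N → ℝ) : absSum (Matrix.of g) ≤ N ^ 2 * ‖g‖ := by
  have h : ∀ i j, |g i j| ≤ ‖g‖ := fun i j =>
    (Real.norm_eq_abs _ ▸ norm_le_pi_norm (g i) j).trans (norm_le_pi_norm g i)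
  refine (Finset.sum_le_sum fun i _ => Finset.sum_le_sum fun j _ => h i j).trans ?_
  simp only [Finset.sum_const, Finset.card_univ, Fintype.card_fin, nsmul_eq_mul]
  exact (by ring : (N : ℝ) * (N * ‖g‖) = N ^ 2 * ‖g‖).le

lemma absSum_transpose (A : Matrix (Fin N) (Fin N) ℝ) : absSum A.transpose = absSum A := by
  rw [absSum, Finset.sum_comm]
  rfl

lemma absSum_Hmat_le (g : Fin N → Fin N → ℝ) :
    absSum (Hmat N g) ≤ (√(2 * N))⁻¹ * (2 * N ^ 2) * ‖g‖ := by
  rw [Hmat_eq, absSum_smul, abs_of_nonneg (by positivity), mul_assoc]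
  refine mul_le_mul_of_nonneg_left ((absSum_add_le _ _).trans ?_) (by positivity)
  rw [absSum_transpose]
  linarith [absSum_of_le g]

lemma Mmat_eq (g : Fin N → Fin N → ℝ) :
    Mmat N g = Hmat N (entryMul (fun i j => if i = j then 0 else 1) g) := by
  ext i j
  simp only [Mmat, Hmat, entryMul_apply]
  split_ifs with h h' <;> simp_all

end TopEigenvalue

section Comparison

open Matrix

variable {N : ℕ}

lemma CenteredGaussian.integral_mul_prod {E F : Type*} [NormedAddCommGroup E] [NormedSpace ℝ E]
    [MeasurableSpace E] [BorelSpace E] [CompleteSpace E] [SecondCountableTopology E]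
    [NormedAddCommGroup F] [NormedSpace ℝ F]
    [MeasurableSpace F] [BorelSpace F] [CompleteSpace F] [SecondCountableTopology F]
    {μ : Measure E} {ν : Measure F} (h : CenteredGaussian μ) (h' : CenteredGaussian ν)
    (L M : StrongDual ℝ E) (L' M' : StrongDual ℝ F) :
    ∫ x, (L x.1 + L' x.2) * (M x.1 + M' x.2) ∂(μ.prod ν)
      = ∫ x, L x * M x ∂μ + ∫ x, L' x * M' x ∂ν := by
  have h1 := (h.prod h').integral_mul_eq (L.comp (.fst ℝ E F) + L'.comp (.snd ℝ E F))
    (M.comp (.fst ℝ E F) + M'.comp (.snd ℝ E F))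
  have h2 := h.integral_sq_prod h' (L + M) (L' + M')
  have h3 := h.integral_sq_prod h' L L'
  have h4 := h.integral_sq_prod h' M M'
  rw [h.integral_mul_eq, h'.integral_mul_eq]
  simp only [_root_.add_apply, ContinuousLinearMap.comp_apply, ContinuousLinearMap.coe_fst',
    ContinuousLinearMap.coe_snd'] at h1 h2 ⊢
  rw [h1, h3, h4]
  have h5 : ∀ x : E × F, (L x.1 + L' x.2 + (M x.1 + M' x.2)) ^ 2
      = (L x.1 + M x.1 + (L' x.2 + M' x.2)) ^ 2 := fun x => by ring
  simp only [h5, h2]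
  ring

lemma integrable_topEig [NeZero N] {E : Type*} [NormedAddCommGroup E] [NormedSpace ℝ E]
    [MeasurableSpace E] [BorelSpace E] [CompleteSpace E] [SecondCountableTopology E]
    {μ : Measure E} (h : CenteredGaussian μ) {f : E → Matrix (Fin N) (Fin N) ℝ}
    (hf : Continuous f) {a b : ℝ} (hab : ∀ x, absSum (f x) ≤ a + b * ‖x‖) :
    Integrable (fun x => topEig (f x)) μ :=
  h.integrable_of_le (continuous_topEig.comp hf) fun x => (abs_topEig_le _).trans (hab x)

lemma absSum_add_smul_Hmat_le (A : Matrix (Fin N) (Fin N) ℝ) (c : ℝ) (g : Fin N → Fin N → ℝ) :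
    absSum (A + c • Hmat N g) ≤ absSum A + |c| * ((√(2 * N))⁻¹ * (2 * N ^ 2)) * ‖g‖ := by
  refine (absSum_add_le _ _).trans (add_le_add le_rfl ?_)
  rw [absSum_smul, mul_assoc]
  exact mul_le_mul_of_nonneg_left (absSum_Hmat_le g) (abs_nonneg c)

lemma continuous_add_smul_Hmat (A : Matrix (Fin N) (Fin N) ℝ) (c : ℝ) :
    Continuous fun g => A + c • Hmat N g :=
  continuous_const.add (continuous_Hmat.const_smul c)

lemma integrable_topEig_add_smul_Hmat [NeZero N] (A : Matrix (Fin N) (Fin N) ℝ) (c : ℝ) :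
    Integrable (fun g => topEig (A + c • Hmat N g)) (gMeasure N) :=
  integrable_topEig (gMeasure_centeredGaussian N) (continuous_add_smul_Hmat A c)
    (absSum_add_smul_Hmat_le A c)

lemma exists_unit_net [NeZero N] {δ : ℝ} (hδ : 0 < δ) :
    ∃ t : Finset (Fin N → ℝ), t.Nonempty ∧ (∀ y ∈ t, y ⬝ᵥ y = 1) ∧
      ∀ x : Fin N → ℝ, x ⬝ᵥ x = 1 → ∃ y ∈ t, ‖x - y‖ ≤ δ := by
  have hc : IsCompact {x : Fin N → ℝ | x ⬝ᵥ x = 1} := by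
    refine Metric.isCompact_of_isClosed_isBounded
      (isClosed_eq (continuous_id.dotProduct continuous_id) continuous_const) ?_
    refine (Metric.isBounded_closedBall (x := (0 : Fin N → ℝ)) (r := 1)).subset fun x hx => ?_
    rw [mem_closedBall_zero_iff, pi_norm_le_iff_of_nonneg zero_le_one]
    intro i
    have h := sq_le_dotProduct x i
    rw [show x ⬝ᵥ x = 1 from hx] at h
    exact abs_le_one_iff_mul_self_le_one.2 (by rwa [← sq])
  obtain ⟨t, hts, htf, hcov⟩ := hc.finite_cover_balls hδ
  have key : ∀ x : Fin N → ℝ, x ⬝ᵥ x = 1 → ∃ y ∈ htf.toFinset, ‖x - y‖ ≤ δ := by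
    intro x hx
    obtain ⟨y, hy, hxy⟩ := Set.mem_iUnion₂.1 (hcov hx)
    exact ⟨y, htf.mem_toFinset.2 hy, (dist_eq_norm x y ▸ (Metric.mem_ball.1 hxy)).le⟩
  refine ⟨htf.toFinset, ?_, fun y hy => hts (htf.mem_toFinset.1 hy), key⟩
  obtain ⟨y, hy, -⟩ := key (Pi.single 0 1) (by simp)
  exact ⟨y, hy⟩

lemma abs_le_one_of_unit {x : Fin N → ℝ} (hx : x ⬝ᵥ x = 1) (i : Fin N) : |x i| ≤ 1 := by
  have h := sq_le_dotProduct x i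
  rw [hx] at h
  exact abs_le_one_iff_mul_self_le_one.2 (by rwa [← sq])

lemma quadForm_sub_le (A : Matrix (Fin N) (Fin N) ℝ) {x y : Fin N → ℝ} (hx : x ⬝ᵥ x = 1)
    (hy : y ⬝ᵥ y = 1) : x ⬝ᵥ A *ᵥ x ≤ y ⬝ᵥ A *ᵥ y + 2 * ‖x - y‖ * absSum A := by
  rw [← sub_le_iff_le_add', quadForm_eq_sum, quadForm_eq_sum, absSum, Finset.mul_sum,
    ← Finset.sum_sub_distrib]
  refine Finset.sum_le_sum fun i _ => ?_
  rw [Finset.mul_sum, ← Finset.sum_sub_distrib]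
  refine Finset.sum_le_sum fun j _ => ?_
  rw [← mul_sub, mul_comm]
  refine (le_abs_self _).trans ?_
  rw [abs_mul]
  refine mul_le_mul_of_nonneg_right ?_ (abs_nonneg _)
  have hi : |x i - y i| ≤ ‖x - y‖ := norm_le_pi_norm (x - y) i
  have hj : |x j - y j| ≤ ‖x - y‖ := norm_le_pi_norm (x - y) j
  have e : x i * x j - y i * y j = x i * (x j - y j) + (x i - y i) * y j := by ring
  rw [e]
  refine (abs_add_le _ _).trans ?_
  rw [abs_mul, abs_mul]
  nlinarith [abs_le_one_of_unit hx i, abs_le_one_of_unit hy j, abs_nonneg (x i), abs_nonneg (y j),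
    abs_nonneg (x i - y i), abs_nonneg (x j - y j)]

lemma quadForm_Hmat (g : Fin N → Fin N → ℝ) (u : Fin N → ℝ) :
    u ⬝ᵥ Hmat N g *ᵥ u
      = arrFunctional (fun a b => 2 * (√(2 * N))⁻¹ * (u a * u b)) g := by
  rw [quadForm_eq_sum, Hmat_eq, arrFunctional_apply]
  simp only [Matrix.smul_apply, Matrix.add_apply, of_apply, transpose_apply, smul_eq_mul, mul_add,
    add_mul, Finset.sum_add_distrib]
  rw [Finset.sum_comm (f := fun i j => (√(2 * (N : ℝ)))⁻¹ * g j i * (u i * u j)),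
    ← Finset.sum_add_distrib]
  refine Finset.sum_congr rfl fun a _ => ?_
  rw [← Finset.sum_add_distrib]
  exact Finset.sum_congr rfl fun b _ => by ring

lemma sum_mul_sum_eq_dotProduct_sq (u w : Fin N → ℝ) (c : ℝ) :
    ∑ a, ∑ b, c * (u a * u b) * (c * (w a * w b)) = c ^ 2 * (u ⬝ᵥ w) ^ 2 := by
  rw [sq (u ⬝ᵥ w), dotProduct, Finset.sum_mul_sum, Finset.mul_sum]
  refine Finset.sum_congr rfl fun a _ => ?_
  rw [Finset.mul_sum]
  exact Finset.sum_congr rfl fun b _ => by ring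

lemma integral_mul_map_pi {E ι : Type*} [NormedAddCommGroup E] [NormedSpace ℝ E]
    [MeasurableSpace E] [BorelSpace E] [CompleteSpace E] [SecondCountableTopology E] [Fintype ι]
    (μ : Measure E) (T : E →L[ℝ] (ι → ℝ)) (i j : ι) :
    ∫ x, x i * x j ∂(μ.map T) = ∫ x, T x i * T x j ∂μ := by
  rw [integral_map (by fun_prop) (by fun_prop)]

/-- Comparison of the quadratic form of a perturbed diagonal matrix with a linear Gaussian
field, at finitely many unit vectors. -/
lemma integral_sup'_quadForm_le [NeZero N] {ι : Type*} [Fintype ι] [Nonempty ι]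
    (u : ι → Fin N → ℝ) (hu : ∀ i, u i ⬝ᵥ u i = 1) (v : ι → ℝ) {τ : ℝ} (hτ : 0 ≤ τ) :
    ∫ g, Finset.univ.sup' Finset.univ_nonempty
        (fun i => v i + √τ * (u i ⬝ᵥ Hmat N g *ᵥ u i)) ∂(gMeasure N)
      ≤ ∫ x, Finset.univ.sup' Finset.univ_nonempty
          (fun i => v i + 2 * √(τ / N) * (u i ⬝ᵥ x))
          ∂(Measure.pi fun _ : Fin N => gaussianReal 0 1) := by
  have hN : (0 : ℝ) < N := Nat.cast_pos.2 (NeZero.pos N)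
  let μ := gMeasure N
  let γ := gaussianReal 0 1
  let ρ := Measure.pi fun _ : Fin N => gaussianReal 0 1
  have hμ : CenteredGaussian μ := gMeasure_centeredGaussian N
  have hγ : CenteredGaussian γ := .real
  have hρ : CenteredGaussian ρ := centeredGaussian_pi _
  let c : ι → Fin N → Fin N → ℝ := fun i a b => √τ * (2 * (√(2 * N))⁻¹) * (u i a * u i b)
  let b : ℝ := √τ * √(2 / N)
  let T : ((Fin N → Fin N → ℝ) × ℝ) →L[ℝ] (ι → ℝ) :=
    .pi fun i => (arrFunctional (c i)).comp (.fst ℝ _ _) +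
      (b • ContinuousLinearMap.id ℝ ℝ).comp (.snd ℝ _ _)
  let S : (Fin N → ℝ) →L[ℝ] (ι → ℝ) := .pi fun i => vecFunctional fun k => 2 * √(τ / N) * u i k
  have hT : ∀ p i, T p i = arrFunctional (c i) p.1 + (b • ContinuousLinearMap.id ℝ ℝ) p.2 :=
    fun p i => rfl
  have hS : ∀ x i, S x i = ∑ k, 2 * √(τ / N) * u i k * x k := fun x i => vecFunctional_apply _ _
  have hs2 : (√(2 * (N : ℝ)))⁻¹ ^ 2 = (2 * (N : ℝ))⁻¹ := by
    rw [inv_pow, Real.sq_sqrt (by positivity)]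
  have hs3 : √(2 / (N : ℝ)) ^ 2 = 2 / N := Real.sq_sqrt (by positivity)
  have hs4 : √(τ / (N : ℝ)) ^ 2 = τ / N := Real.sq_sqrt (by positivity)
  have hs5 : √τ ^ 2 = τ := Real.sq_sqrt hτ
  have mP : ∀ i j, ∫ x, x i * x j ∂((μ.prod γ).map T)
      = 2 * τ / N * ((u i ⬝ᵥ u j) ^ 2 + 1) := by
    intro i j
    rw [integral_mul_map_pi]
    simp only [hT]
    rw [hμ.integral_mul_prod hγ]
    simp only [arrFunctional_apply]
    rw [integral_mul_gMeasure, sum_mul_sum_eq_dotProduct_sq]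
    have : ∫ x, (b • ContinuousLinearMap.id ℝ ℝ) x * (b • ContinuousLinearMap.id ℝ ℝ) x ∂γ
        = b ^ 2 := by
      have e : ∀ x : ℝ, (b • ContinuousLinearMap.id ℝ ℝ) x * (b • ContinuousLinearMap.id ℝ ℝ) x
          = b ^ 2 * x ^ 2 := fun x => by
        rw [_root_.smul_apply, ContinuousLinearMap.id_apply, smul_eq_mul]; ring
      simp only [e, integral_const_mul]
      rw [integral_sq_gaussianReal, mul_one]
    rw [this]
    simp only [b, mul_pow, hs2, hs3, hs5]
    field_simp
  have mQ : ∀ i j, ∫ x, x i * x j ∂(ρ.map S) = 4 * τ / N * (u i ⬝ᵥ u j) := by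
    intro i j
    rw [integral_mul_map_pi]
    simp only [hS]
    rw [integral_mul_pi_gaussianReal, dotProduct, Finset.mul_sum]
    refine Finset.sum_congr rfl fun k _ => ?_
    calc _ = 4 * √(τ / N) ^ 2 * (u i k * u j k) := by ring
      _ = _ := by rw [hs4]; ring
  have main := integral_sup'_le ((hμ.prod hγ).map T) (hρ.map S)
    (fun i => by simp only [sq, mP, mQ, hu]; ring)
    (fun i j => by
      rw [mP, mQ]
      have : 0 ≤ 2 * τ / N * (u i ⬝ᵥ u j - 1) ^ 2 := by positivity
      have e : 2 * τ / N * (u i ⬝ᵥ u j - 1) ^ 2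
        = 2 * τ / N * ((u i ⬝ᵥ u j) ^ 2 + 1) - 4 * τ / N * (u i ⬝ᵥ u j) := by ring
      linarith) v
  have hcont : Continuous fun x : ι → ℝ => Finset.univ.sup' Finset.univ_nonempty (v + x) :=
    continuous_univ_sup'.comp (by fun_prop)
  rw [integral_map (by fun_prop) hcont.aestronglyMeasurable,
    integral_map (by fun_prop) hcont.aestronglyMeasurable] at main
  have eS : ∀ x, v + S x = fun i => v i + 2 * √(τ / N) * (u i ⬝ᵥ x) := fun x => by
    ext i
    rw [Pi.add_apply, hS, dotProduct, Finset.mul_sum]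
    simp only [mul_assoc]
  simp only [eS] at main
  refine le_trans (le_of_eq ?_) main
  let f : (Fin N → Fin N → ℝ) → ι → ℝ := fun g => (fun i => arrFunctional (c i) g)
  have eH : ∀ g, (fun i => v i + √τ * (u i ⬝ᵥ Hmat N g *ᵥ u i)) = v + f g := fun g => by
    ext i
    simp only [f, Pi.add_apply, quadForm_Hmat, arrFunctional_apply, c, Finset.mul_sum, mul_assoc]
  have eT : ∀ p, Finset.univ.sup' Finset.univ_nonempty (v + T p)
      = Finset.univ.sup' Finset.univ_nonempty (v + f p.1) + b * p.2 := fun p => by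
    have := Finset.apply_sup'_eq_sup'_comp (Finset.univ_nonempty (α := ι)) (f := v + f p.1)
      (fun y => y + b * p.2) (fun x y => (max_add_add_right x y (b * p.2)).symm)
    rw [this]
    congr 1
    ext i
    simp only [Pi.add_apply, hT, Function.comp, f, _root_.smul_apply, ContinuousLinearMap.id_apply,
      smul_eq_mul]
    ring
  have hfi : Integrable (fun g => Finset.univ.sup' Finset.univ_nonempty (v + f g)) μ := by
    let F : (Fin N → Fin N → ℝ) →L[ℝ] (ι → ℝ) := .pi fun i => arrFunctional (c i)
    exact (integrable_map_measure hcont.aestronglyMeasurable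
      (by fun_prop : AEMeasurable F μ)).1 (integrable_sup' (hμ.map F) v)
  have hγi : Integrable (fun x : ℝ => b * x) γ := by
    have := (hγ.integrable_dual (.id ℝ ℝ)).const_mul b
    exact this
  simp only [eH, eT]
  rw [integral_add (hfi.comp_fst γ) (hγi.comp_snd μ),
    integral_fun_fst (fun g => Finset.univ.sup' Finset.univ_nonempty (v + f g)),
    integral_fun_snd (fun x : ℝ => b * x), integral_const_mul]
  have : ∫ x, x ∂γ = 0 := integral_id_gaussianReal
  simp [this, μ]

lemma integral_sup'_linear_le [NeZero N] {ι : Type*} [Fintype ι] [Nonempty ι]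
    (u : ι → Fin N → ℝ) (hu : ∀ i, u i ⬝ᵥ u i = 1) (Λ : Fin N → ℝ) {x τ : ℝ}
    (hx : ∀ k, Λ k < x) (hτ : 0 ≤ τ) :
    ∫ w, Finset.univ.sup' Finset.univ_nonempty
        (fun i => u i ⬝ᵥ Matrix.diagonal Λ *ᵥ u i + 2 * √(τ / N) * (u i ⬝ᵥ w))
        ∂(Measure.pi fun _ : Fin N => gaussianReal 0 1)
      ≤ x + τ / N * ∑ k, 1 / (x - Λ k) := by
  set ρ := Measure.pi fun _ : Fin N => gaussianReal 0 1
  have hρ : CenteredGaussian ρ := centeredGaussian_pi (Fin N)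
  have := hρ.gauss
  have hsq : ∀ k : Fin N, ∫ w, w k ^ 2 ∂ρ = 1 :=
    fun k => by simpa [Pi.single_apply] using integral_sq_pi_gaussianReal (Pi.single k (1 : ℝ))
  have hsqi : ∀ k : Fin N, Integrable (fun w => w k ^ 2) ρ := fun k => by
    simp only [sq]
    exact hρ.integrable_dual_mul (.proj k) (.proj k)
  have hi : Integrable (fun w => τ / N * ∑ k, w k ^ 2 * (1 / (x - Λ k))) ρ :=
    (integrable_finsetSum _ fun k _ => (hsqi k).mul_const _).const_mul _
  have hs4 : √(τ / (N : ℝ)) ^ 2 = τ / N := Real.sq_sqrt (by positivity)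
  have hi' : Integrable (fun w => x + τ / N * ∑ k, w k ^ 2 * (1 / (x - Λ k))) ρ :=
    (integrable_const x).add hi
  refine (integral_mono ?_ hi' fun w => ?_).trans (le_of_eq ?_)
  · let v : ι → ℝ := fun i => u i ⬝ᵥ Matrix.diagonal Λ *ᵥ u i
    let S : (Fin N → ℝ) →L[ℝ] (ι → ℝ) :=
      .pi fun i => vecFunctional fun k => 2 * √(τ / N) * u i k
    have hcont : Continuous fun z : ι → ℝ => Finset.univ.sup' Finset.univ_nonempty (v + z) :=
      continuous_univ_sup'.comp (by fun_prop)
    have hS : AEMeasurable S ρ := by fun_prop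
    have h2 := (integrable_map_measure hcont.aestronglyMeasurable hS).1
      (integrable_sup' (hρ.map S) v)
    refine h2.congr (ae_of_all _ fun w => ?_)
    have e : v + S w = fun i => u i ⬝ᵥ Matrix.diagonal Λ *ᵥ u i + 2 * √(τ / N) * (u i ⬝ᵥ w) := by
      ext i
      simp only [S, v, Pi.add_apply, ContinuousLinearMap.coe_pi', vecFunctional_apply, dotProduct,
        Finset.mul_sum, mul_assoc]
    simp only [Function.comp, e]
  · refine Finset.sup'_le _ _ fun i _ => ?_
    have hx1 : ∑ k, x * u i k ^ 2 = x := by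
      rw [← Finset.mul_sum]
      have := hu i
      simp only [dotProduct, ← sq] at this
      rw [this, mul_one]
    beta_reduce
    rw [quadForm_diagonal, dotProduct, Finset.mul_sum, Finset.mul_sum, ← sub_le_iff_le_add']
    refine le_trans (le_of_eq (b := ∑ k, (Λ k * u i k ^ 2 + 2 * √(τ / N) * (u i k * w k)
      - x * u i k ^ 2)) ?_) (Finset.sum_le_sum fun k _ => ?_)
    · rw [Finset.sum_sub_distrib, Finset.sum_add_distrib, hx1]
    have hk : 0 < x - Λ k := sub_pos.2 (hx k)
    rw [← sub_nonneg]
    have e : τ / N * (w k ^ 2 * (1 / (x - Λ k)))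
        - (Λ k * u i k ^ 2 + 2 * √(τ / N) * (u i k * w k) - x * u i k ^ 2)
        = ((x - Λ k) * u i k - √(τ / N) * w k) ^ 2 / (x - Λ k) := by
      rw [← hs4, eq_div_iff hk.ne', Real.sqrt_sq (Real.sqrt_nonneg _)]
      field_simp
      ring
    rw [e]
    positivity
  · rw [integral_add (integrable_const x) hi, integral_const_mul,
      integral_finsetSum _ fun k _ => (hsqi k).mul_const _]
    simp only [integral_mul_const, hsq, one_mul]
    simp

/-- Upper bound for the expected top eigenvalue of a GOE perturbation of a diagonal matrix. -/
lemma integral_topEig_diagonal_add_le [NeZero N] (Λ : Fin N → ℝ) {x τ : ℝ}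
    (hx : ∀ k, Λ k < x) (hτ : 0 ≤ τ) :
    ∫ g, topEig (Matrix.diagonal Λ + √τ • Hmat N g) ∂(gMeasure N)
      ≤ x + τ / N * ∑ k, 1 / (x - Λ k) := by
  have hN : (0 : ℝ) < N := Nat.cast_pos.2 (NeZero.pos N)
  have hμ := gMeasure_centeredGaussian N
  have habs : Integrable (fun g => absSum (Matrix.diagonal Λ + √τ • Hmat N g)) (gMeasure N) :=
    hμ.integrable_of_le (continuous_absSum.comp (continuous_add_smul_Hmat _ _)) fun g =>
      (abs_of_nonneg (absSum_nonneg _)).le.trans (absSum_add_smul_Hmat_le _ _ g)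
  have key : ∀ δ : ℝ, 0 < δ → ∫ g, topEig (Matrix.diagonal Λ + √τ • Hmat N g) ∂(gMeasure N)
      ≤ x + τ / N * ∑ k, 1 / (x - Λ k)
        + 2 * δ * ∫ g, absSum (Matrix.diagonal Λ + √τ • Hmat N g) ∂(gMeasure N) := by
    intro δ hδ
    obtain ⟨t, htn, htu, hcov⟩ := exists_unit_net (N := N) hδ
    have : Nonempty t := htn.coe_sort
    let v : t → ℝ := fun y => y.1 ⬝ᵥ Matrix.diagonal Λ *ᵥ y.1
    let f : (Fin N → Fin N → ℝ) → ℝ := fun g => Finset.univ.sup' Finset.univ_nonempty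
      (fun y : t => v y + √τ * (y.1 ⬝ᵥ Hmat N g *ᵥ y.1))
    have hf : ∀ g (y : t), v y + √τ * (y.1 ⬝ᵥ Hmat N g *ᵥ y.1)
        = y.1 ⬝ᵥ (Matrix.diagonal Λ + √τ • Hmat N g) *ᵥ y.1 := fun g y => by
      rw [add_mulVec, dotProduct_add, smul_mulVec, dotProduct_smul, smul_eq_mul]
    have hfc : Continuous f := by
      refine continuous_univ_sup'.comp (continuous_pi fun y => ?_)
      simp only [quadForm_Hmat]
      fun_prop
    have hfi : Integrable f (gMeasure N) := by
      refine hμ.integrable_of_le hfc (a := absSum (Matrix.diagonal Λ))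
        (b := |√τ| * ((√(2 * N))⁻¹ * (2 * N ^ 2))) fun g => ?_
      have hb : ∀ y : t, |v y + √τ * (y.1 ⬝ᵥ Hmat N g *ᵥ y.1)|
          ≤ absSum (Matrix.diagonal Λ) + |√τ| * ((√(2 * N))⁻¹ * (2 * N ^ 2)) * ‖g‖ := fun y => by
        rw [hf]
        have h := abs_quadForm_le (Matrix.diagonal Λ + √τ • Hmat N g) y.1
        rw [htu _ y.2, mul_one] at h
        exact h.trans (absSum_add_smul_Hmat_le _ _ g)
      rw [abs_le]
      exact ⟨(abs_le.1 (hb (Classical.arbitrary t))).1.trans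
        (Finset.le_sup' (fun y : t => v y + √τ * (y.1 ⬝ᵥ Hmat N g *ᵥ y.1)) (Finset.mem_univ _)),
        Finset.sup'_le _ _ fun i _ => (abs_le.1 (hb i)).2⟩
    have h1 : ∀ g, topEig (Matrix.diagonal Λ + √τ • Hmat N g)
        ≤ f g + 2 * δ * absSum (Matrix.diagonal Λ + √τ • Hmat N g) := fun g =>
      topEig_le fun z hz => by
        obtain ⟨y, hy, hzy⟩ := hcov z hz
        refine (quadForm_sub_le _ hz (htu y hy)).trans (add_le_add ?_ ?_)
        · rw [← hf g ⟨y, hy⟩]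
          exact Finset.le_sup' (fun y : t => v y + √τ * (y.1 ⬝ᵥ Hmat N g *ᵥ y.1))
            (Finset.mem_univ (⟨y, hy⟩ : t))
        · exact mul_le_mul_of_nonneg_right (by linarith) (absSum_nonneg _)
    refine (integral_mono (integrable_topEig_add_smul_Hmat _ _)
      (hfi.add (habs.const_mul (2 * δ))) h1).trans ?_
    rw [Pi.add_def, integral_add hfi (habs.const_mul _), integral_const_mul]
    refine add_le_add ((integral_sup'_quadForm_le (fun y : t => y.1) (fun y => htu y.1 y.2) v
      hτ).trans ?_) le_rfl
    exact integral_sup'_linear_le _ (fun y => htu y.1 y.2) Λ hx hτ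
  have hA : 0 ≤ ∫ g, absSum (Matrix.diagonal Λ + √τ • Hmat N g) ∂(gMeasure N) :=
    integral_nonneg fun g => absSum_nonneg _
  set I := ∫ g, absSum (Matrix.diagonal Λ + √τ • Hmat N g) ∂(gMeasure N)
  refine le_of_forall_pos_le_add fun e he => (key (e / (2 * (I + 1))) (by positivity)).trans ?_
  have : 2 * (e / (2 * (I + 1))) * I ≤ e := by
    rw [show 2 * (e / (2 * (I + 1))) * I = e * (I / (I + 1)) by field_simp]
    exact mul_le_of_le_one_right he.le ((div_le_one (by positivity)).2 (by linarith))
  linarith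

end Comparison

section Rayleigh

open Matrix

variable {N : ℕ}

lemma integral_pow_four_gaussianReal : ∫ x, x ^ 4 ∂(gaussianReal 0 1) = 3 := by
  let γ := gaussianReal 0 1
  have hγ : CenteredGaussian γ := .real
  have hp : ∀ n : ℕ, Integrable (fun x : ℝ => x ^ n) γ := fun n => by
    have h := (hγ.memLp_dual (.id ℝ ℝ) (p := n) (by simp)).integrable_norm_pow'
    refine h.mono' (by fun_prop) (ae_of_all _ fun x => ?_)
    simp
  have h2 : ∫ x, x ^ 2 ∂γ = 1 := integral_sq_gaussianReal
  have h1 : ∫ x, x ∂γ = 0 := integral_id_gaussianReal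
  have hr := hγ.map_add_smul (a := 1) (b := 1) (c := √2) (by norm_num)
  have e := congrArg (fun ρ : Measure ℝ => ∫ x, x ^ 4 ∂ρ) hr
  simp only [smul_eq_mul] at e
  rw [integral_map (by fun_prop) (by fun_prop), integral_map (by fun_prop) (by fun_prop)] at e
  have hm : ∀ m n : ℕ, Integrable (fun p : ℝ × ℝ => p.1 ^ m * p.2 ^ n) (γ.prod γ) := fun m n =>
    (hp m).mul_prod (hp n)
  have hi : ∀ m n : ℕ, ∫ p : ℝ × ℝ, p.1 ^ m * p.2 ^ n ∂(γ.prod γ)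
      = (∫ x, x ^ m ∂γ) * ∫ x, x ^ n ∂γ := fun m n =>
    integral_prod_mul (fun x : ℝ => x ^ m) (fun x : ℝ => x ^ n)
  have e4 : ∀ p : ℝ × ℝ, (p.1 + p.2) ^ 4 = ∑ k ∈ Finset.range 5,
      (Nat.choose 4 k : ℝ) * (p.1 ^ k * p.2 ^ (4 - k)) := fun p => by
    rw [add_pow]
    exact Finset.sum_congr rfl fun k _ => by ring
  have hs : √2 ^ 4 = 4 := by
    rw [show √2 ^ 4 = (√2 ^ 2) ^ 2 by ring, Real.sq_sqrt (by norm_num)]; norm_num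
  simp only [one_mul, mul_pow, hs] at e
  simp only [e4] at e
  rw [integral_finsetSum _ fun k _ => (hm k _).const_mul _, integral_const_mul] at e
  simp only [integral_const_mul, hi, Finset.sum_range_succ, Finset.sum_range_zero] at e
  norm_num [h1, h2, Nat.choose] at e
  change ∫ x, x ^ 4 ∂γ = 3
  linarith

lemma CenteredGaussian.integral_pow_four {E : Type*} [NormedAddCommGroup E] [NormedSpace ℝ E]
    [MeasurableSpace E] [BorelSpace E] [CompleteSpace E] [SecondCountableTopology E]
    {μ : Measure E} (h : CenteredGaussian μ) (L : StrongDual ℝ E) :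
    ∫ x, L x ^ 4 ∂μ = 3 * (∫ x, L x ^ 2 ∂μ) ^ 2 := by
  set v := ∫ x, L x ^ 2 ∂μ with hv
  have hv0 : 0 ≤ v := integral_nonneg fun x => sq_nonneg _
  let S : ℝ →L[ℝ] ℝ := √v • .id ℝ ℝ
  have hS : ∀ x, S x = √v * x := fun x => rfl
  have hl : μ.map L = (gaussianReal 0 1).map S := by
    refine (h.map L).ext (CenteredGaussian.real.map S) fun M => ?_
    have hM : ∀ x : ℝ, M x = M 1 * x := fun x => by
      rw [mul_comm, ← smul_eq_mul, ← map_smul, smul_eq_mul, mul_one]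
    rw [integral_map (by fun_prop) (by fun_prop), integral_map (by fun_prop) (by fun_prop)]
    simp only [hS, hM (L _), hM (√v * _), mul_pow, integral_const_mul, integral_sq_gaussianReal,
      Real.sq_sqrt hv0, ← hv, mul_one]
  have e := congrArg (fun ρ : Measure ℝ => ∫ x, x ^ 4 ∂ρ) hl
  rw [integral_map (by fun_prop) (by fun_prop), integral_map (by fun_prop) (by fun_prop)] at e
  rw [e]
  simp only [hS, mul_pow, integral_const_mul, integral_pow_four_gaussianReal]
  rw [show √v ^ 4 = (√v ^ 2) ^ 2 by ring, Real.sq_sqrt hv0, mul_comm]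

/-- Signs of the entries of `-J G J`, where `J = diag(1, -1, …, -1)`. -/
def flipSign [NeZero N] (i j : Fin N) : ℝ := if i = 0 ↔ j = 0 then -1 else 1

lemma quadForm_flip_average [NeZero N] {G : Matrix (Fin N) (Fin N) ℝ} (hG : ∀ i j, G i j = G j i)
    (y : Fin N → ℝ) :
    ∑ i, ∑ j, (G i j + flipSign i j * G i j) * (y i * y j)
      = 4 * y 0 * (∑ k, G 0 k * y k - G 0 0 * y 0) := by
  have e : ∀ i j, (G i j + flipSign i j * G i j) * (y i * y j)
      = 2 * (if i = 0 then (G 0 j * (y 0 * y j) - if j = 0 then G 0 0 * (y 0 * y 0) else 0) else 0)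
      + 2 * (if j = 0 then (G i 0 * (y i * y 0) - if i = 0 then G 0 0 * (y 0 * y 0) else 0)
        else 0) := by
    intro i j
    rw [flipSign]
    by_cases hi : i = 0 <;> by_cases hj : j = 0 <;> simp [hi, hj] <;> ring
  simp only [e, Finset.sum_add_distrib, ← Finset.mul_sum]
  rw [Finset.sum_comm (f := fun i j => if i = 0 then (G 0 j * (y 0 * y j) -
    if j = 0 then G 0 0 * (y 0 * y 0) else 0) else 0)]
  simp only [Finset.sum_ite_eq', Finset.mem_univ, if_true, Finset.sum_sub_distrib]
  have e2 : ∑ i, G i 0 * (y i * y 0) = y 0 * ∑ k, G 0 k * y k := by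
    rw [Finset.mul_sum]
    exact Finset.sum_congr rfl fun k _ => by rw [hG k 0]; ring
  have e3 : ∑ i, G 0 i * (y 0 * y i) = y 0 * ∑ k, G 0 k * y k := by
    rw [Finset.mul_sum]
    exact Finset.sum_congr rfl fun k _ => by ring
  rw [e2, e3]
  ring

lemma topEig_flip_average_ge [NeZero N] (Λ a : Fin N → ℝ) (ha0 : a 0 = 0)
    (hw : ∀ k, 0 ≤ 2 * a k - (Λ 0 - Λ k) * a k ^ 2) {G : Matrix (Fin N) (Fin N) ℝ}
    (hG : ∀ i j, G i j = G j i) {τ : ℝ} (hτ : 0 ≤ τ) :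
    Λ 0 + τ * (∑ k, (2 * a k - (Λ 0 - Λ k) * a k ^ 2) * G 0 k ^ 2)
        * (1 - τ * ∑ k, a k ^ 2 * G 0 k ^ 2)
      ≤ (topEig (Matrix.diagonal Λ + √τ • G)
        + topEig (Matrix.diagonal Λ + √τ • Matrix.of fun i j => flipSign i j * G i j)) / 2 := by
  set N₁ := τ * ∑ k, (2 * a k - (Λ 0 - Λ k) * a k ^ 2) * G 0 k ^ 2 with hN₁
  set B := τ * ∑ k, a k ^ 2 * G 0 k ^ 2 with hB
  set m := (topEig (Matrix.diagonal Λ + √τ • G)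
        + topEig (Matrix.diagonal Λ + √τ • Matrix.of fun i j => flipSign i j * G i j)) / 2 with hm
  have hN₁0 : 0 ≤ N₁ := mul_nonneg hτ (Finset.sum_nonneg fun k _ => mul_nonneg (hw k) (sq_nonneg _))
  have hB0 : 0 ≤ B := mul_nonneg hτ (Finset.sum_nonneg fun k _ => by positivity)
  have hsτ : √τ * √τ = τ := Real.mul_self_sqrt hτ
  let y : Fin N → ℝ := fun k => (if k = 0 then 1 else 0) + √τ * (a k * G 0 k)
  have hy : ∀ k, y k = (if k = 0 then 1 else 0) + √τ * (a k * G 0 k) := fun k => rfl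
  have hy0 : y 0 = 1 := by simp [hy, ha0]
  have hy2 : ∀ k, y k ^ 2 = (if k = 0 then 1 else 0) + τ * (a k ^ 2 * G 0 k ^ 2) := by
    intro k
    rw [hy]
    split_ifs with hk
    · subst hk; simp [ha0]
    · simp only [zero_add]
      linear_combination (a k ^ 2 * G 0 k ^ 2) * hsτ
  have hyy : y ⬝ᵥ y = 1 + B := by
    simp only [dotProduct, ← sq, hy2, Finset.sum_add_distrib, hB, Finset.mul_sum]
    simp
  have hq : y ⬝ᵥ (Matrix.diagonal Λ + √τ • G) *ᵥ y
      + y ⬝ᵥ (Matrix.diagonal Λ + √τ • Matrix.of fun i j => flipSign i j * G i j) *ᵥ y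
      = 2 * (Λ 0 * (1 + B) + N₁) := by
    have e1 : y ⬝ᵥ G *ᵥ y + y ⬝ᵥ (Matrix.of fun i j => flipSign i j * G i j) *ᵥ y
        = 4 * (√τ * ∑ k, a k * G 0 k ^ 2) := by
      rw [quadForm_eq_sum, quadForm_eq_sum, ← Finset.sum_add_distrib]
      simp only [← Finset.sum_add_distrib, of_apply, ← add_mul]
      rw [quadForm_flip_average hG, hy0]
      simp only [hy, mul_add, Finset.sum_add_distrib, mul_ite, mul_one, mul_zero,
        Finset.sum_ite_eq', Finset.mem_univ, if_true, add_sub_cancel_left, Finset.mul_sum]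
      exact Finset.sum_congr rfl fun k _ => by ring
    have e2 : y ⬝ᵥ Matrix.diagonal Λ *ᵥ y = Λ 0 + τ * ∑ k, Λ k * (a k ^ 2 * G 0 k ^ 2) := by
      rw [quadForm_diagonal]
      simp only [hy2, mul_add, Finset.sum_add_distrib, mul_ite, mul_one, mul_zero,
        Finset.sum_ite_eq', Finset.mem_univ, if_true, Finset.mul_sum]
      congr 1
      exact Finset.sum_congr rfl fun k _ => by ring
    simp only [add_mulVec, dotProduct_add, smul_mulVec, dotProduct_smul, smul_eq_mul]
    have e3 : N₁ = 2 * τ * (∑ k, a k * G 0 k ^ 2) - Λ 0 * B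
        + τ * ∑ k, Λ k * (a k ^ 2 * G 0 k ^ 2) := by
      simp only [hN₁, hB, Finset.mul_sum]
      rw [← Finset.sum_sub_distrib, ← Finset.sum_add_distrib]
      exact Finset.sum_congr rfl fun k _ => by ring
    rw [e2, e3]
    have e4 := congrArg (fun z => √τ * z) e1
    simp only [mul_add] at e4
    have e5 : √τ * (4 * (√τ * ∑ k, a k * G 0 k ^ 2)) = 4 * τ * ∑ k, a k * G 0 k ^ 2 := by
      linear_combination (4 * ∑ k, a k * G 0 k ^ 2) * hsτ
    rw [e5] at e4
    linarith
  have h1 := quadForm_le_topEig (Matrix.diagonal Λ + √τ • G) y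
  have h2 := quadForm_le_topEig
    (Matrix.diagonal Λ + √τ • Matrix.of fun i j => flipSign i j * G i j) y
  rw [hyy] at h1 h2
  have h3 : N₁ ≤ (m - Λ 0) * (1 + B) := by
    rw [hm]; linarith
  have h4 : N₁ * (1 - B) * (1 + B) ≤ (m - Λ 0) * (1 + B) := by
    nlinarith [mul_nonneg hN₁0 (sq_nonneg B)]
  linarith [le_of_mul_le_mul_right h4 (by linarith)]

lemma measurePreserving_entryMul_flipSign [NeZero N] :
    MeasurePreserving (entryMul flipSign) (gMeasure N) (gMeasure N) :=
  measurePreserving_entryMul fun i j => by rw [flipSign]; split_ifs <;> norm_num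

lemma integral_comp_entryMul_flipSign [NeZero N] {f : (Fin N → Fin N → ℝ) → ℝ}
    (hf : Continuous f) :
    ∫ g, f (entryMul flipSign g) ∂(gMeasure N) = ∫ g, f g ∂(gMeasure N) := by
  conv_rhs => rw [← measurePreserving_entryMul_flipSign.map_eq]
  rw [integral_map (by fun_prop) hf.aestronglyMeasurable]

lemma Hmat_entryMul_flipSign [NeZero N] (g : Fin N → Fin N → ℝ) :
    Hmat N (entryMul flipSign g) = Matrix.of fun i j => flipSign i j * Hmat N g i j := by
  have hs : ∀ i j : Fin N, flipSign j i = flipSign i j := fun i j => by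
    simp only [flipSign, iff_comm]
  ext i j
  simp only [Hmat_eq, Matrix.smul_apply, Matrix.add_apply, of_apply, transpose_apply,
    entryMul_apply, smul_eq_mul, hs i j]
  ring

lemma Hmat_apply_eq (g : Fin N → Fin N → ℝ) (i j : Fin N) :
    Hmat N g i j = arrFunctional (fun a b => (√(2 * N))⁻¹ *
      ((if a = i then if b = j then 1 else 0 else 0)
        + if a = j then if b = i then 1 else 0 else 0)) g := by
  rw [Hmat_eq, arrFunctional_apply]
  simp only [Matrix.smul_apply, Matrix.add_apply, of_apply, transpose_apply, smul_eq_mul, mul_add,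
    add_mul, Finset.sum_add_distrib]
  have e : ∀ i j : Fin N, ∑ a, ∑ b,
      (√(2 * N))⁻¹ * (if a = i then if b = j then 1 else 0 else 0) * g a b
        = (√(2 * N))⁻¹ * g i j := by
    intro i j
    rw [Finset.sum_eq_single_of_mem i (Finset.mem_univ _) (fun b _ hb => by simp [hb])]
    simp
  rw [e, e]

lemma integral_sq_Hmat {i j : Fin N} (hij : i ≠ j) :
    ∫ g, Hmat N g i j ^ 2 ∂(gMeasure N) = 1 / N := by
  have hN : (N : ℝ) ≠ 0 := Nat.cast_ne_zero.2 fun h => by subst h; exact i.elim0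
  simp only [Hmat_apply_eq, arrFunctional_apply]
  rw [integral_sq_gMeasure]
  have e : ∀ a b : Fin N, ((√(2 * N))⁻¹ * ((if a = i then if b = j then (1 : ℝ) else 0 else 0)
        + if a = j then if b = i then 1 else 0 else 0)) ^ 2
      = (2 * (N : ℝ))⁻¹ * ((if a = i then if b = j then 1 else 0 else 0)
        + if a = j then if b = i then 1 else 0 else 0) := by
    intro a b
    rw [mul_pow, inv_pow, Real.sq_sqrt (by positivity)]
    by_cases ha : a = i <;> by_cases hb : a = j <;> split_ifs <;> simp_all
  simp only [e, ← Finset.mul_sum, Finset.sum_add_distrib]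
  have e2 : ∀ i j : Fin N, ∑ a, ∑ b, (if a = i then if b = j then (1 : ℝ) else 0 else 0) = 1 := by
    intro i j
    rw [Finset.sum_eq_single_of_mem i (Finset.mem_univ _) (fun b _ hb => by simp [hb])]
    simp
  rw [e2, e2]
  field_simp
  norm_num

lemma integrable_Hmat_pow (i j : Fin N) (n : ℕ) :
    Integrable (fun g => Hmat N g i j ^ n) (gMeasure N) := by
  have h := ((gMeasure_centeredGaussian N).memLp_dual (arrFunctional (fun a b => (√(2 * N))⁻¹ *
      ((if a = i then if b = j then 1 else 0 else 0)
        + if a = j then if b = i then 1 else 0 else 0))) (p := n) (by simp)).integrable_norm_pow'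
  simp only [Hmat_apply_eq]
  exact h.mono' (by fun_prop) (ae_of_all _ fun x => by simp)

lemma integral_pow_four_Hmat {i j : Fin N} (hij : i ≠ j) :
    ∫ g, Hmat N g i j ^ 4 ∂(gMeasure N) = 3 / N ^ 2 := by
  have h := integral_sq_Hmat hij
  simp only [Hmat_apply_eq] at h ⊢
  rw [(gMeasure_centeredGaussian N).integral_pow_four, h]
  ring

lemma integrable_sq_Hmat_mul_sq_Hmat (i j k l : Fin N) :
    Integrable (fun g => Hmat N g i j ^ 2 * Hmat N g k l ^ 2) (gMeasure N) := by
  have h : Integrable (fun g => (Hmat N g i j ^ 4 + Hmat N g k l ^ 4) / 2) (gMeasure N) :=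
    ((integrable_Hmat_pow i j 4).add (integrable_Hmat_pow k l 4)).div_const 2
  refine h.mono' ?_ (ae_of_all _ fun g => ?_)
  · simp only [Hmat_apply_eq]; fun_prop
  · rw [Real.norm_of_nonneg (by positivity)]
    nlinarith [sq_nonneg (Hmat N g i j ^ 2 - Hmat N g k l ^ 2)]

lemma integral_sq_Hmat_mul_sq_Hmat_le {i j k l : Fin N} (hij : i ≠ j) (hkl : k ≠ l) :
    ∫ g, Hmat N g i j ^ 2 * Hmat N g k l ^ 2 ∂(gMeasure N) ≤ 3 / N ^ 2 := by
  have h : Integrable (fun g => (Hmat N g i j ^ 4 + Hmat N g k l ^ 4) / 2) (gMeasure N) :=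
    ((integrable_Hmat_pow i j 4).add (integrable_Hmat_pow k l 4)).div_const 2
  have h1 := integral_mono (integrable_sq_Hmat_mul_sq_Hmat i j k l) h fun g => by
    nlinarith [sq_nonneg (Hmat N g i j ^ 2 - Hmat N g k l ^ 2)]
  rw [integral_div, integral_add (integrable_Hmat_pow i j 4) (integrable_Hmat_pow k l 4),
    integral_pow_four_Hmat hij, integral_pow_four_Hmat hkl] at h1
  linarith

/-- A lower bound for the largest eigenvalue of a perturbed diagonal matrix, from the test vector
with coordinates `√τ • a k • H 0 k` away from the leading one. -/
lemma le_integral_topEig_diagonal_add [NeZero N] (Λ a : Fin N → ℝ) (ha0 : a 0 = 0)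
    (hw : ∀ k, 0 ≤ 2 * a k - (Λ 0 - Λ k) * a k ^ 2) {τ : ℝ} (hτ : 0 ≤ τ) :
    Λ 0 + τ / N * (∑ k, (2 * a k - (Λ 0 - Λ k) * a k ^ 2)) * (1 - 3 * τ / N * ∑ k, a k ^ 2)
      ≤ ∫ g, topEig (Matrix.diagonal Λ + √τ • Hmat N g) ∂(gMeasure N) := by
  have hN : (0 : ℝ) < N := Nat.cast_pos.2 (NeZero.pos N)
  set w : Fin N → ℝ := fun k => 2 * a k - (Λ 0 - Λ k) * a k ^ 2 with hwdef
  have hw0 : w 0 = 0 := by simp [hwdef, ha0]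
  let f : (Fin N → Fin N → ℝ) → ℝ := fun g => topEig (Matrix.diagonal Λ + √τ • Hmat N g)
  have hfc : Continuous f := continuous_topEig.comp (continuous_add_smul_Hmat _ _)
  have hfi : Integrable f (gMeasure N) := integrable_topEig_add_smul_Hmat _ _
  have hfi' : Integrable (fun g => f (entryMul flipSign g)) (gMeasure N) :=
    measurePreserving_entryMul_flipSign.integrable_comp_of_integrable hfi
  have hii : ∀ k l, Integrable (fun g => w k * (a l ^ 2 * (Hmat N g 0 k ^ 2 * Hmat N g 0 l ^ 2)))
      (gMeasure N) := fun k l =>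
    ((integrable_sq_Hmat_mul_sq_Hmat 0 k 0 l).const_mul _).const_mul _
  have hi2 : Integrable (fun g => ∑ k, ∑ l, w k * (a l ^ 2 * (Hmat N g 0 k ^ 2 * Hmat N g 0 l ^ 2)))
      (gMeasure N) := integrable_finsetSum _ fun k _ => integrable_finsetSum _ fun l _ => hii k l
  have hi1 : Integrable (fun g => ∑ k, w k * Hmat N g 0 k ^ 2) (gMeasure N) :=
    integrable_finsetSum _ fun k _ => (integrable_Hmat_pow 0 k 2).const_mul _
  have hd : Integrable (fun g => τ * ∑ k, w k * Hmat N g 0 k ^ 2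
      - τ ^ 2 * ∑ k, ∑ l, w k * (a l ^ 2 * (Hmat N g 0 k ^ 2 * Hmat N g 0 l ^ 2)))
      (gMeasure N) := (hi1.const_mul _).sub (hi2.const_mul _)
  have hl : Integrable (fun g => Λ 0 + (τ * ∑ k, w k * Hmat N g 0 k ^ 2
      - τ ^ 2 * ∑ k, ∑ l, w k * (a l ^ 2 * (Hmat N g 0 k ^ 2 * Hmat N g 0 l ^ 2))))
      (gMeasure N) := (integrable_const _).add hd
  have hr : Integrable (fun g => (f g + f (entryMul flipSign g)) / 2) (gMeasure N) :=
    (hfi.add hfi').div_const 2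
  have key := integral_mono hl hr fun g => by
    have h := topEig_flip_average_ge Λ a ha0 hw (G := Hmat N g)
      (fun i j => by simp only [Hmat_eq, Matrix.smul_apply, Matrix.add_apply, of_apply,
        transpose_apply, add_comm]) hτ
    simp only [f, Hmat_entryMul_flipSign]
    refine le_trans (le_of_eq ?_) h
    have e : ∑ k, ∑ l, w k * (a l ^ 2 * (Hmat N g 0 k ^ 2 * Hmat N g 0 l ^ 2))
        = (∑ k, w k * Hmat N g 0 k ^ 2) * ∑ l, a l ^ 2 * Hmat N g 0 l ^ 2 := by
      rw [Finset.sum_mul_sum]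
      exact Finset.sum_congr rfl fun k _ => Finset.sum_congr rfl fun l _ => by ring
    rw [e]
    ring
  rw [integral_div, integral_add hfi hfi', integral_comp_entryMul_flipSign hfc] at key
  rw [integral_add (integrable_const _) hd,
    integral_sub (hi1.const_mul _) (hi2.const_mul _), integral_const_mul, integral_const_mul,
    integral_finsetSum _ fun k _ => (integrable_Hmat_pow 0 k 2).const_mul _,
    integral_finsetSum _ fun k _ => integrable_finsetSum _ fun l _ => hii k l] at key
  have s1 : ∑ k, ∫ g, w k * Hmat N g 0 k ^ 2 ∂(gMeasure N) = (∑ k, w k) / N := by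
    rw [Finset.sum_div]
    refine Finset.sum_congr rfl fun k _ => ?_
    rw [integral_const_mul]
    by_cases hk : k = 0
    · subst hk; simp [hw0]
    · rw [integral_sq_Hmat (Ne.symm hk)]; ring
  have s2 : ∑ k, ∫ g, ∑ l, w k * (a l ^ 2 * (Hmat N g 0 k ^ 2 * Hmat N g 0 l ^ 2)) ∂(gMeasure N)
      ≤ 3 / N ^ 2 * ((∑ k, w k) * ∑ l, a l ^ 2) := by
    rw [Finset.sum_mul_sum, Finset.mul_sum]
    refine Finset.sum_le_sum fun k _ => ?_
    rw [integral_finsetSum _ fun l _ => hii k l, Finset.mul_sum]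
    refine Finset.sum_le_sum fun l _ => ?_
    rw [integral_const_mul, integral_const_mul]
    by_cases hk : k = 0
    · subst hk; simp [hw0]
    by_cases hl : l = 0
    · subst hl; simp [ha0]
    have := integral_sq_Hmat_mul_sq_Hmat_le (Ne.symm hk) (Ne.symm hl)
    have h0 : 0 ≤ w k * a l ^ 2 := mul_nonneg (hw k) (sq_nonneg _)
    calc _ = w k * a l ^ 2 * ∫ g, Hmat N g 0 k ^ 2 * Hmat N g 0 l ^ 2 ∂(gMeasure N) := by ring
      _ ≤ w k * a l ^ 2 * (3 / N ^ 2) := mul_le_mul_of_nonneg_left this h0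
      _ = _ := by ring
  rw [s1] at key
  simp only [integral_const, probReal_univ, one_smul] at key
  have s3 := mul_le_mul_of_nonneg_left s2 (sq_nonneg τ)
  refine le_trans (le_trans (le_of_eq ?_) (add_le_add_right (sub_le_sub_left s3 _) _))
    (key.trans (le_of_eq ?_))
  · field_simp
  · simp only [f]; ring

end Rayleigh

section DiagonalAverage

open Matrix

variable {N : ℕ}

/-- The diagonal part of a matrix. -/
def diagPart (A : Matrix (Fin N) (Fin N) ℝ) : Matrix (Fin N) (Fin N) ℝ :=
  Matrix.diagonal fun i => A i i

/-- The change of the diagonal part of `A` when the basis vectors `e a`, `e b` are replaced by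
`(e a + e b) / √2` and `(e a - e b) / √2`. -/
def pairTerm (A : Matrix (Fin N) (Fin N) ℝ) (a b : Fin N) : Matrix (Fin N) (Fin N) ℝ :=
  Matrix.of fun i j => if a = b then 0 else
    (A b b - A a a) / 2 * ((if i = a then 1 else 0) * if j = a then 1 else 0)
      + (A a a - A b b) / 2 * ((if i = b then 1 else 0) * if j = b then 1 else 0)
      + A a b * (((if i = a then 1 else 0) * if j = b then 1 else 0)
        + (if i = b then 1 else 0) * if j = a then 1 else 0)

lemma sum_eq_add_of_eq_off_pair {F G : Fin N → ℝ} {a b : Fin N} (hab : a ≠ b)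
    (h : ∀ m, m ≠ a → m ≠ b → F m = G m) :
    ∑ m, F m = ∑ m, G m + ((F a - G a) + (F b - G b)) := by
  rw [← sub_eq_iff_eq_add', ← Finset.sum_sub_distrib]
  exact Finset.sum_eq_add a b hab (fun m _ hm => by rw [h m hm.1 hm.2, sub_self])
    (fun h => absurd (Finset.mem_univ _) h) fun h => absurd (Finset.mem_univ _) h

lemma exists_conj_diagPart (a b : Fin N) : ∃ Q : Matrix (Fin N) (Fin N) ℝ,
    Q * Q.transpose = 1 ∧ ∀ A : Matrix (Fin N) (Fin N) ℝ, (∀ i j, A i j = A j i) →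
      Q * diagPart (Q.transpose * A * Q) * Q.transpose = diagPart A + pairTerm A a b := by
  by_cases hab : a = b
  · refine ⟨1, by simp, fun A _ => ?_⟩
    ext i j
    simp [hab, pairTerm]
  let e : Fin N → Fin N → ℝ := fun a => Pi.single a 1
  have he : ∀ a i, e a i = if i = a then 1 else 0 := fun a i => Pi.single_apply _ _ _
  let u : Fin N → Fin N → ℝ := fun m =>
    if m = a then (√2)⁻¹ • (e a + e b) else if m = b then (√2)⁻¹ • (e a - e b) else e m
  have ua : u a = (√2)⁻¹ • (e a + e b) := by simp [u]
  have ub : u b = (√2)⁻¹ • (e a - e b) := by simp [u, Ne.symm hab]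
  have um : ∀ m, m ≠ a → m ≠ b → u m = e m := fun m h1 h2 => by simp [u, h1, h2]
  have h2 : (√2)⁻¹ * (√2)⁻¹ = 1 / 2 := by
    rw [← mul_inv, Real.mul_self_sqrt (by norm_num), one_div]
  refine ⟨(Matrix.of u).transpose, ?_, fun A hA => ?_⟩
  · ext i j
    simp only [transpose_transpose, mul_apply, transpose_apply, of_apply]
    rw [sum_eq_add_of_eq_off_pair (G := fun m => e m i * e m j) hab
      fun m h1 h2 => by rw [um m h1 h2], ua, ub]
    have e1 : ∑ m, e m i * e m j = (1 : Matrix (Fin N) (Fin N) ℝ) i j := by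
      simp [he, Matrix.one_apply]
    rw [e1]
    simp only [Pi.smul_apply, Pi.add_apply, Pi.sub_apply, smul_eq_mul]
    linear_combination (2 * (e a i * e a j) + 2 * (e b i * e b j)) * h2
  have hq : ∀ m, (Matrix.of u * A * (Matrix.of u).transpose) m m
      = u m ⬝ᵥ A *ᵥ u m := fun m => by
    rw [quadForm_eq_sum]
    simp only [mul_apply, transpose_apply, of_apply, Finset.sum_mul]
    rw [Finset.sum_comm]
    exact Finset.sum_congr rfl fun i _ => Finset.sum_congr rfl fun j _ => by ring
  have hee : ∀ a b, e a ⬝ᵥ A *ᵥ e b = A a b := fun a b => by simp [e]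
  ext i j
  rw [diagPart, mul_apply, transpose_transpose]
  simp only [mul_diagonal, hq, transpose_apply, of_apply, Matrix.add_apply]
  rw [sum_eq_add_of_eq_off_pair (G := fun m => e m i * A m m * e m j) hab
      fun m h1 h2 => by rw [um m h1 h2, hee], ua, ub]
  have e1 : ∑ m, e m i * A m m * e m j = diagPart A i j := by
    simp only [he, diagPart, Matrix.diagonal_apply, ite_mul, one_mul, zero_mul, mul_ite, mul_one,
      mul_zero, Finset.sum_ite_eq, Finset.mem_univ, if_true]
    split_ifs with h <;> simp_all
  rw [e1]
  simp only [pairTerm, of_apply, hab, if_false, ← he, mulVec_smul, mulVec_add, mulVec_sub,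
    dotProduct_smul, smul_dotProduct, dotProduct_add, add_dotProduct, dotProduct_sub,
    sub_dotProduct, hee, Pi.smul_apply, Pi.add_apply, Pi.sub_apply, smul_eq_mul, hA b a]
  have h4 : (√2)⁻¹ * (√2)⁻¹ * ((√2)⁻¹ * (√2)⁻¹) = 1 / 4 := by rw [h2]; norm_num
  linear_combination ((e a i + e b i) * (e a j + e b j) * (A a a + A a b + (A a b + A b b))
    + (e a i - e b i) * (e a j - e b j) * (A a a - A a b - (A a b - A b b))) * h4

lemma sum_sum_pairTerm {A : Matrix (Fin N) (Fin N) ℝ} (hA : ∀ i j, A i j = A j i) :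
    ∑ a, ∑ b, pairTerm A a b = A.trace • 1 - (N + 2 : ℝ) • diagPart A + (2 : ℝ) • A := by
  have e1 : ∀ (a b i j : Fin N), pairTerm A a b i j
      = (A b b - A a a) / 2 * ((if i = a then 1 else 0) * if j = a then 1 else 0)
      + (A a a - A b b) / 2 * ((if i = b then 1 else 0) * if j = b then 1 else 0)
      + A a b * (((if i = a then 1 else 0) * if j = b then 1 else 0)
        + (if i = b then 1 else 0) * if j = a then 1 else 0)
      - if a = b then 2 * A a a * ((if i = a then 1 else 0) * if j = a then 1 else 0) else 0 := by
    intro a b i j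
    simp only [pairTerm, of_apply]
    split_ifs with h <;> simp_all
    ring
  ext i j
  simp only [Matrix.sum_apply, e1, Finset.sum_add_distrib, Finset.sum_sub_distrib]
  rw [Finset.sum_comm (f := fun a b => (A a a - A b b) / 2 *
    ((if i = b then 1 else 0) * if j = b then 1 else 0))]
  simp [mul_add, Finset.sum_add_distrib, diagPart, Matrix.trace, Matrix.diagonal_apply,
    Matrix.one_apply, ← Finset.sum_div]
  by_cases h : i = j
  · subst h; simp; ring
  · simp [h, hA j i]; ring

lemma topEig_sum_le [NeZero N] {ι : Type*} (s : Finset ι) (A : ι → Matrix (Fin N) (Fin N) ℝ) :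
    topEig (∑ i ∈ s, A i) ≤ ∑ i ∈ s, topEig (A i) := by
  classical
  induction s using Finset.induction_on with
  | empty => simp [topEig_zero]
  | insert i s hi ih =>
    rw [Finset.sum_insert hi, Finset.sum_insert hi]
    exact (topEig_add_le _ _).trans (by linarith)

lemma continuous_diagPart : Continuous (diagPart : Matrix (Fin N) (Fin N) ℝ → _) := by
  unfold diagPart
  fun_prop

lemma absSum_diagPart_le (A : Matrix (Fin N) (Fin N) ℝ) : absSum (diagPart A) ≤ absSum A := by
  refine Finset.sum_le_sum fun i _ => Finset.sum_le_sum fun j _ => ?_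
  rw [diagPart, Matrix.diagonal_apply]
  split_ifs with h
  · rw [h]
  · simp

lemma integrable_topEig_Hmat_sub [NeZero N] (s : ℝ) :
    Integrable (fun g => topEig (Hmat N g - s • diagPart (Hmat N g))) (gMeasure N) := by
  refine integrable_topEig (gMeasure_centeredGaussian N)
    (continuous_Hmat.sub ((continuous_diagPart.comp continuous_Hmat).const_smul s)) (a := 0)
    (b := (1 + |s|) * ((√(2 * N))⁻¹ * (2 * N ^ 2))) fun g => ?_
  rw [sub_eq_add_neg, zero_add]
  refine (absSum_add_le _ _).trans ?_
  rw [absSum_neg, absSum_smul, mul_assoc]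
  have h := absSum_Hmat_le g
  nlinarith [mul_le_mul_of_nonneg_left ((absSum_diagPart_le (Hmat N g)).trans h) (abs_nonneg s)]

lemma Hmat_symm (g : Fin N → Fin N → ℝ) (i j : Fin N) : Hmat N g i j = Hmat N g j i := by
  simp only [Hmat_eq, Matrix.smul_apply, Matrix.add_apply, of_apply, transpose_apply, add_comm]

lemma integral_trace_Hmat :
    Integrable (fun g => (Hmat N g).trace) (gMeasure N)
      ∧ ∫ g, (Hmat N g).trace ∂(gMeasure N) = 0 := by
  have h : ∀ i j : Fin N, Integrable (fun g => Hmat N g i j) (gMeasure N) := fun i j => by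
    simpa using integrable_Hmat_pow i j 1
  refine ⟨integrable_finsetSum _ fun i _ => h i i, ?_⟩
  refine (integral_finsetSum _ fun i _ => h i i).trans (Finset.sum_eq_zero fun i _ => ?_)
  simp only [Hmat_apply_eq]
  exact (gMeasure_centeredGaussian N).mean _

lemma integral_topEig_Hmat_sub_pair [NeZero N] (s : ℝ) (a b : Fin N) :
    Integrable (fun g => topEig (Hmat N g - s • (diagPart (Hmat N g) + pairTerm (Hmat N g) a b)))
        (gMeasure N)
      ∧ ∫ g, topEig (Hmat N g - s • (diagPart (Hmat N g) + pairTerm (Hmat N g) a b)) ∂(gMeasure N)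
        = ∫ g, topEig (Hmat N g - s • diagPart (Hmat N g)) ∂(gMeasure N) := by
  obtain ⟨Q, hQ, h⟩ := exists_conj_diagPart a b
  have hQ' : Q.transpose * Q = 1 := mul_eq_one_comm.1 hQ
  have hm := map_conjArr (Q := Q.transpose) (by rwa [transpose_transpose])
  have e : ∀ g, topEig (Hmat N g - s • (diagPart (Hmat N g) + pairTerm (Hmat N g) a b))
      = topEig (Hmat N (conjArr Q.transpose g)
        - s • diagPart (Hmat N (conjArr Q.transpose g))) := by
    intro g
    rw [← h _ (Hmat_symm g), Hmat_conjArr, transpose_transpose,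
      ← topEig_conj hQ' (Q.transpose * Hmat N g * Q - _)]
    congr 1
    rw [Matrix.mul_sub, Matrix.sub_mul, Matrix.mul_smul, Matrix.smul_mul,
      Matrix.mul_assoc Q.transpose,
      ← Matrix.mul_assoc Q, hQ, Matrix.one_mul, Matrix.mul_assoc (Hmat N g), hQ, Matrix.mul_one]
  simp only [e]
  have hi := integrable_topEig_Hmat_sub (N := N) s
  constructor
  · rw [← hm] at hi
    exact hi.comp_measurable (by fun_prop)
  · conv_rhs => rw [← hm]
    rw [← hm] at hi
    rw [integral_map (by fun_prop) hi.aestronglyMeasurable]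

lemma mul_integral_topEig_Hmat_sub_le [NeZero N] (hN : 2 ≤ N) {s s' : ℝ} (hs : s ≤ 1)
    (hs' : (N ^ 2 - 2 * s) * s' = s * (N ^ 2 - N - 2)) :
    (N ^ 2 - 2 * s) * ∫ g, topEig (Hmat N g - s' • diagPart (Hmat N g)) ∂(gMeasure N)
      ≤ N ^ 2 * ∫ g, topEig (Hmat N g - s • diagPart (Hmat N g)) ∂(gMeasure N) := by
  have hN2 : (2 : ℝ) ≤ N := by exact_mod_cast hN
  have hp := fun a b => integral_topEig_Hmat_sub_pair (N := N) s a b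
  have hi : Integrable (fun g => ∑ a, ∑ b,
      topEig (Hmat N g - s • (diagPart (Hmat N g) + pairTerm (Hmat N g) a b))) (gMeasure N) :=
    integrable_finsetSum _ fun a _ => integrable_finsetSum _ fun b _ => (hp a b).1
  have ht := integral_trace_Hmat (N := N)
  have hl : Integrable (fun g => (N ^ 2 - 2 * s) * topEig (Hmat N g - s' • diagPart (Hmat N g))
      + (-s) * (Hmat N g).trace) (gMeasure N) :=
    ((integrable_topEig_Hmat_sub s').const_mul _).add (ht.1.const_mul _)
  have key := integral_mono hl hi fun g => by
    have h1 := topEig_sum_le Finset.univ fun p : Fin N × Fin N =>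
      Hmat N g - s • (diagPart (Hmat N g) + pairTerm (Hmat N g) p.1 p.2)
    rw [← Finset.univ_product_univ, Finset.sum_product, Finset.sum_product] at h1
    refine le_trans (le_of_eq ?_) h1
    have e : ∑ a, ∑ b, (Hmat N g - s • (diagPart (Hmat N g) + pairTerm (Hmat N g) a b))
        = (N ^ 2 - 2 * s : ℝ) • (Hmat N g - s' • diagPart (Hmat N g))
          + (-s * (Hmat N g).trace) • 1 := by
      simp only [Finset.sum_sub_distrib, ← Finset.smul_sum, Finset.sum_add_distrib,
        sum_sum_pairTerm (Hmat_symm g), Finset.sum_const, Finset.card_univ, Fintype.card_fin]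
      simp only [← Nat.cast_smul_eq_nsmul ℝ]
      match_scalars <;> first | ring1 | linear_combination hs'
    rw [e, topEig_add_smul_one, topEig_smul (by nlinarith)]
  rw [integral_add ((integrable_topEig_Hmat_sub s').const_mul _) (ht.1.const_mul _),
    integral_const_mul, integral_const_mul, ht.2, mul_zero, add_zero,
    integral_finsetSum _ fun a _ => integrable_finsetSum _ fun b _ => (hp a b).1] at key
  refine key.trans (le_of_eq ?_)
  simp only [integral_finsetSum _ fun b _ => (hp _ b).1, (hp _ _).2, Finset.sum_const,
    Finset.card_univ, Fintype.card_fin, nsmul_eq_mul]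
  ring

/-- Removing the diagonal decreases the mean of the largest eigenvalue by a factor at most
`N / (N + 2)`. -/
lemma integral_topEig_Hmat_sub_diagPart [NeZero N] (hN : 2 ≤ N) :
    (N + 2) * (∫ g, topEig (Hmat N g) ∂(gMeasure N)
        - ∫ g, topEig (Hmat N g - diagPart (Hmat N g)) ∂(gMeasure N))
      ≤ 2 * ∫ g, topEig (Hmat N g) ∂(gMeasure N) := by
  have hN2 : (2 : ℝ) ≤ N := by exact_mod_cast hN
  let ψ : ℝ → ℝ := fun s => ∫ g, topEig (Hmat N g - s • diagPart (Hmat N g)) ∂(gMeasure N)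
  have hψ0 : ψ 0 = ∫ g, topEig (Hmat N g) ∂(gMeasure N) := by simp [ψ]
  have hψ1 : ψ 1 = ∫ g, topEig (Hmat N g - diagPart (Hmat N g)) ∂(gMeasure N) := by simp [ψ]
  rw [← hψ0, ← hψ1]
  have hid : Integrable (fun g => topEig (diagPart (Hmat N g))) (gMeasure N) := by
    refine integrable_topEig (gMeasure_centeredGaussian N)
      (continuous_diagPart.comp continuous_Hmat) (a := 0)
      (b := (√(2 * N))⁻¹ * (2 * N ^ 2)) fun g => ?_
    rw [zero_add]
    exact (absSum_diagPart_le _).trans (absSum_Hmat_le g)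
  have hc₀ : ∀ s, 0 ≤ s → ψ 0 - ψ s ≤ (∫ g, topEig (diagPart (Hmat N g)) ∂(gMeasure N)) * s := by
    intro s hs
    have h := integral_mono (integrable_topEig_Hmat_sub (N := N) 0)
      ((integrable_topEig_Hmat_sub s).add (hid.const_mul s)) fun g => by
        have h := topEig_add_le (Hmat N g - s • diagPart (Hmat N g)) (s • diagPart (Hmat N g))
        rw [sub_add_cancel, topEig_smul hs] at h
        simpa using h
    have h2 := integral_add (integrable_topEig_Hmat_sub (N := N) s) (hid.const_mul s)
    rw [integral_const_mul] at h2
    have h3 := h.trans (le_of_eq h2)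
    change ψ 0 ≤ ψ s + _ at h3
    linarith
  let S : Set ℝ := (fun s => (ψ 0 - ψ s) / s) '' Set.Ioc 0 1
  have hS1 : ψ 0 - ψ 1 ∈ S := ⟨1, by simp, by simp⟩
  have hlub : IsLUB S (sSup S) := isLUB_csSup ⟨_, hS1⟩
    ⟨_, by rintro _ ⟨s, hs, rfl⟩; exact (div_le_iff₀ hs.1).2 (hc₀ s hs.1.le)⟩
  set c := sSup S
  have hc : ∀ s, 0 ≤ s → s ≤ 1 → ψ 0 - ψ s ≤ c * s := by
    intro s h0 h1
    rcases h0.eq_or_lt with rfl | h0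
    · simp
    · exact (div_le_iff₀ h0).1 (hlub.1 ⟨s, ⟨h0, h1⟩, rfl⟩)
  have hle : c ≤ (c * (N ^ 2 - N - 2) + 2 * ψ 0) / N ^ 2 := by
    refine hlub.2 ?_
    rintro _ ⟨s, ⟨h0, h1⟩, rfl⟩
    have hd : (0 : ℝ) < N ^ 2 - 2 * s := by nlinarith
    have hk : (0 : ℝ) ≤ N ^ 2 - N - 2 := by nlinarith
    have hss : (N ^ 2 - 2 * s) * (s * (N ^ 2 - N - 2) / (N ^ 2 - 2 * s))
        = s * (N ^ 2 - N - 2) := mul_div_cancel₀ _ hd.ne'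
    set s' := s * (N ^ 2 - N - 2) / (N ^ 2 - 2 * s) with hs'
    have hm := mul_integral_topEig_Hmat_sub_le hN h1 hss
    change (N ^ 2 - 2 * s) * ψ s' ≤ N ^ 2 * ψ s at hm
    have h2 := hc s' (by positivity) (by rw [hs', div_le_one hd]; nlinarith)
    simp only
    rw [div_le_div_iff₀ h0 (by positivity)]
    have h3 := mul_le_mul_of_nonneg_left h2 hd.le
    rw [mul_left_comm, hss] at h3
    linarith
  rw [le_div_iff₀ (by positivity)] at hle
  have := hc 1 zero_le_one le_rfl
  nlinarith

end DiagonalAverage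

section Perturbation

open Matrix

variable {N : ℕ}

lemma antitone_evalsDesc {A : Matrix (Fin N) (Fin N) ℝ} (hA : A.IsHermitian) :
    Antitone (evalsDesc hA) := fun _ _ h =>
  neg_le_neg (Tuple.monotone_sort (fun j => - hA.eigenvalues j) h)

lemma exists_eq_conj_diagonal_evalsDesc {A : Matrix (Fin N) (Fin N) ℝ} (hA : A.IsHermitian) :
    ∃ Q : Matrix (Fin N) (Fin N) ℝ, Q.transpose * Q = 1 ∧
      A = Q * Matrix.diagonal (evalsDesc hA) * Q.transpose := by
  let σ := Tuple.sort fun j => - hA.eigenvalues j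
  let U : Matrix (Fin N) (Fin N) ℝ := hA.eigenvectorUnitary
  have hU : U.transpose * U = 1 := Unitary.coe_star_mul_self hA.eigenvectorUnitary
  have hs : A = U * Matrix.diagonal hA.eigenvalues * U.transpose := by
    conv_lhs => rw [hA.spectral_theorem]
    rw [Unitary.conjStarAlgAut_apply]
    rfl
  have hd : Matrix.diagonal (evalsDesc hA) = (Matrix.diagonal hA.eigenvalues).submatrix σ σ := by
    rw [Matrix.submatrix_diagonal_equiv]
    congr 1
    ext i
    simp [evalsDesc, σ]
  refine ⟨U.submatrix id σ, ?_, ?_⟩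
  · rw [transpose_submatrix, ← Matrix.submatrix_mul _ _ _ _ _ Function.bijective_id, hU,
      Matrix.submatrix_one_equiv]
  · rw [hd, transpose_submatrix, Matrix.submatrix_mul_equiv, Matrix.submatrix_mul_equiv,
      Matrix.submatrix_id_id, ← hs]

/-- The mean of the largest eigenvalue of `A` perturbed by `√τ` times a GOE matrix. -/
def meanTopEig (τ : ℝ) (A : Matrix (Fin N) (Fin N) ℝ) : ℝ :=
  ∫ g, topEig (A + √τ • Hmat N g) ∂(gMeasure N)

lemma meanTopEig_conj [NeZero N] (τ : ℝ) {Q : Matrix (Fin N) (Fin N) ℝ}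
    (hQ : Q.transpose * Q = 1) (A : Matrix (Fin N) (Fin N) ℝ) :
    meanTopEig τ (Q * A * Q.transpose) = meanTopEig τ A := by
  have hm := map_conjArr hQ
  have hi := integrable_topEig_add_smul_Hmat (Q * A * Q.transpose) √τ
  unfold meanTopEig
  rw [← hm] at hi ⊢
  rw [integral_map (by fun_prop) hi.aestronglyMeasurable, hm]
  refine integral_congr_ae (ae_of_all _ fun g => ?_)
  simp only
  rw [Hmat_conjArr, ← Matrix.smul_mul, ← Matrix.mul_smul, ← Matrix.add_mul, ← Matrix.mul_add,
    topEig_conj hQ]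

lemma topEig_eq_evalsDesc [NeZero N] {A : Matrix (Fin N) (Fin N) ℝ} (hA : A.IsHermitian) :
    topEig A = evalsDesc hA 0 := by
  obtain ⟨Q, hQ, h⟩ := exists_eq_conj_diagonal_evalsDesc hA
  conv_lhs => rw [h]
  rw [topEig_conj hQ, topEig_diagonal _ fun i => antitone_evalsDesc hA (Fin.zero_le i)]

lemma meanTopEig_eq_diagonal [NeZero N] (τ : ℝ) {A : Matrix (Fin N) (Fin N) ℝ}
    (hA : A.IsHermitian) :
    meanTopEig τ A = meanTopEig τ (Matrix.diagonal (evalsDesc hA)) := by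
  obtain ⟨Q, hQ, h⟩ := exists_eq_conj_diagonal_evalsDesc hA
  conv_lhs => rw [h]
  rw [meanTopEig_conj τ hQ]

/-- Comparison of the perturbation of the largest eigenvalue at two scales bounds the first gap
from below. -/
lemma le_meanTopEig_diagonal_comparison [NeZero N] (Λ : Fin N → ℝ) (hΛ : ∀ k, Λ k ≤ Λ 0)
    {i₁ : Fin N} (hi₁ : i₁ ≠ 0) {η δ τ τ' r : ℝ} (hη : 0 < η) (hη1 : η ≤ 1) (hδ : 1 / N ≤ δ)
    (hτ : τ = η ^ 2 / 12) (hτ' : 0 < τ') (hr : r = η ^ 2 / (2 * N * δ ^ 2)) (hr1 : r ≤ 1) :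
    (1 - r) / (Λ 0 - Λ i₁ + δ) ≤ N / τ * (meanTopEig τ (Matrix.diagonal Λ) - Λ 0)
      - (1 - r) * (N / τ' * (meanTopEig τ' (Matrix.diagonal Λ) - Λ 0 - η) - 2 / η) := by
  have hN : (0 : ℝ) < N := Nat.cast_pos.2 (NeZero.pos N)
  have hδ0 : 0 < δ := lt_of_lt_of_le (by positivity) hδ
  have hτ0 : 0 < τ := by rw [hτ]; positivity
  have hd : ∀ k, 0 ≤ Λ 0 - Λ k := fun k => sub_nonneg.2 (hΛ k)
  let e : Fin N → ℝ := fun k => if k = i₁ then δ else η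
  have he : ∀ k, 0 < e k := fun k => by simp only [e]; split_ifs <;> assumption
  let a : Fin N → ℝ := fun k => if k = 0 then 0 else 1 / (Λ 0 - Λ k + e k)
  have ha0 : a 0 = 0 := by simp [a]
  have ha : ∀ k, 0 ≤ a k := fun k => by
    simp only [a]
    split_ifs
    · exact le_rfl
    · exact div_nonneg zero_le_one (add_nonneg (hd k) (he k).le)
  have hw : ∀ k, 2 * a k - (Λ 0 - Λ k) * a k ^ 2 = a k + e k * a k ^ 2 := fun k => by
    by_cases hk : k = 0
    · simp [hk, ha0]
    · have h : a k * (Λ 0 - Λ k + e k) = 1 := by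
        simp only [a, hk, if_false]
        exact one_div_mul_cancel (add_pos_of_nonneg_of_pos (hd k) (he k)).ne'
      linear_combination (-a k) * h
  set S := ∑ k, a k with hS
  have hS0 : 0 ≤ S := Finset.sum_nonneg fun k _ => ha k
  have hw0 : ∀ k, 0 ≤ 2 * a k - (Λ 0 - Λ k) * a k ^ 2 := fun k => by
    rw [hw]
    have := ha k
    have := he k
    positivity
  have hi₁e : e i₁ = δ := by simp [e]
  have hae : ∀ k, a k * e k ≤ 1 := fun k => by
    simp only [a]
    split_ifs
    · simp
    · rw [div_mul_eq_mul_div, one_mul]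
      exact div_le_one_of_le₀ (by linarith [hd k]) (add_nonneg (hd k) (he k).le)
  have haη : ∀ k, k ≠ i₁ → a k ≤ 1 / η := fun k hk => by
    have h := hae k
    simp only [e, hk, if_false] at h
    exact (le_div_iff₀ hη).2 h
  have haδ : a i₁ ≤ 1 / δ := (le_div_iff₀ hδ0).2 (hi₁e ▸ hae i₁)
  have hSN : S ≤ N + N / η := by
    have h1 : S ≤ ∑ k : Fin N, (1 / η + if k = i₁ then 1 / δ else 0) :=
      Finset.sum_le_sum fun k _ => by
        split_ifs with h
        · subst h
          have : 0 ≤ 1 / η := by positivity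
          linarith
        · linarith [haη k h]
    rw [Finset.sum_add_distrib, Finset.sum_ite_eq' Finset.univ] at h1
    simp only [Finset.sum_const, Finset.card_univ, Fintype.card_fin, nsmul_eq_mul,
      Finset.mem_univ, if_true] at h1
    have h2 : 1 / δ ≤ N := (one_div_le hN hδ0).1 hδ
    have h3 : (N : ℝ) * (1 / η) = N / η := by ring
    linarith
  have hτS : 6 * τ / N * S ≤ η := by
    calc 6 * τ / N * S ≤ 6 * τ / N * (N + N / η) := mul_le_mul_of_nonneg_left hSN (by positivity)
      _ = η ^ 2 / 2 + η / 2 := by rw [hτ]; field_simp; ring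
      _ ≤ η := by nlinarith
  have hlow := le_integral_topEig_diagonal_add Λ a ha0 hw0 hτ0.le
  have hS2 : 0 ≤ ∑ k, a k ^ 2 := Finset.sum_nonneg fun k _ => sq_nonneg _
  have hW : ∑ k, (2 * a k - (Λ 0 - Λ k) * a k ^ 2) ≤ 2 * S := by
    rw [hS, Finset.mul_sum]
    exact Finset.sum_le_sum fun k _ => by nlinarith [mul_nonneg (hd k) (sq_nonneg (a k))]
  have hquad : ∑ k, a k ^ 2 * (e k - 6 * τ / N * S) ≥ - r * S := by
    have h1 : ∀ k : Fin N, (if k = i₁ then - r * S else 0) ≤ a k ^ 2 * (e k - 6 * τ / N * S) := by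
      intro k
      split_ifs with hk
      · subst hk
        have h2 : a k ^ 2 ≤ (1 / δ) ^ 2 := pow_le_pow_left₀ (ha k) haδ 2
        have h3 : r * S = (1 / δ) ^ 2 * (6 * τ / N * S) := by
          rw [hr, hτ]; field_simp; ring
        have h4 : 0 ≤ 6 * τ / N * S := by positivity
        nlinarith [mul_le_mul_of_nonneg_right h2 h4, mul_nonneg (sq_nonneg (a k)) (he k).le]
      · have : e k = η := by simp [e, hk]
        rw [this]
        exact mul_nonneg (sq_nonneg _) (by linarith)
    have h5 := Finset.sum_le_sum fun k (_ : k ∈ Finset.univ) => h1 k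
    simpa using h5
  have hU : (1 - r) * S ≤ N / τ * (meanTopEig τ (Matrix.diagonal Λ) - Λ 0) := by
    have h1 : (1 - r) * S ≤ (∑ k, (2 * a k - (Λ 0 - Λ k) * a k ^ 2))
        * (1 - 3 * τ / N * ∑ k, a k ^ 2) := by
      have h2 : (3 * τ / N * ∑ k, a k ^ 2) * ∑ k, (2 * a k - (Λ 0 - Λ k) * a k ^ 2)
          ≤ (3 * τ / N * ∑ k, a k ^ 2) * (2 * S) :=
        mul_le_mul_of_nonneg_left hW (by positivity)
      have h3 : ∑ k, (2 * a k - (Λ 0 - Λ k) * a k ^ 2) = S + ∑ k, e k * a k ^ 2 := by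
        simp only [hw, Finset.sum_add_distrib, hS]
      have h4 : ∑ k, a k ^ 2 * (e k - 6 * τ / N * S)
          = ∑ k, e k * a k ^ 2 - 6 * τ / N * S * ∑ k, a k ^ 2 := by
        have h (c : ℝ) : ∑ k, a k ^ 2 * (e k - c) = ∑ k, e k * a k ^ 2 - c * ∑ k, a k ^ 2 := by
          rw [Finset.mul_sum, ← Finset.sum_sub_distrib]
          exact Finset.sum_congr rfl fun k _ => by ring
        exact h _
      have h5 : (3 * τ / N * ∑ k, a k ^ 2) * (2 * S) = 6 * τ / N * S * ∑ k, a k ^ 2 := by ring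
      linarith
    have h6 := mul_le_mul_of_nonneg_left h1 (div_nonneg hτ0.le hN.le)
    rw [← mul_assoc] at h6
    rw [div_mul_eq_mul_div, le_div_iff₀ hτ0]
    have h7 : τ / N * ((1 - r) * S) ≤ meanTopEig τ (Matrix.diagonal Λ) - Λ 0 := by
      unfold meanTopEig
      linarith
    rw [div_mul_eq_mul_div, div_le_iff₀ hN] at h7
    linarith
  have hV : N / τ' * (meanTopEig τ' (Matrix.diagonal Λ) - Λ 0 - η) - 2 / η
      ≤ S - 1 / (Λ 0 - Λ i₁ + δ) := by
    have h1 := integral_topEig_diagonal_add_le Λ (x := Λ 0 + η)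
      (fun k => by linarith [hΛ k]) hτ'.le
    have h2 : ∑ k, 1 / (Λ 0 + η - Λ k) ≤ 2 / η + (S - 1 / (Λ 0 - Λ i₁ + δ)) := by
      have h3 : ∀ k, 1 / (Λ 0 + η - Λ k) ≤ a k + ((if k = 0 then 1 / η else 0)
          + if k = i₁ then (1 / η - 1 / (Λ 0 - Λ i₁ + δ)) else 0) := by
        intro k
        have h4 : 1 / (Λ 0 + η - Λ k) ≤ 1 / η := one_div_le_one_div_of_le hη (by linarith [hd k])
        by_cases hk : k = 0
        · subst hk
          simp [ha0, Ne.symm hi₁]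
        · by_cases hk1 : k = i₁
          · subst hk1
            simp only [a, e, hk, if_false, if_true]
            linarith
          · simp only [a, e, hk, hk1, if_false, add_zero]
            exact le_of_eq (by ring)
      have h5 := Finset.sum_le_sum fun k (_ : k ∈ Finset.univ) => h3 k
      simp only [Finset.sum_add_distrib, Finset.sum_ite_eq', Finset.mem_univ, if_true] at h5
      have h6 : 2 / η = 1 / η + 1 / η := by ring
      linarith
    have h7 : meanTopEig τ' (Matrix.diagonal Λ) - Λ 0 - η
        ≤ τ' / N * ∑ k, 1 / (Λ 0 + η - Λ k) := by
      unfold meanTopEig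
      linarith
    have h8 := mul_le_mul_of_nonneg_left h7 (by positivity : (0 : ℝ) ≤ N / τ')
    have h9 : N / τ' * (τ' / N * ∑ k, 1 / (Λ 0 + η - Λ k)) = ∑ k, 1 / (Λ 0 + η - Λ k) := by
      field_simp
    linarith
  have h := mul_le_mul_of_nonneg_left hV (sub_nonneg.2 hr1)
  have e1 : (1 - r) / (Λ 0 - Λ i₁ + δ) = (1 - r) * (1 / (Λ 0 - Λ i₁ + δ)) := by ring
  rw [e1]
  linarith

end Perturbation

section EntryMean

variable {N : ℕ}

lemma integrable_topEig_Hmat_comp [NeZero N] {E : Type*} [NormedAddCommGroup E] [NormedSpace ℝ E]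
    [MeasurableSpace E] [BorelSpace E] [CompleteSpace E] [SecondCountableTopology E]
    {μ : Measure E} (h : CenteredGaussian μ) (T : E →L[ℝ] (Fin N → Fin N → ℝ)) :
    Integrable (fun x => topEig (Hmat N (T x))) μ := by
  refine integrable_topEig h (continuous_Hmat.comp T.continuous) (a := 0)
    (b := (√(2 * N))⁻¹ * (2 * N ^ 2) * ‖T‖) fun x => (absSum_Hmat_le (T x)).trans ?_
  rw [zero_add, mul_assoc _ ‖T‖]
  exact mul_le_mul_of_nonneg_left (T.le_opNorm x) (by positivity)

/-- The mean largest eigenvalue of the GOE matrix whose Gaussian coefficients are multiplied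
entrywise by `γ`. -/
def entryMean (γ : Fin N → Fin N → ℝ) : ℝ :=
  ∫ g, topEig (Hmat N (entryMul γ g)) ∂(gMeasure N)

lemma integrable_topEig_entryMul [NeZero N] (γ : Fin N → Fin N → ℝ) :
    Integrable (fun g => topEig (Hmat N (entryMul γ g))) (gMeasure N) :=
  integrable_topEig_Hmat_comp (gMeasure_centeredGaussian N) _

lemma continuous_topEig_Hmat [NeZero N] : Continuous fun g => topEig (Hmat N g) :=
  continuous_topEig.comp continuous_Hmat

lemma entryMean_eq_integral_map [NeZero N] (γ : Fin N → Fin N → ℝ) :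
    entryMean γ = ∫ g, topEig (Hmat N g) ∂((gMeasure N).map (entryMul γ)) :=
  (integral_map (by fun_prop) continuous_topEig_Hmat.aestronglyMeasurable).symm

lemma entryMean_congr [NeZero N] {γ γ' : Fin N → Fin N → ℝ}
    (h : ∀ i j, γ i j ^ 2 = γ' i j ^ 2) : entryMean γ = entryMean γ' := by
  rw [entryMean_eq_integral_map, entryMean_eq_integral_map, map_entryMul_congr h]

lemma entryMean_add_le [NeZero N] (γ γ' : Fin N → Fin N → ℝ) :
    entryMean (γ + γ') ≤ entryMean γ + entryMean γ' := by
  unfold entryMean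
  rw [← integral_add (integrable_topEig_entryMul γ) (integrable_topEig_entryMul γ')]
  refine integral_mono (integrable_topEig_entryMul _)
    ((integrable_topEig_entryMul γ).add (integrable_topEig_entryMul γ')) fun g => ?_
  have h : entryMul (γ + γ') g = entryMul γ g + entryMul γ' g := by
    ext i j; simp [entryMul_apply, add_mul]
  simp only [h, Hmat_add]
  exact topEig_add_le _ _

lemma entryMean_smul [NeZero N] {c : ℝ} (hc : 0 ≤ c) (γ : Fin N → Fin N → ℝ) :
    entryMean (c • γ) = c * entryMean γ := by
  unfold entryMean
  rw [← integral_const_mul]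
  refine integral_congr_ae (ae_of_all _ fun g => ?_)
  have h : entryMul (c • γ) g = c • entryMul γ g := by
    ext i j; simp [entryMul_apply, mul_assoc]
  simp only [h, Hmat_smul]
  exact topEig_smul hc _

lemma entryMean_le_of_two_smul_eq_add [NeZero N] {γ₀ γ γ' : Fin N → Fin N → ℝ}
    (h : ∀ i j, γ' i j ^ 2 = γ i j ^ 2) (h₀ : (2 : ℝ) • γ₀ = γ + γ') :
    entryMean γ₀ ≤ entryMean γ := by
  have h1 := entryMean_add_le γ γ'
  rw [← h₀, entryMean_smul zero_le_two, entryMean_congr h] at h1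
  linarith

lemma entryMean_nonneg [NeZero N] (γ : Fin N → Fin N → ℝ) : 0 ≤ entryMean γ := by
  have h0 : entryMean (0 : Fin N → Fin N → ℝ) = 0 := by
    simpa using entryMean_smul (N := N) le_rfl 0
  rw [← h0]
  exact entryMean_le_of_two_smul_eq_add (γ' := -γ) (fun i j => by simp) (by simp)

/-- The array equal to `a` on the diagonal and to `b` off the diagonal. -/
def diagOff (a b : ℝ) (i j : Fin N) : ℝ := if i = j then a else b

lemma smul_diagOff (c a b : ℝ) :
    c • (diagOff a b : Fin N → Fin N → ℝ) = diagOff (c * a) (c * b) := by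
  ext i j; simp [diagOff]

lemma diagOff_add (a b a' b' : ℝ) :
    (diagOff a b + diagOff a' b' : Fin N → Fin N → ℝ) = diagOff (a + a') (b + b') := by
  ext i j; simp only [diagOff, Pi.add_apply]; split_ifs <;> rfl

lemma entryMean_diagOff_zero_le [NeZero N] (a b : ℝ) :
    entryMean (diagOff 0 b : Fin N → Fin N → ℝ) ≤ entryMean (diagOff a b : Fin N → Fin N → ℝ) :=
  entryMean_le_of_two_smul_eq_add (γ' := diagOff (-a) b)
    (fun i j => by simp only [diagOff]; split_ifs <;> ring)
    (by rw [smul_diagOff, diagOff_add]; congr 1 <;> ring)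

lemma entryMean_diagOff_le [NeZero N] {a b : ℝ} (ha : 0 ≤ a) (hab : a ≤ b) :
    entryMean (diagOff a b : Fin N → Fin N → ℝ)
      ≤ a * entryMean (diagOff 1 1 : Fin N → Fin N → ℝ)
        + (b - a) * entryMean (diagOff 0 1 : Fin N → Fin N → ℝ) := by
  have h := entryMean_add_le (a • (diagOff 1 1 : Fin N → Fin N → ℝ)) ((b - a) • diagOff 0 1)
  rw [entryMean_smul ha, entryMean_smul (sub_nonneg.2 hab), smul_diagOff, smul_diagOff,
    diagOff_add] at h
  convert h using 3 <;> ring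

lemma entryMul_diagOff_one (g : Fin N → Fin N → ℝ) : entryMul (diagOff 1 1) g = g := by
  ext i j; simp [entryMul_apply, diagOff]

lemma entryMean_diagOff_one_le [NeZero N] :
    entryMean (diagOff 1 1 : Fin N → Fin N → ℝ) ≤ 2 := by
  have hN : (N : ℝ) ≠ 0 := NeZero.ne _
  have h := integral_topEig_diagonal_add_le (N := N) 0 (x := 1) (fun _ => one_pos) zero_le_one
  simp only [entryMean, entryMul_diagOff_one]
  have h0 : Matrix.diagonal (0 : Fin N → ℝ) = 0 := Matrix.diagonal_zero
  simp only [h0, Real.sqrt_one, one_smul, zero_add, Pi.zero_apply, sub_zero, div_one,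
    Finset.sum_const, Finset.card_univ, Fintype.card_fin, nsmul_eq_mul, mul_one,
    one_div_mul_cancel hN] at h
  linarith

lemma entryMean_diagOff_sub_le [NeZero N] (hN : 2 ≤ N) :
    entryMean (diagOff 1 1 : Fin N → Fin N → ℝ) - entryMean (diagOff 0 1 : Fin N → Fin N → ℝ)
      ≤ 4 / N := by
  have hN0 : (0 : ℝ) < N := Nat.cast_pos.2 (NeZero.pos N)
  have h := integral_topEig_Hmat_sub_diagPart (N := N) hN
  have h1 : ∫ g, topEig (Hmat N g) ∂(gMeasure N) = entryMean (N := N) (diagOff 1 1) := by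
    simp only [entryMean, entryMul_diagOff_one]
  have h0 : ∫ g, topEig (Hmat N g - diagPart (Hmat N g)) ∂(gMeasure N)
      = entryMean (N := N) (diagOff 0 1) := by
    refine integral_congr_ae (ae_of_all _ fun g => ?_)
    simp only
    congr 1
    ext i j
    by_cases hij : i = j
    · subst hij; simp [Hmat, diagPart, entryMul_apply, diagOff]
    · simp [Hmat, diagPart, entryMul_apply, diagOff, hij, Ne.symm hij]
  rw [h1, h0] at h
  rw [le_div_iff₀ hN0]
  have h2 := entryMean_diagOff_one_le (N := N)
  have h3 := entryMean_diagOff_zero_le (N := N) 1 1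
  nlinarith

lemma meanTopEig_Hmat_entryMul {τ : ℝ} (γ g : Fin N → Fin N → ℝ) :
    meanTopEig τ (Hmat N (entryMul γ g))
      = ∫ g', topEig (Hmat N (entryMul γ g + entryMul (fun _ _ => √τ) g')) ∂(gMeasure N) := by
  unfold meanTopEig
  refine integral_congr_ae (ae_of_all _ fun g' => ?_)
  have h : entryMul (fun _ _ => √τ) g' = √τ • g' := by
    ext i j; simp [entryMul_apply]
  simp only [h, Hmat_add, Hmat_smul]

lemma integrable_topEig_entryMul_add [NeZero N] (α β : Fin N → Fin N → ℝ) :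
    Integrable (fun p : (Fin N → Fin N → ℝ) × (Fin N → Fin N → ℝ) =>
      topEig (Hmat N (entryMul α p.1 + entryMul β p.2))) ((gMeasure N).prod (gMeasure N)) := by
  let T : (Fin N → Fin N → ℝ) × (Fin N → Fin N → ℝ) →L[ℝ] (Fin N → Fin N → ℝ) :=
    (entryMul α).comp (.fst ℝ _ _) + (entryMul β).comp (.snd ℝ _ _)
  have hT : ∀ p, T p = entryMul α p.1 + entryMul β p.2 := fun p => by simp [T]
  have h := integrable_topEig_Hmat_comp
    ((gMeasure_centeredGaussian N).prod (gMeasure_centeredGaussian N)) T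
  simpa only [hT] using h

lemma integrable_meanTopEig [NeZero N] (τ : ℝ) (γ : Fin N → Fin N → ℝ) :
    Integrable (fun g => meanTopEig τ (Hmat N (entryMul γ g))) (gMeasure N) := by
  simp only [meanTopEig_Hmat_entryMul]
  exact (integrable_topEig_entryMul_add γ fun _ _ => √τ).integral_prod_left

lemma integral_meanTopEig [NeZero N] {τ : ℝ} (hτ : 0 ≤ τ) {γ γ' : Fin N → Fin N → ℝ}
    (h : ∀ i j, γ i j ^ 2 + τ = γ' i j ^ 2) :
    ∫ g, meanTopEig τ (Hmat N (entryMul γ g)) ∂(gMeasure N) = entryMean γ' := by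
  simp only [meanTopEig_Hmat_entryMul]
  rw [← integral_prod _ (integrable_topEig_entryMul_add γ fun _ _ => √τ),
    entryMean_eq_integral_map,
    ← map_entryMul_add (α := γ) (β := fun _ _ => √τ) fun i j => by rw [Real.sq_sqrt hτ, h],
    integral_map (by fun_prop) continuous_topEig_Hmat.aestronglyMeasurable]

end EntryMean

section GapTail

variable {N : ℕ}

lemma le_sqrt_one_add {x : ℝ} (h0 : 0 ≤ x) (h1 : x ≤ 1) :
    1 + x / 2 - x ^ 2 / 8 ≤ √(1 + x) := by
  refine Real.le_sqrt_of_sq_le ?_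
  nlinarith [pow_nonneg h0 3, mul_nonneg (pow_nonneg h0 3) (sub_nonneg.2 h1)]

lemma comparison_mean_le {N a L r η τ τ' K K' : ℝ} (ha : 1 ≤ a) (hN : N = a ^ 3) (hL0 : 0 ≤ L)
    (hL : L ≤ 2) (hr0 : 0 ≤ r) (hr1 : r ≤ 1 / 2) (hrN : r * N ≤ a ^ 2 / 2) (hη : η = 1 / a ^ 2)
    (hτ : τ = η ^ 2 / 12) (hτ' : τ' = 1 / a) (hK : K ≤ √(1 + τ) * L + 4 * √τ / N)
    (hK' : √(1 + τ') * L ≤ K') :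
    N / τ * (K - L) - (1 - r) * (N / τ' * (K' - L - η) - 2 / η) ≤ 18 * a ^ 2 := by
  have ha0 : 0 < a := by linarith
  have hη0 : 0 < η := by rw [hη]; positivity
  have hτ0 : 0 < τ := by rw [hτ]; positivity
  have hτ'0 : 0 < τ' := by rw [hτ']; positivity
  have hτ'1 : τ' ≤ 1 := by rw [hτ', div_le_one ha0]; exact ha
  have hN0 : (0 : ℝ) < N := by rw [hN]; positivity
  have h1 : N / τ * (K - L)
      ≤ N * L / 2 + 14 * a ^ 2 := by
    have hsq : √(1 + τ) ≤ 1 + τ / 2 := by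
      rw [Real.sqrt_le_left (by positivity)]
      nlinarith
    have ht : √τ ^ 2 = τ := Real.sq_sqrt hτ0.le
    have ht0 : 0 < √τ := Real.sqrt_pos.2 hτ0
    have ht2 : 2 / 7 * η ≤ √τ := by
      refine Real.le_sqrt_of_sq_le ?_
      rw [hτ]; nlinarith
    have h2 : K - L
        ≤ τ / 2 * L + 4 * √τ / N := by
      have := hK
      nlinarith [mul_le_mul_of_nonneg_right hsq hL0]
    have h3 := mul_le_mul_of_nonneg_left h2 (div_nonneg hN0.le hτ0.le)
    have h4 : N / τ * (τ / 2 * L + 4 * √τ / N) = N * L / 2 + 4 / √τ := by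
      rw [← ht]
      simp only [Real.sqrt_sq ht0.le]
      field_simp
    have h5 : 4 / √τ ≤ 14 * a ^ 2 := by
      rw [div_le_iff₀ ht0]
      have h6 : a ^ 2 * η = 1 := by rw [hη]; field_simp
      nlinarith [mul_le_mul_of_nonneg_left ht2 (sq_nonneg a)]
    linarith
  have h2 : N * L / 2 - 13 / 4 * a ^ 2
      ≤ N / τ' * (K' - L - η) - 2 / η := by
    have h3 : (τ' / 2 - τ' ^ 2 / 8) * L - η
        ≤ K' - L - η := by
      have := hK'
      nlinarith [mul_le_mul_of_nonneg_right (le_sqrt_one_add hτ'0.le hτ'1) hL0]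
    have h4 := mul_le_mul_of_nonneg_left h3 (div_nonneg hN0.le hτ'0.le)
    have h5 : N / τ' * ((τ' / 2 - τ' ^ 2 / 8) * L - η) = N * L / 2 - a ^ 2 * L / 8 - a ^ 2 := by
      rw [hτ', hη, hN]; field_simp
    have h6 : 2 / η = 2 * a ^ 2 := by rw [hη]; field_simp
    nlinarith [mul_le_mul_of_nonneg_left hL (sq_nonneg a)]
  have h3 := mul_le_mul_of_nonneg_left h2 (by linarith : 0 ≤ 1 - r)
  have h4 : r * N * L ≤ r * N * 2 := mul_le_mul_of_nonneg_left hL (by positivity)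
  nlinarith [mul_nonneg hr0 (sq_nonneg a)]

/-- Tail bound for the first gap of a Gaussian matrix whose mean largest eigenvalue behaves like
a square root under Gaussian perturbations. -/
lemma measureReal_gap_lt_le [NeZero N] {γ : Fin N → Fin N → ℝ}
    {B : (Fin N → Fin N → ℝ) → Matrix (Fin N) (Fin N) ℝ} (hB : ∀ g, (B g).IsHermitian)
    (hBγ : ∀ g, B g = Hmat N (entryMul γ g)) {i₁ : Fin N} (hi₁ : i₁ ≠ 0)
    (hL : entryMean γ ≤ 2)
    (hlow : ∀ τ, 0 ≤ τ → √(1 + τ) * entryMean γ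
      ≤ ∫ g, meanTopEig τ (Hmat N (entryMul γ g)) ∂(gMeasure N))
    (hupp : ∀ τ, 0 ≤ τ → ∫ g, meanTopEig τ (Hmat N (entryMul γ g)) ∂(gMeasure N)
      ≤ √(1 + τ) * entryMean γ + 4 * √τ / N)
    {a s : ℝ} (ha : 1 ≤ a) (haN : a ^ 3 = N) (hs : 1 / a ≤ s) :
    (gMeasure N).real {g | a ^ 2 * (evalsDesc (hB g) 0 - evalsDesc (hB g) i₁) < s} ≤ 72 * s := by
  have ha0 : 0 < a := by linarith
  have hs0 : 0 < s := lt_of_lt_of_le (by positivity) hs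
  have has : 1 ≤ s * a := (div_le_iff₀ ha0).1 hs
  set L := entryMean γ with hLdef
  have hL0 : 0 ≤ L := entryMean_nonneg γ
  obtain ⟨η, hη⟩ : ∃ η, η = 1 / a ^ 2 := ⟨_, rfl⟩
  obtain ⟨τ, hτ⟩ : ∃ τ, τ = η ^ 2 / 12 := ⟨_, rfl⟩
  obtain ⟨τ', hτ'⟩ : ∃ τ', τ' = 1 / a := ⟨_, rfl⟩
  obtain ⟨δ, hδ⟩ : ∃ δ, δ = s / a ^ 2 := ⟨_, rfl⟩
  obtain ⟨r, hr⟩ : ∃ r, r = η ^ 2 / (2 * N * δ ^ 2) := ⟨_, rfl⟩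
  have hη0 : 0 < η := by rw [hη]; positivity
  have hη1 : η ≤ 1 := by rw [hη, div_le_one (by positivity)]; exact one_le_pow₀ ha
  have hτ0 : 0 < τ := by rw [hτ]; positivity
  have hτ'0 : 0 < τ' := by rw [hτ']; positivity
  have hδ0 : 0 < δ := by rw [hδ]; positivity
  have hδN : 1 / (N : ℝ) ≤ δ := by
    rw [hδ, ← haN, div_le_div_iff₀ (by positivity) (by positivity)]
    nlinarith [pow_pos ha0 2]
  have hrN : r * N = 1 / (2 * s ^ 2) := by
    rw [hr, hη, hδ, ← haN]; field_simp
  have hrN' : r * N ≤ a ^ 2 / 2 := by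
    rw [hrN, div_le_div_iff₀ (by positivity) (by positivity)]
    nlinarith
  have hr0 : 0 ≤ r := by rw [hr]; positivity
  have hr1 : r ≤ 1 / 2 := by
    have h : r * N ≤ 1 / 2 * N := by
      rw [← haN] at hrN' ⊢
      nlinarith [pow_pos ha0 2]
    exact le_of_mul_le_mul_right h (by rw [← haN]; positivity)
  let Ψ : (Fin N → Fin N → ℝ) → ℝ := fun g =>
    N / τ * (meanTopEig τ (Hmat N (entryMul γ g)) - topEig (Hmat N (entryMul γ g)))
      - (1 - r) * (N / τ' * (meanTopEig τ' (Hmat N (entryMul γ g))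
        - topEig (Hmat N (entryMul γ g)) - η) - 2 / η)
  have hΨ : ∀ g, (1 - r) / (evalsDesc (hB g) 0 - evalsDesc (hB g) i₁ + δ) ≤ Ψ g := fun g => by
    have h := le_meanTopEig_diagonal_comparison (evalsDesc (hB g))
      (fun k => antitone_evalsDesc (hB g) (Fin.zero_le k)) hi₁ hη0 hη1 hδN hτ hτ'0 hr
      (by linarith)
    rw [← meanTopEig_eq_diagonal, ← meanTopEig_eq_diagonal] at h
    simp only [Ψ, ← hBγ g]
    rw [topEig_eq_evalsDesc (hB g)]
    exact h
  have hgap : ∀ g, 0 ≤ evalsDesc (hB g) 0 - evalsDesc (hB g) i₁ := fun g =>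
    sub_nonneg.2 (antitone_evalsDesc (hB g) (Fin.zero_le i₁))
  have hΨ0 : ∀ g, 0 ≤ Ψ g := fun g =>
    (div_nonneg (by linarith) (add_nonneg (hgap g) hδ0.le)).trans (hΨ g)
  have hi := integrable_topEig_entryMul γ
  have hiτ := integrable_meanTopEig τ γ
  have hiτ' := integrable_meanTopEig τ' γ
  have hi₁ : Integrable (fun g => N / τ * (meanTopEig τ (Hmat N (entryMul γ g))
      - topEig (Hmat N (entryMul γ g)))) (gMeasure N) := (hiτ.sub hi).const_mul _
  have hi₂ : Integrable (fun g => meanTopEig τ' (Hmat N (entryMul γ g))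
      - topEig (Hmat N (entryMul γ g))) (gMeasure N) := hiτ'.sub hi
  have hi₃ : Integrable (fun g => meanTopEig τ' (Hmat N (entryMul γ g))
      - topEig (Hmat N (entryMul γ g)) - η) (gMeasure N) := hi₂.sub (integrable_const _)
  have hi₄ : Integrable (fun g => N / τ' * (meanTopEig τ' (Hmat N (entryMul γ g))
      - topEig (Hmat N (entryMul γ g)) - η) - 2 / η) (gMeasure N) :=
    (hi₃.const_mul _).sub (integrable_const _)
  have hΨi : Integrable Ψ (gMeasure N) := hi₁.sub (hi₄.const_mul _)
  have hΨE : ∫ g, Ψ g ∂(gMeasure N) ≤ 18 * a ^ 2 := by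
    have e : ∫ g, Ψ g ∂(gMeasure N)
        = N / τ * (∫ g, meanTopEig τ (Hmat N (entryMul γ g)) ∂(gMeasure N) - L)
          - (1 - r) * (N / τ' * (∫ g, meanTopEig τ' (Hmat N (entryMul γ g)) ∂(gMeasure N) - L - η)
            - 2 / η) := by
      simp only [Ψ]
      rw [integral_sub hi₁ (hi₄.const_mul _), integral_const_mul, integral_const_mul,
        integral_sub (hi₃.const_mul _) (integrable_const _), integral_const_mul,
        integral_sub hi₂ (integrable_const _), integral_sub hiτ' hi, integral_sub hiτ hi]
      simp only [integral_const, probReal_univ, one_smul]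
      rfl
    rw [e]
    exact comparison_mean_le ha haN.symm hL0 hL hr0 hr1 hrN' hη hτ hτ' (hupp τ hτ0.le)
      (hlow τ' hτ'0.le)
  have hmarkov := mul_meas_ge_le_integral_of_nonneg (ae_of_all _ hΨ0) hΨi (1 / (4 * δ))
  have hsub : {g | a ^ 2 * (evalsDesc (hB g) 0 - evalsDesc (hB g) i₁) < s}
      ⊆ {g | 1 / (4 * δ) ≤ Ψ g} := by
    intro g hg
    have h1 : evalsDesc (hB g) 0 - evalsDesc (hB g) i₁ < δ := by
      rw [hδ, lt_div_iff₀ (by positivity), mul_comm]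
      exact hg
    refine le_trans ?_ (hΨ g)
    have := hgap g
    rw [div_le_div_iff₀ (by positivity) (by linarith)]
    nlinarith
  have h1 := measureReal_mono (μ := gMeasure N) hsub
  have h2 : (1 / (4 * δ)) * (gMeasure N).real {g | 1 / (4 * δ) ≤ Ψ g} ≤ 18 * a ^ 2 :=
    hmarkov.trans hΨE
  rw [one_div_mul_eq_div, div_le_iff₀ (by positivity)] at h2
  have h3 : 18 * a ^ 2 * (4 * δ) = 72 * s := by rw [hδ]; field_simp; norm_num
  linarith

lemma measureReal_gap_Hmat_lt_le [NeZero N] {i₁ : Fin N} (hi₁ : i₁ ≠ 0)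
    {a s : ℝ} (ha : 1 ≤ a) (haN : a ^ 3 = N) (hs : 1 / a ≤ s) :
    (gMeasure N).real {g | a ^ 2 * (evalsH N g 0 - evalsH N g i₁) < s} ≤ 72 * s := by
  have hE (τ : ℝ) (hτ : 0 ≤ τ) :
      ∫ g, meanTopEig τ (Hmat N (entryMul (diagOff 1 1) g)) ∂(gMeasure N)
        = √(1 + τ) * entryMean (diagOff 1 1 : Fin N → Fin N → ℝ) := by
    rw [← entryMean_smul (Real.sqrt_nonneg _), smul_diagOff]
    refine integral_meanTopEig hτ fun i j => ?_
    simp [diagOff, Real.sq_sqrt (by linarith : 0 ≤ 1 + τ)]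
  refine measureReal_gap_lt_le (Hmat_isHermitian N)
    (fun g => by rw [entryMul_diagOff_one]) hi₁ entryMean_diagOff_one_le
    (fun τ hτ => (hE τ hτ).ge) (fun τ hτ => ?_) ha haN hs
  rw [hE τ hτ]
  exact le_add_of_nonneg_right (by positivity)

lemma measureReal_gap_Mmat_lt_le [NeZero N] (hN : 2 ≤ N) {i₁ : Fin N} (hi₁ : i₁ ≠ 0)
    {a s : ℝ} (ha : 1 ≤ a) (haN : a ^ 3 = N) (hs : 1 / a ≤ s) :
    (gMeasure N).real {g | a ^ 2 * (evalsM N g 0 - evalsM N g i₁) < s} ≤ 72 * s := by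
  have hE (τ : ℝ) (hτ : 0 ≤ τ) :
      ∫ g, meanTopEig τ (Hmat N (entryMul (diagOff 0 1) g)) ∂(gMeasure N)
        = entryMean (diagOff √τ √(1 + τ) : Fin N → Fin N → ℝ) := by
    refine integral_meanTopEig hτ fun i j => ?_
    simp only [diagOff]
    split_ifs
    · rw [Real.sq_sqrt hτ]; ring
    · rw [Real.sq_sqrt (by linarith : 0 ≤ 1 + τ)]; ring
  have h0 := entryMean_diagOff_zero_le (N := N) 1 1
  refine measureReal_gap_lt_le (Mmat_isHermitian N) (γ := diagOff 0 1) Mmat_eq hi₁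
    (h0.trans entryMean_diagOff_one_le) (fun τ hτ => ?_) (fun τ hτ => ?_) ha haN hs
  · rw [hE τ hτ, ← entryMean_smul (Real.sqrt_nonneg _), smul_diagOff, mul_zero, mul_one]
    exact entryMean_diagOff_zero_le _ _
  · rw [hE τ hτ]
    refine (entryMean_diagOff_le (Real.sqrt_nonneg τ) (Real.sqrt_le_sqrt (by linarith))).trans ?_
    have h := mul_le_mul_of_nonneg_left (entryMean_diagOff_sub_le hN) (Real.sqrt_nonneg τ)
    have e : 4 * √τ / N = √τ * (4 / N) := by ring
    rw [e]
    linarith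

end GapTail

/-- Lemma `lem:lr`: existence of a spacing density at the edge,
for the GOE matrix `H` and its zero-diagonal version `M`. -/
theorem edge_gap_density
    (ε : ℝ) (hε : 0 < ε) :
    ∃ C > (0:ℝ), ∃ N₀ : ℕ, ∀ N : ℕ, N₀ ≤ N → ∀ (hN2 : 2 ≤ N),
    ∀ s : ℝ, (N:ℝ) ^ (-(1:ℝ)/3 + ε) ≤ s → s ≤ 1 →
      ((gMeasure N) {g : Fin N → Fin N → ℝ |
          (N:ℝ) ^ ((2:ℝ)/3) * (evalsH N g ⟨0, by omega⟩ - evalsH N g ⟨1, by omega⟩) < s}).toReal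
        ≤ C * s * (N:ℝ) ^ ε
      ∧
      ((gMeasure N) {g : Fin N → Fin N → ℝ |
          (N:ℝ) ^ ((2:ℝ)/3) * (evalsM N g ⟨0, by omega⟩ - evalsM N g ⟨1, by omega⟩) < s}).toReal
        ≤ C * s * (N:ℝ) ^ ε := by
  refine ⟨72, by norm_num, 0, fun N _ hN2 s hs _ => ?_⟩
  have : NeZero N := ⟨by omega⟩
  have hN1 : (1 : ℝ) ≤ N := by exact_mod_cast (by omega : 1 ≤ N)
  have hN0 : (0 : ℝ) ≤ N := by linarith
  have ha : (1 : ℝ) ≤ (N : ℝ) ^ ((1 : ℝ) / 3) := Real.one_le_rpow hN1 (by norm_num)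
  have ha2 : (N : ℝ) ^ ((2 : ℝ) / 3) = ((N : ℝ) ^ ((1 : ℝ) / 3)) ^ 2 := by
    rw [← Real.rpow_mul_natCast hN0]; norm_num
  have ha3 : ((N : ℝ) ^ ((1 : ℝ) / 3)) ^ 3 = N := by
    rw [← Real.rpow_mul_natCast hN0]; norm_num
  have hs' : 1 / (N : ℝ) ^ ((1 : ℝ) / 3) ≤ s := by
    refine le_trans ?_ hs
    rw [one_div, ← Real.rpow_neg hN0]
    exact Real.rpow_le_rpow_of_exponent_le hN1 (by linarith)
  have hs0 : 0 ≤ s := le_trans (by positivity) hs'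
  have hC : 72 * s ≤ 72 * s * (N : ℝ) ^ ε :=
    le_mul_of_one_le_right (by positivity) (Real.one_le_rpow hN1 hε.le)
  have hi₁ : (⟨1, by omega⟩ : Fin N) ≠ 0 := by
    simp [Fin.ext_iff]
  rw [ha2]
  exact ⟨(measureReal_gap_Hmat_lt_le hi₁ ha ha3 hs').trans hC,
    (measureReal_gap_Mmat_lt_le hN2 hi₁ ha ha3 hs').trans hC⟩

end
end

section
/- Let β>1, c_β = 1/(β−1), and N a positive integer. For every E<0 the equation η(β−1) = (1/N)·arg(E + iη + c_β/N) has a unique strictly positive solution η(E), where arg is the principal argument in (−π,π]. Moreover: (i) there is a constant c₁>0 such that for −c₁/N ≤ E < 0 one has N·η(E) = √(3 c_β |NE|)·(1 + O(|NE|)); (ii) for any c₂>0 there is c₃>0 (depending on c₂) such that E ≤ −c₂/N implies c₃/N ≤ η(E) ≤ π/(N(β−1)). -/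
open Complex

/-- For positive `u`, the equation `u = arg (a + i u)` says that `u < π` and `u cot u = a`. -/
lemma eq_arg_add_mul_I_iff {a u : ℝ} (hu : 0 < u) :
    u = arg ((a : ℂ) + u * I) ↔ u < Real.pi ∧ u * Real.cos u = a * Real.sin u := by
  constructor
  · intro h
    have hre := norm_mul_cos_arg ((a : ℂ) + u * I)
    have him := norm_mul_sin_arg ((a : ℂ) + u * I)
    rw [← h] at hre him
    simp only [add_re, ofReal_re, re_ofReal_mul, I_re, mul_zero, add_zero, add_im, ofReal_im,
      im_ofReal_mul, I_im, mul_one, zero_add] at hre him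
    refine ⟨lt_of_le_of_ne (h ▸ arg_le_pi _) fun hpi => ?_, by
      linear_combination Real.sin u * hre - Real.cos u * him⟩
    rw [hpi, Real.sin_pi, mul_zero] at him
    linarith [Real.pi_pos]
  · rintro ⟨hpi, h⟩
    have hs := Real.sin_pos_of_pos_of_lt_pi hu hpi
    have hz : (a : ℂ) + u * I
        = ((u / Real.sin u : ℝ) : ℂ) * (Complex.cos u + Complex.sin u * I) := by
      have ha : u / Real.sin u * Real.cos u = a := by
        rw [div_mul_eq_mul_div, h, mul_div_cancel_right₀ _ hs.ne']
      have hu' : u / Real.sin u * Real.sin u = u := div_mul_cancel₀ _ hs.ne'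
      rw [← ofReal_cos, ← ofReal_sin, mul_add, ← mul_assoc, ← ofReal_mul, ← ofReal_mul, ha, hu']
    rw [hz, arg_mul_cos_add_sin_mul_I (div_pos hu hs) ⟨by linarith [Real.pi_pos], hpi.le⟩]

/-- The contour equation in the rescaled variable `u = N (β - 1) η`. -/
lemma saddle_equation_iff {β η E : ℝ} {N : ℕ} (hβ : 1 < β) (hN : 0 < N) (hη : 0 < η) :
    η * (β - 1) = (1 / (N:ℝ)) *
        arg ((E:ℂ) + (η:ℂ) * I + ((1 / (β - 1) : ℝ) : ℂ) / (N:ℂ)) ↔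
      N * (β - 1) * η < Real.pi ∧ N * (β - 1) * η * Real.cos (N * (β - 1) * η)
        = (1 + N * (β - 1) * E) * Real.sin (N * (β - 1) * η) := by
  have hN' : (0:ℝ) < N := by exact_mod_cast hN
  have hb : 0 < β - 1 := by linarith
  have hc : 0 < (N:ℝ) * (β - 1) := by positivity
  rw [← eq_arg_add_mul_I_iff (by positivity), ← arg_real_mul _ hc]
  have hz : (((N:ℝ) * (β - 1) : ℝ) : ℂ) *
      ((E:ℂ) + (η:ℂ) * I + ((1 / (β - 1) : ℝ) : ℂ) / (N:ℂ))
      = ((1 + N * (β - 1) * E : ℝ) : ℂ) + ((N * (β - 1) * η : ℝ) : ℂ) * I := by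
    have h1 : (N:ℂ) ≠ 0 := by exact_mod_cast hN.ne'
    have h2 : (β:ℂ) - 1 ≠ 0 := by exact_mod_cast hb.ne'
    push_cast
    field_simp
    ring
  rw [hz, one_div, eq_inv_mul_iff_mul_eq₀ hN'.ne', ← mul_assoc, mul_right_comm]

lemma sin_sub_mul_cos_nonneg {u : ℝ} (h0 : 0 ≤ u) (hpi : u ≤ Real.pi) :
    0 ≤ Real.sin u - u * Real.cos u := by
  have hmono : MonotoneOn (fun x : ℝ => Real.sin x - x * Real.cos x) (Set.Icc 0 Real.pi) := by
    refine monotoneOn_of_hasDerivWithinAt_nonneg (f' := fun x => x * Real.sin x)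
      (convex_Icc _ _) (by fun_prop) (fun x _ => ?_) fun x hx => ?_
    · have := ((Real.hasDerivAt_sin x).sub ((hasDerivAt_id x).mul (Real.hasDerivAt_cos x)))
      exact (this.congr_deriv (by simp)).hasDerivWithinAt
    · rw [interior_Icc] at hx
      exact mul_nonneg hx.1.le (Real.sin_nonneg_of_nonneg_of_le_pi hx.1.le hx.2.le)
  simpa using hmono ⟨le_rfl, Real.pi_pos.le⟩ ⟨h0, hpi⟩ h0

/-- `u cot u ≤ 1 - u² / 3` on `(0, π)`. -/
lemma mul_cos_le {u : ℝ} (h0 : 0 ≤ u) (hpi : u ≤ Real.pi) :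
    u * Real.cos u ≤ (1 - u ^ 2 / 3) * Real.sin u := by
  have hmono : MonotoneOn (fun x : ℝ => (1 - x ^ 2 / 3) * Real.sin x - x * Real.cos x)
      (Set.Icc 0 Real.pi) := by
    refine monotoneOn_of_hasDerivWithinAt_nonneg
      (f' := fun x => x / 3 * (Real.sin x - x * Real.cos x))
      (convex_Icc _ _) (by fun_prop) (fun x _ => ?_) fun x hx => ?_
    · have := (((((hasDerivAt_id x).pow 2).div_const 3).const_sub 1).mul
        (Real.hasDerivAt_sin x)).sub ((hasDerivAt_id x).mul (Real.hasDerivAt_cos x))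
      exact (this.congr_deriv (by simp; ring)).hasDerivWithinAt
    · rw [interior_Icc] at hx
      exact mul_nonneg (by linarith [hx.1]) (sin_sub_mul_cos_nonneg hx.1.le hx.2.le)
  have := hmono ⟨le_rfl, Real.pi_pos.le⟩ ⟨h0, hpi⟩ h0
  simp at this
  linarith

/-- `1 - u² / 3 - u⁴ / 12 ≤ u cot u` on `(0, 1]`. -/
lemma le_mul_cos {u : ℝ} (h0 : 0 ≤ u) (h1 : u ≤ 1) :
    (1 - u ^ 2 / 3 - u ^ 4 / 12) * Real.sin u ≤ u * Real.cos u := by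
  have hmono : MonotoneOn
      (fun x : ℝ => x * Real.cos x - (1 - x ^ 2 / 3 - x ^ 4 / 12) * Real.sin x)
      (Set.Icc 0 1) := by
    refine monotoneOn_of_hasDerivWithinAt_nonneg
      (f' := fun x => x / 3 * (x ^ 2 * Real.sin x - (Real.sin x - x * Real.cos x))
        + x ^ 4 / 12 * Real.cos x)
      (convex_Icc _ _) (by fun_prop) (fun x _ => ?_) fun x hx => ?_
    · have := ((hasDerivAt_id x).mul (Real.hasDerivAt_cos x)).sub
        ((((((hasDerivAt_id x).pow 2).div_const 3).const_sub 1).sub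
          (((hasDerivAt_id x).pow 4).div_const 12)).mul (Real.hasDerivAt_sin x))
      exact (this.congr_deriv (by simp; ring)).hasDerivWithinAt
    · rw [interior_Icc] at hx
      obtain ⟨hx0, hx1⟩ := hx
      have hcos := Real.one_sub_sq_div_two_le_cos (x := x)
      have hcos0 : 0 ≤ Real.cos x := by nlinarith
      have hsin := Real.sin_le hx0.le
      have hsin' : x / 2 ≤ Real.sin x := by
        have := Real.sin_gt_sub_cube hx0
        nlinarith [mul_pos hx0 (sub_pos.2 hx1), mul_pos hx0 hx0]
      have hxc := mul_le_mul_of_nonneg_left hcos hx0.le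
      have hxs := mul_le_mul_of_nonneg_left hsin' (sq_nonneg x)
      have : 0 ≤ x ^ 2 * Real.sin x - (Real.sin x - x * Real.cos x) := by nlinarith
      positivity
  have := hmono ⟨le_rfl, zero_le_one⟩ ⟨h0, h1⟩ h0
  simp at this
  linarith

lemma strictAntiOn_mul_cos_div_sin :
    StrictAntiOn (fun u : ℝ => u * Real.cos u / Real.sin u) (Set.Ioo 0 Real.pi) := by
  have hsin : ∀ x ∈ Set.Ioo 0 Real.pi, 0 < Real.sin x :=
    fun x hx => Real.sin_pos_of_pos_of_lt_pi hx.1 hx.2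
  refine strictAntiOn_of_hasDerivWithinAt_neg
    (f' := fun x => (Real.sin x * Real.cos x - x) / Real.sin x ^ 2)
    (convex_Ioo _ _) ?_ (fun x hx => ?_) fun x hx => ?_
  · exact ContinuousOn.div (by fun_prop) (by fun_prop) fun x hx => (hsin x hx).ne'
  · rw [interior_Ioo] at hx
    have := ((hasDerivAt_id x).mul (Real.hasDerivAt_cos x)).div (Real.hasDerivAt_sin x)
      (hsin x hx).ne'
    refine (this.congr_deriv ?_).hasDerivWithinAt
    simp only [id, Pi.mul_apply]
    congr 1
    linear_combination (-x) * Real.sin_sq_add_cos_sq x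
  · rw [interior_Ioo] at hx
    have h1 := Real.sin_lt hx.1
    have h2 := Real.cos_le_one x
    have h3 := hsin x hx
    exact div_neg_of_neg_of_pos (by nlinarith) (by positivity)

/-- `u cot u = 1 - t` has a solution in `(0, π)` for every `t > 0`. -/
lemma exists_mul_cos_eq {t : ℝ} (ht : 0 < t) :
    ∃ u, 0 < u ∧ u < Real.pi ∧ u * Real.cos u = (1 - t) * Real.sin u := by
  set v := min 1 t
  have hv0 : 0 < v := lt_min one_pos ht
  have hv1 : v ≤ 1 := min_le_left _ _
  have hvt : v ≤ t := min_le_right _ _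
  have hvpi : v ≤ Real.pi := by linarith [Real.pi_gt_three]
  have hs : 0 < Real.sin v := Real.sin_pos_of_pos_of_le_one hv0 hv1
  have hle : v ^ 2 / 3 + v ^ 4 / 12 ≤ t := by
    have h2 : v ^ 2 ≤ v := pow_le_of_le_one hv0.le hv1 two_ne_zero
    have h4 : v ^ 4 ≤ v := pow_le_of_le_one hv0.le hv1 four_ne_zero
    linarith
  have hpos : 0 ≤ v * Real.cos v - (1 - t) * Real.sin v := by
    have := le_mul_cos hv0.le hv1
    nlinarith
  obtain ⟨u, hu, hu0⟩ := intermediate_value_Icc' hvpi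
    (f := fun x => x * Real.cos x - (1 - t) * Real.sin x) (by fun_prop)
    (show (0:ℝ) ∈ _ from ⟨by simp [Real.pi_pos.le], hpos⟩)
  refine ⟨u, hv0.trans_le hu.1, lt_of_le_of_ne hu.2 ?_, by linarith⟩
  rintro rfl
  simp [Real.pi_ne_zero] at hu0

/-- Solutions of `u cot u = 1 - t` in `(0, π)` are monotone in `t`. -/
lemma le_of_mul_cos_eq {s t u v : ℝ} (hst : s ≤ t) (hu0 : 0 < u) (hu : u < Real.pi)
    (hv0 : 0 < v) (hv : v < Real.pi) (hus : u * Real.cos u = (1 - s) * Real.sin u)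
    (hvt : v * Real.cos v = (1 - t) * Real.sin v) : u ≤ v := by
  rw [← strictAntiOn_mul_cos_div_sin.le_iff_ge ⟨hv0, hv⟩ ⟨hu0, hu⟩]
  simp only [hus, hvt]
  rw [mul_div_cancel_right₀ _ (Real.sin_pos_of_pos_of_lt_pi hu0 hu).ne',
    mul_div_cancel_right₀ _ (Real.sin_pos_of_pos_of_lt_pi hv0 hv).ne']
  linarith

/-- The solution of `u cot u = 1 - t` is `√(3 t) (1 + O(t))` for small `t`. -/
lemma abs_sub_sqrt_le {t u : ℝ} (ht : 0 < t) (ht' : t ≤ 1 / 3) (hu0 : 0 < u)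
    (hu : u < Real.pi) (h : u * Real.cos u = (1 - t) * Real.sin u) :
    |u - √(3 * t)| ≤ √(3 * t) * t := by
  have hs := Real.sin_pos_of_pos_of_lt_pi hu0 hu
  have hlow : u ^ 2 ≤ 3 * t := by
    have := le_of_mul_le_mul_right (h ▸ mul_cos_le hu0.le hu.le) hs
    linarith
  have hu1 : u ≤ 1 := by nlinarith
  have hup : 3 * t ≤ u ^ 2 + u ^ 4 / 4 := by
    have := le_of_mul_le_mul_right (h ▸ le_mul_cos hu0.le hu1) hs
    linarith
  have hule : u ≤ √(3 * t) := Real.le_sqrt_of_sq_le hlow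
  have hsq : √(3 * t) ^ 2 = 3 * t := Real.sq_sqrt (by positivity)
  have hr : 0 < √(3 * t) := by positivity
  rw [abs_sub_comm, abs_of_nonneg (by linarith)]
  have h4 : u ^ 4 ≤ (3 * t) ^ 2 := by nlinarith [sq_nonneg u]
  refine le_of_mul_le_mul_right ?_ hr
  nlinarith [mul_nonneg hu0.le (sub_nonneg.2 hule)]

/-- Lemma `lem: saddle-lemma`: existence, uniqueness and asymptotics of
the steepest-descent contour `η(E)` solving `η(β-1) = N⁻¹ arg(E + iη + c_β/N)`,
with `c_β = 1/(β-1)` and `arg` the principal argument valued in `(-π, π]`. -/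
theorem saddle_contour_eta
    (β : ℝ) (hβ : 1 < β) (cβ : ℝ) (hcβ : cβ = 1 / (β - 1)) :
    -- uniqueness of the strictly positive solution
    (∀ N : ℕ, 0 < N → ∀ E : ℝ, E < 0 →
      ∃! η : ℝ, 0 < η ∧
        η * (β - 1) = (1 / (N:ℝ)) * Complex.arg ((E:ℂ) + (η:ℂ) * Complex.I + (cβ:ℂ) / (N:ℂ)))
    ∧
    -- asymptotics near E = 0: N η(E) = √(3 c_β |NE|) (1 + O(|NE|))
    (∃ c₁ > (0:ℝ), ∃ C > (0:ℝ), ∀ N : ℕ, 0 < N → ∀ E : ℝ,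
      -c₁ / (N:ℝ) ≤ E → E < 0 → ∀ η : ℝ, 0 < η →
      η * (β - 1) = (1 / (N:ℝ)) * Complex.arg ((E:ℂ) + (η:ℂ) * Complex.I + (cβ:ℂ) / (N:ℂ)) →
      |(N:ℝ) * η - Real.sqrt (3 * cβ * |(N:ℝ) * E|)|
        ≤ C * Real.sqrt (3 * cβ * |(N:ℝ) * E|) * |(N:ℝ) * E|)
    ∧
    -- away from E = 0: `c₃/N ≤ η(E) ≤ π/(N(β-1))`
    (∀ c₂ : ℝ, 0 < c₂ → ∃ c₃ > (0:ℝ), ∀ N : ℕ, 0 < N → ∀ E : ℝ,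
      E ≤ -c₂ / (N:ℝ) → ∀ η : ℝ, 0 < η →
      η * (β - 1) = (1 / (N:ℝ)) * Complex.arg ((E:ℂ) + (η:ℂ) * Complex.I + (cβ:ℂ) / (N:ℂ)) →
      c₃ / (N:ℝ) ≤ η ∧ η ≤ Real.pi / ((N:ℝ) * (β - 1))) := by
  subst hcβ
  have hb : 0 < β - 1 := by linarith
  refine ⟨fun N hN E hE => ?_, ?_, fun c₂ hc₂ => ?_⟩
  · have hN' : (0:ℝ) < N := by exact_mod_cast hN
    have hc : 0 < (N:ℝ) * (β - 1) := by positivity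
    obtain ⟨u, hu0, hupi, hu⟩ := exists_mul_cos_eq (mul_pos hc (neg_pos.2 hE))
    have heq : (N:ℝ) * (β - 1) * (u / (N * (β - 1))) = u := mul_div_cancel₀ _ hc.ne'
    have hη : 0 < u / (N * (β - 1)) := by positivity
    refine ⟨u / (N * (β - 1)), ⟨hη, ?_⟩, ?_⟩
    · rw [saddle_equation_iff hβ hN hη, heq]
      exact ⟨hupi, by linarith⟩
    · rintro y ⟨hy0, hy⟩
      rw [saddle_equation_iff hβ hN hy0] at hy
      have hy' : 0 < (N:ℝ) * (β - 1) * y := by positivity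
      have hye : (N:ℝ) * (β - 1) * y * Real.cos (N * (β - 1) * y)
          = (1 - N * (β - 1) * -E) * Real.sin (N * (β - 1) * y) := by linarith [hy.2]
      rw [eq_div_iff hc.ne', mul_comm y]
      exact le_antisymm (le_of_mul_cos_eq le_rfl hy' hy.1 hu0 hupi hye hu)
        (le_of_mul_cos_eq le_rfl hu0 hupi hy' hy.1 hu hye)
  · refine ⟨1 / (3 * (β - 1)), by positivity, β - 1, hb, fun N hN E hE hE0 η hη h => ?_⟩
    have hN' : (0:ℝ) < N := by exact_mod_cast hN
    rw [saddle_equation_iff hβ hN hη] at h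
    have hx : 0 < |(N:ℝ) * E| := abs_pos.2 (mul_neg_of_pos_of_neg hN' hE0).ne
    have habs : |(N:ℝ) * E| = -(N * E) := abs_of_neg (mul_neg_of_pos_of_neg hN' hE0)
    set x := |(N:ℝ) * E|
    have hxle : (β - 1) * x ≤ 1 / 3 := by
      rw [div_le_iff₀ hN'] at hE
      have : x ≤ 1 / (3 * (β - 1)) := by linarith
      rw [le_div_iff₀ (by positivity)] at this
      linarith
    have key := abs_sub_sqrt_le (mul_pos hb hx) hxle (by positivity) h.1
      (by rw [habs]; linarith [h.2])
    have hsqrt : √(3 * ((β - 1) * x)) = (β - 1) * √(3 * (1 / (β - 1)) * x) := by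
      rw [← Real.sqrt_sq hb.le, ← Real.sqrt_mul (sq_nonneg _), Real.sqrt_sq hb.le]
      congr 1
      field_simp
    rw [hsqrt, show (N:ℝ) * (β - 1) * η = (β - 1) * (N * η) by ring, ← mul_sub, abs_mul,
      abs_of_pos hb, mul_assoc (β - 1)] at key
    linarith [le_of_mul_le_mul_left key hb]
  · obtain ⟨u, hu0, hupi, hu⟩ := exists_mul_cos_eq (mul_pos hb hc₂)
    refine ⟨u / (β - 1), by positivity, fun N hN E hE η hη h => ?_⟩
    have hN' : (0:ℝ) < N := by exact_mod_cast hN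
    rw [saddle_equation_iff hβ hN hη] at h
    rw [le_div_iff₀ hN'] at hE
    have hle : u ≤ N * (β - 1) * η :=
      le_of_mul_cos_eq (t := (β - 1) * -(E * N)) (by gcongr; linarith) hu0 hupi
        (by positivity) h.1 hu (by linarith [h.2])
    rw [div_div, div_le_iff₀ (by positivity), le_div_iff₀ (by positivity)]
    exact ⟨by linarith, by linarith [h.1]⟩
end

section
/- Let β>1, c_β=1/(β−1), and for E<0 let η(E) be the unique positive solution of η(β−1) = (1/N)·arg(E + iη + c_β/N). For any c₁>0 there is c₂>0 such that for all positive integers N and all E ≤ −c₁/N, β − 1 − (1/N)·(E + c_β/N)/((E + c_β/N)² + η(E)²) ≥ c₂. -/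
open Complex

/-- If `z` lies in the upper half plane and `arg z = k * im z`, then `1 ≤ k² |z|²`. -/
theorem one_le_sq_mul_normSq_of_arg_eq {z : ℂ} {k : ℝ} (hz : 0 < z.im)
    (h : z.arg = k * z.im) : 1 ≤ k ^ 2 * (z.re ^ 2 + z.im ^ 2) := by
  have hz0 : z ≠ 0 := by
    rintro rfl
    simp at hz
  have hn : 0 < ‖z‖ := norm_pos_iff.mpr hz0
  have hsin : z.im / ‖z‖ ≤ k * z.im := by
    rw [← Complex.sin_arg, ← h]
    exact Real.sin_le (Complex.arg_nonneg_iff.mpr hz.le)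
  rw [div_le_iff₀ hn] at hsin
  have h1 : 1 ≤ k * ‖z‖ := by
    by_contra! hlt
    nlinarith
  have hsq : ‖z‖ ^ 2 = z.re ^ 2 + z.im ^ 2 := by
    rw [Complex.sq_norm, Complex.normSq_apply]
    ring
  rw [← hsq, ← mul_pow]
  exact one_le_pow₀ h1

/-- Lemma `lem:rega1`: a lower bound along the steepest-descent contour,
where `η(E)` is the unique positive solution of `η(β-1) = N⁻¹ arg(E + iη + c_β/N)` and
`c_β = 1/(β-1)`. -/
theorem saddle_contour_lower_bound
    (β : ℝ) (hβ : 1 < β) (cβ : ℝ) (hcβ : cβ = 1 / (β - 1)) :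
    ∀ c₁ : ℝ, 0 < c₁ → ∃ c₂ > (0:ℝ), ∀ N : ℕ, 0 < N → ∀ E : ℝ, E ≤ -c₁ / (N:ℝ) →
      ∀ η : ℝ, 0 < η →
      η * (β - 1) = (1 / (N:ℝ)) * Complex.arg ((E:ℂ) + (η:ℂ) * Complex.I + (cβ:ℂ) / (N:ℂ)) →
      β - 1 - (1 / (N:ℝ)) * ((E + cβ / N) / ((E + cβ / N) ^ 2 + η ^ 2)) ≥ c₂ := by
  intro c₁ hc₁
  have hb : 0 < β - 1 := sub_pos.mpr hβ
  refine ⟨min (β - 1) ((β - 1) ^ 2 * c₁), lt_min hb (by positivity), ?_⟩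
  intro N hN E hE η hη harg
  have hN' : (0 : ℝ) < N := Nat.cast_pos.mpr hN
  set X : ℝ := E + cβ / N with hX
  have hz : (E : ℂ) + (η : ℂ) * Complex.I + (cβ : ℂ) / (N : ℂ) = ⟨X, η⟩ := by
    rw [Complex.mk_eq_add_mul_I, hX]
    push_cast
    ring
  rw [hz] at harg
  have hkey : 1 ≤ (N * (β - 1)) ^ 2 * (X ^ 2 + η ^ 2) := by
    refine one_le_sq_mul_normSq_of_arg_eq (z := ⟨X, η⟩) hη ?_
    rw [one_div, inv_mul_eq_div, eq_div_iff hN'.ne'] at harg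
    simp only
    linarith
  have hD : 0 < X ^ 2 + η ^ 2 := by positivity
  rcases le_or_gt X 0 with hX0 | hX0
  · have : 1 / (N : ℝ) * (X / (X ^ 2 + η ^ 2)) ≤ 0 :=
      mul_nonpos_of_nonneg_of_nonpos (by positivity) (div_nonpos_of_nonpos_of_nonneg hX0 hD.le)
    linarith [min_le_left (β - 1) ((β - 1) ^ 2 * c₁)]
  · have hNX : N * X ≤ 1 / (β - 1) - c₁ := by
      rw [le_div_iff₀ hN'] at hE
      have : N * X = E * N + cβ := by
        rw [hX]
        field_simp
      linarith
    have hquot : 1 / (N : ℝ) * (X / (X ^ 2 + η ^ 2)) ≤ (β - 1) ^ 2 * (N * X) := by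
      rw [div_mul_div_comm, one_mul, div_le_iff₀ (by positivity)]
      nlinarith [mul_le_mul_of_nonneg_left hkey hX0.le]
    have hbound : (β - 1) ^ 2 * (N * X) ≤ (β - 1) - (β - 1) ^ 2 * c₁ :=
      (mul_le_mul_of_nonneg_left hNX (sq_nonneg _)).trans_eq (by field_simp)
    linarith [min_le_right (β - 1) ((β - 1) ^ 2 * c₁)]
end
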